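/- Let K be a number field of degree greater than 1 having at least one real embedding, and let 𝔱 and 𝔪 be nonzero ideals of O_K. Then Γ₁(𝔱, 𝔱𝔪) is contained in the subgroup of GL₂(K) generated by the matrices (1, b; 0, 1) for b∈𝔱⁻¹, (1, 0; c, 1) for c∈𝔱𝔪, and (ε, 0; 0, 1) for ε∈O_K^×. Likewise, Γ₁⁺(𝔱, 𝔱𝔪) is contained in the subgroup generated by the same elementary matrices together with (ε, 0; 0, 1) for ε a totally positive unit of O_K. -/

import Mathlib

set_option linter.unusedSectionVars false
set_option linter.unusedSimpArgs false

namespace VL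
open NumberField InfinitePlace Polynomial

section units
variable {K : Type*} [Field K] [NumberField K]

open scoped Classical in
/-- signed factor of the norm -/
noncomputable def locN (w : InfinitePlace K) (x : K) : ℝ :=
  if hw : IsReal w then embedding_of_isReal hw x else (w x) ^ 2

theorem norm_eq_prod_locN (x : K) : ((Algebra.norm ℚ x : ℚ) : ℝ) = ∏ w, locN w x := by
  classical
  have h := Algebra.norm_eq_prod_embeddings ℚ ℂ x
  rw [← Fintype.prod_equiv (RingHom.equivRatAlgHom K ℂ) (fun f => f x)
      (fun φ => φ x) fun _ => by simp [RingHom.equivRatAlgHom_apply]] at h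
  rw [← Finset.prod_fiberwise Finset.univ InfinitePlace.mk (fun φ => φ x)] at h
  have key : ∀ w : InfinitePlace K,
      ∏ φ with InfinitePlace.mk φ = w, φ x = ((locN w x : ℝ) : ℂ) := by
    intro w
    have hset : (Finset.univ.filter fun φ : K →+* ℂ => InfinitePlace.mk φ = w)
        = {embedding w, ComplexEmbedding.conjugate (embedding w)} := by
      ext φ
      simp only [Finset.mem_filter, Finset.mem_univ, true_and, Finset.mem_insert,
        Finset.mem_singleton]
      conv_lhs => rw [← mk_embedding w, mk_eq_iff, ComplexEmbedding.conjugate,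
        star_involutive.eq_iff]
    rw [hset]
    unfold locN
    split_ifs with hw
    · rw [ComplexEmbedding.isReal_iff.mp (isReal_iff.mp hw), Finset.pair_eq_singleton,
        Finset.prod_singleton, embedding_of_isReal_apply]
    · rw [Finset.prod_pair]
      · rw [ComplexEmbedding.conjugate_coe_eq, Complex.mul_conj, Complex.normSq_eq_norm_sq,
          norm_embedding_eq]
      · rwa [Ne, eq_comm, ← ComplexEmbedding.isReal_iff, ← isReal_iff]
  rw [Finset.prod_congr rfl fun w _ => key w] at h
  have : (((Algebra.norm ℚ x : ℚ) : ℝ) : ℂ) = ((∏ w, locN w x : ℝ) : ℂ) := by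
    push_cast; rw [← h]; simp
  exact_mod_cast this

theorem norm_pos_of_totPos (x : K) (hx : x ≠ 0) (h : ∀ φ : K →+* ℝ, 0 < φ x) :
    0 < Algebra.norm ℚ x := by
  have : (0:ℝ) < ((Algebra.norm ℚ x : ℚ) : ℝ) := by
    rw [norm_eq_prod_locN]
    refine Finset.prod_pos fun w _ => ?_
    unfold locN
    split_ifs with hw
    · exact h _
    · have := (InfinitePlace.pos_iff (w := w)).mpr hx; positivity
  exact_mod_cast this

/-- the unit -/
theorem exists_unit (hdeg : 1 < Module.finrank ℚ K) (hreal : Nonempty (K →+* ℝ)) :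
    ∃ ε : (𝓞 K)ˣ, ∃ w₁ : InfinitePlace K, IsReal w₁ ∧ ∀ w : InfinitePlace K, w ≠ w₁ →
      w ((ε : 𝓞 K) : K) < 1 := by
  obtain ⟨φ⟩ := hreal
  have hφ : ComplexEmbedding.IsReal (Complex.ofRealHom.comp φ) := by
    rw [ComplexEmbedding.isReal_iff]
    ext x; simp [ComplexEmbedding.conjugate_coe_eq]
  let w₁ := InfinitePlace.mk (Complex.ofRealHom.comp φ)
  obtain ⟨u, hu⟩ := NumberField.Units.dirichletUnitTheorem.exists_unit K w₁
  refine ⟨u, w₁, ⟨_, hφ, rfl⟩, fun w hw => ?_⟩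
  have := hu w hw
  by_contra hc
  exact absurd (Real.log_nonneg (not_lt.1 hc)) (not_le.2 this)

theorem adjoin_top {x : 𝓞 K} {w : InfinitePlace K} (hw : IsReal w) (h0 : x ≠ 0)
    (h : ∀ w', w' ≠ w → w' (x : K) < 1) :
    ∃ f : ℕ, 0 < f ∧ ∀ y : 𝓞 K, (f : 𝓞 K) * y ∈ Algebra.adjoin ℤ {x} := by
  have htop := NumberField.is_primitive_element_of_infinitePlace_lt h0 (fun w' hw' => h w' hw')
    (Or.inl hw)
  have key : ∀ y : 𝓞 K, ∃ f : ℕ, 0 < f ∧ (f : 𝓞 K) * y ∈ Algebra.adjoin ℤ {x} := by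
    intro y
    have hy : (y : K) ∈ (IntermediateField.adjoin ℚ {(x : K)}) := by rw [htop]; trivial
    have hinteg : IsIntegral ℚ (x : K) := Algebra.IsIntegral.isIntegral _
    rw [← IntermediateField.mem_toSubalgebra,
      IntermediateField.adjoin_simple_toSubalgebra_of_isAlgebraic hinteg.isAlgebraic,
      Algebra.adjoin_singleton_eq_range_aeval] at hy
    obtain ⟨p, hp⟩ := hy
    obtain ⟨b, hb0, hb⟩ := IsLocalization.integerNormalization_spec (nonZeroDivisors ℤ) p
    set q := IsLocalization.integerNormalization (nonZeroDivisors ℤ) p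
    have hbne : (b : ℤ) ≠ 0 := nonZeroDivisors.ne_zero hb0
    have h1 : ((b : ℤ) : 𝓞 K) * y = aeval x q := by
      apply RingOfIntegers.ext
      have h2 := congrArg (aeval (x : K)) hb
      rw [aeval_map_algebraMap] at h2
      have h3 : aeval (x:K) q = algebraMap (𝓞 K) K (aeval x q) := by
        rw [← aeval_algebraMap_apply]
      rw [h3] at h2
      change aeval (x:K) p = _ at hp
      refine Eq.trans ?_ h2.symm
      rw [map_zsmul, hp]
      simp
    refine ⟨(b:ℤ).natAbs, Int.natAbs_pos.2 hbne, ?_⟩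
    have h4 : ((b : ℤ) : 𝓞 K) * y ∈ Algebra.adjoin ℤ {x} := by
      rw [h1, Algebra.adjoin_singleton_eq_range_aeval]; exact ⟨q, rfl⟩
    rcases Int.natAbs_eq (b:ℤ) with h | h
    · have h5 : (((b:ℤ).natAbs : ℕ) : 𝓞 K) = ((b : ℤ) : 𝓞 K) := by
        conv_rhs => rw [h]
        simp
      rw [h5]; exact h4
    · have h5 : (((b:ℤ).natAbs : ℕ) : 𝓞 K) = -((b : ℤ) : 𝓞 K) := by
        conv_rhs => rw [h]
        simp
      rw [h5, neg_mul]; exact neg_mem h4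
  have hfg : (⊤ : Submodule ℤ (𝓞 K)).FG := Module.Finite.fg_top
  obtain ⟨s, hs⟩ := hfg
  classical
  choose F hF0 hF using key
  refine ⟨∏ y ∈ s, F y, Finset.prod_pos fun y _ => hF0 y, fun y => ?_⟩
  have hy : y ∈ Submodule.span ℤ (s : Set (𝓞 K)) := by rw [hs]; trivial
  induction hy using Submodule.span_induction with
  | mem z hz =>
    rw [← Finset.prod_erase_mul s F hz]
    push_cast
    rw [mul_assoc]
    refine mul_mem ?_ (hF z)
    exact prod_mem fun i _ => natCast_mem _ _
  | zero => simp
  | add a b _ _ ha hb => rw [mul_add]; exact add_mem ha hb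
  | smul a b _ hb =>
    rw [mul_smul_comm]; exact Subalgebra.smul_mem _ hb a

theorem unit_lemma (hdeg : 1 < Module.finrank ℚ K) (hreal : Nonempty (K →+* ℝ)) :
    ∃ ε : (𝓞 K)ˣ, ∀ j : ℕ, 0 < j → ε ^ j ≠ 1 ∧ ∃ f : ℕ, 0 < f ∧
      ∀ y : 𝓞 K, (f : 𝓞 K) * y ∈ Algebra.adjoin ℤ {((ε ^ j : (𝓞 K)ˣ) : 𝓞 K)} := by
  obtain ⟨ε, w₁, hw₁, h⟩ := exists_unit hdeg hreal
  refine ⟨ε, fun j hj => ?_⟩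
  have hlt : ∀ w, w ≠ w₁ → w (((ε ^ j : (𝓞 K)ˣ) : 𝓞 K) : K) < 1 := by
    intro w hw
    push_cast
    rw [map_pow]
    exact pow_lt_one₀ (apply_nonneg _ _) (h w hw) hj.ne'
  refine ⟨fun h1 => ?_, adjoin_top hw₁ (Units.ne_zero _) hlt⟩
  have htop := NumberField.is_primitive_element_of_infinitePlace_lt (Units.ne_zero (ε^j))
    (fun w' hw' => hlt w' hw') (Or.inl hw₁)
  rw [h1] at htop
  have h2 : ((((1 : (𝓞 K)ˣ) : 𝓞 K) : K)) = 1 := by simp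
  rw [h2, IntermediateField.adjoin_one] at htop
  have h3 := IntermediateField.finrank_bot (F := ℚ) (E := K)
  have h4 := IntermediateField.finrank_eq_one_iff (F := ℚ) (E := K) (K := ⊤)
  rw [htop] at h3
  rw [IntermediateField.finrank_top'] at h3
  omega

theorem exists_neg_norm (hdeg : 1 < Module.finrank ℚ K) (hreal : Nonempty (K →+* ℝ))
    (m : ℕ) (hm : 0 < m) :
    ∃ y : 𝓞 K, (m : 𝓞 K) ∣ y - 1 ∧ Algebra.norm ℤ y < 0 := by
  obtain ⟨ε, w₁, hw₁, h⟩ := exists_unit hdeg hreal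
  have h1 : 1 ≤ w₁ ((ε : 𝓞 K) : K) := one_le_of_lt_one (Units.ne_zero ε) (fun z hz => h z hz)
  have h1' : 1 < w₁ ((ε : 𝓞 K) : K) := by
    refine lt_of_le_of_ne h1 fun heq => ?_
    have hprod := InfinitePlace.prod_eq_abs_norm ((ε : 𝓞 K) : K)
    have hu1 : |Algebra.norm ℚ ((ε : 𝓞 K) : K)| = 1 := by
      have := NumberField.isUnit_iff_norm.1 ε.isUnit
      simpa using this
    rw [hu1] at hprod
    have hne : ∃ w : InfinitePlace K, w ≠ w₁ := by
      by_contra hc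
      push Not at hc
      have := InfinitePlace.sum_mult_eq (K := K)
      have h2 : (Finset.univ : Finset (InfinitePlace K)) = {w₁} := by
        ext w; simp [hc w]
      rw [h2, Finset.sum_singleton, hw₁.mult_eq_one] at this
      omega
    obtain ⟨w, hw⟩ := hne
    have hlt : ∏ w : InfinitePlace K, w ((ε : 𝓞 K) : K) ^ mult w < 1 := by
      rw [← Finset.prod_const_one (s := (Finset.univ : Finset (InfinitePlace K)))]
      refine Finset.prod_lt_prod (fun z _ => ?_) (fun z _ => ?_) ⟨w, Finset.mem_univ _, ?_⟩
      · exact pow_pos (InfinitePlace.pos_iff.2 (by simp)) _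
      · by_cases hz : z = w₁
        · rw [hz, ← heq]; simp
        · exact pow_le_one₀ (apply_nonneg _ _) (h z hz).le
      · exact pow_lt_one₀ (apply_nonneg _ _) (h w hw) mult_ne_zero
    rw [hprod] at hlt
    simp at hlt
  obtain ⟨j, hj⟩ := pow_unbounded_of_one_lt (4:ℝ) h1'
  have hj0 : j ≠ 0 := by rintro rfl; norm_num at hj
  refine ⟨1 + (m : 𝓞 K) * (2 - (ε : 𝓞 K) ^ (2 * j)), ⟨2 - (ε : 𝓞 K) ^ (2 * j), by ring⟩, ?_⟩
  classical
  have hneg : ((Algebra.norm ℚ (((1 + (m : 𝓞 K) * (2 - (ε : 𝓞 K) ^ (2 * j)) : 𝓞 K)) : K) : ℚ) : ℝ) < 0 := by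
    have hm' : (1:ℝ) ≤ m := by exact_mod_cast hm
    rw [norm_eq_prod_locN, ← Finset.mul_prod_erase _ _ (Finset.mem_univ w₁)]
    refine mul_neg_of_neg_of_pos ?_ (Finset.prod_pos fun w hw => ?_)
    · unfold locN
      rw [dif_pos hw₁]
      simp only [map_add, map_mul, map_sub, map_pow, map_one, map_natCast, map_ofNat]
      set e := embedding_of_isReal hw₁ ((ε : 𝓞 K) : K) with he
      have h5 : |e| = w₁ ((ε : 𝓞 K) : K) := norm_embedding_of_isReal hw₁ _
      have h6 : (4:ℝ) < e ^ (2*j) := by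
        rw [pow_mul, ← sq_abs, h5, ← pow_mul, mul_comm, pow_mul]
        nlinarith
      nlinarith
    · have hw' := Finset.ne_of_mem_erase hw
      unfold locN
      have h7 : w (((ε : 𝓞 K) : K) ^ (2*j)) < 1 := by
        rw [map_pow]; exact pow_lt_one₀ (apply_nonneg _ _) (h w hw') (by omega)
      split_ifs with hwr
      · simp only [map_add, map_mul, map_sub, map_pow, map_one, map_natCast, map_ofNat]
        rw [← norm_embedding_of_isReal hwr, map_pow] at h7
        have := (abs_lt.1 h7).2
        nlinarith
      · have hne : (((1 + (m : 𝓞 K) * (2 - (ε : 𝓞 K) ^ (2 * j)) : 𝓞 K)) : K) ≠ 0 := by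
          intro h0
          have h8 : (1 + (m:K) * 2) = (m:K) * ((ε : 𝓞 K) : K) ^ (2*j) := by
            simp only [map_add, map_mul, map_sub, map_pow, map_one, map_natCast, map_ofNat] at h0
            linear_combination h0
          have h9 := congrArg w h8
          rw [map_mul] at h9
          have h10 : w (m:K) = m := InfinitePlace.map_natCast w m
          have h11 : w (1 + (m:K)*2) = 1 + m * 2 := by
            have := InfinitePlace.map_natCast w (1 + m * 2)
            push_cast at this
            exact this
          rw [h10, h11] at h9
          nlinarith
        have := (InfinitePlace.pos_iff (w := w)).mpr hne
        positivity
  have := Algebra.coe_norm_int (K := K) (1 + (m : 𝓞 K) * (2 - (ε : 𝓞 K) ^ (2 * j)))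
  rw [← this] at hneg
  exact_mod_cast hneg

end units
end VL

namespace VL
open NumberField InfinitePlace

section logspace
variable {K : Type*} [Field K] [NumberField K]

/-- logarithmic vector -/
noncomputable def LV (y : 𝓞 K) : InfinitePlace K → ℝ := fun w => Real.log (w (y : K))

/-- weighted trace -/
noncomputable def tr (x : InfinitePlace K → ℝ) : ℝ := ∑ w, (mult w : ℝ) * x w

/-- centered vector -/
noncomputable def cen (x : InfinitePlace K → ℝ) : InfinitePlace K → ℝ :=
  fun w => x w - tr x / Module.finrank ℚ K

theorem finrank_pos' : (0:ℝ) < Module.finrank ℚ K := by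
  exact_mod_cast Module.finrank_pos (R := ℚ) (M := K)

theorem w_ne {y : 𝓞 K} (hy : y ≠ 0) (w : InfinitePlace K) : w (y : K) ≠ 0 :=
  (map_ne_zero w).2 (by simpa using hy)

theorem w_pos {y : 𝓞 K} (hy : y ≠ 0) (w : InfinitePlace K) : 0 < w (y : K) :=
  InfinitePlace.pos_iff.2 (by simpa using hy)

theorem LV_mul {x y : 𝓞 K} (hx : x ≠ 0) (hy : y ≠ 0) : LV (x * y) = LV x + LV y := by
  ext w
  simp only [LV, Pi.add_apply, map_mul]
  exact Real.log_mul (w_ne hx w) (w_ne hy w)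

theorem sum_mult : ∑ w : InfinitePlace K, (mult w : ℝ) = Module.finrank ℚ K := by
  exact_mod_cast InfinitePlace.sum_mult_eq (K := K)

theorem tr_add (x y : InfinitePlace K → ℝ) : tr (x + y) = tr x + tr y := by
  simp [tr, mul_add, Finset.sum_add_distrib]

theorem tr_sub (x y : InfinitePlace K → ℝ) : tr (x - y) = tr x - tr y := by
  simp [tr, mul_sub, Finset.sum_sub_distrib]

theorem abs_tr_le (x : InfinitePlace K → ℝ) : |tr x| ≤ Module.finrank ℚ K * ‖x‖ := by
  rw [← sum_mult, Finset.sum_mul]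
  refine (Finset.abs_sum_le_sum_abs _ _).trans (Finset.sum_le_sum fun w _ => ?_)
  rw [abs_mul, abs_of_nonneg (by positivity : (0:ℝ) ≤ mult w)]
  exact mul_le_mul_of_nonneg_left (norm_le_pi_norm x w) (by positivity)

theorem cen_add (x y : InfinitePlace K → ℝ) : cen (x + y) = cen x + cen y := by
  ext w; simp only [cen, tr_add, Pi.add_apply]; ring

theorem cen_sub (x y : InfinitePlace K → ℝ) : cen (x - y) = cen x - cen y := by
  ext w; simp only [cen, tr_sub, Pi.sub_apply]; ring

theorem norm_cen_le (x : InfinitePlace K → ℝ) : ‖cen x‖ ≤ 2 * ‖x‖ := by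
  rw [pi_norm_le_iff_of_nonneg (by positivity)]
  intro w
  have h1 : |tr x / Module.finrank ℚ K| ≤ ‖x‖ := by
    rw [abs_div, abs_of_pos (finrank_pos' (K := K)), div_le_iff₀ finrank_pos']
    linarith [abs_tr_le x]
  calc ‖cen x w‖ ≤ ‖x w‖ + ‖tr x / Module.finrank ℚ K‖ := norm_sub_le _ _
    _ ≤ ‖x‖ + ‖x‖ := add_le_add (norm_le_pi_norm x w) h1
    _ = _ := by ring

theorem tr_LV {y : 𝓞 K} (hy : y ≠ 0) :
    tr (LV y) = Real.log (Ideal.absNorm (Ideal.span {y})) := by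
  have h := InfinitePlace.prod_eq_abs_norm (y : K)
  rw [← Algebra.coe_norm_int] at h
  rw [Ideal.absNorm_span_singleton]
  have h2 : (((Algebra.norm ℤ y).natAbs : ℕ) : ℝ) = ∏ w : InfinitePlace K, w (y : K) ^ mult w := by
    rw [h, Nat.cast_natAbs]; push_cast; rfl
  rw [h2, Real.log_prod (fun w _ => pow_ne_zero _ (w_ne hy w))]
  simp [tr, LV, Real.log_pow]

theorem tr_LV_unit (u : (𝓞 K)ˣ) : tr (LV (u : 𝓞 K)) = 0 := by
  rw [tr_LV (Units.ne_zero u), Ideal.span_singleton_eq_top.2 u.isUnit]; simp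

theorem cen_LV_unit (u : (𝓞 K)ˣ) : cen (LV (u : 𝓞 K)) = LV (u : 𝓞 K) := by
  ext w; simp [cen, tr_LV_unit]

theorem finite_units (B : ℝ) : {u : (𝓞 K)ˣ | ‖LV (u : 𝓞 K)‖ ≤ B}.Finite := by
  have hfin := NumberField.Embeddings.finite_of_norm_le K ℂ (Real.exp B)
  refine Set.Finite.of_finite_image (f := fun u : (𝓞 K)ˣ => ((u : 𝓞 K) : K))
    (hfin.subset ?_) ?_
  · rintro _ ⟨u, hu, rfl⟩
    refine ⟨(u : 𝓞 K).isIntegral_coe, fun φ => ?_⟩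
    have h1 := (norm_le_pi_norm (LV (u : 𝓞 K)) (InfinitePlace.mk φ)).trans hu
    have h2 := (le_abs_self _).trans h1
    have h3 : Real.log (‖φ ((u : 𝓞 K) : K)‖) ≤ B := h2
    have h4 : 0 < ‖φ ((u : 𝓞 K) : K)‖ := by
      rw [norm_pos_iff]; simp
    exact (Real.log_le_iff_le_exp h4).1 h3
  · intro a _ b _ hab
    exact Units.ext (RingOfIntegers.ext hab)

open Classical in
theorem exists_kappa : ∃ κ : ℝ, 0 ≤ κ ∧ ∀ y : 𝓞 K, y ≠ 0 →
    ∃ u : (𝓞 K)ˣ, ‖cen (LV ((u : 𝓞 K) * y))‖ ≤ κ := by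
  obtain ⟨R, hR⟩ := (ZSpan.fundamentalDomain_isBounded
    ((NumberField.Units.basisUnitLattice K).ofZLatticeBasis ℝ _)).exists_norm_le
  refine ⟨Module.finrank ℚ K * max R 0, by positivity, fun y hy => ?_⟩
  have hN : mixedEmbedding.norm (mixedEmbedding K (y : K)) ≠ 0 := by
    rw [mixedEmbedding.norm_eq_norm]
    simpa using hy
  obtain ⟨u, hu⟩ := mixedEmbedding.fundamentalCone.exists_unit_smul_mem hN
  refine ⟨u, ?_⟩
  have hz0 : (u : 𝓞 K) * y ≠ 0 := mul_ne_zero (Units.ne_zero u) hy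
  set z : 𝓞 K := (u : 𝓞 K) * y with hz
  have h1 := hR _ hu.1
  have h2 : u • mixedEmbedding K (y : K) = mixedEmbedding K (z : K) := by
    rw [mixedEmbedding.unitSMul_smul, ← map_mul (mixedEmbedding K)]
    exact congrArg _ (map_mul (algebraMap (𝓞 K) K) _ _).symm
  rw [h2] at h1
  have hlog : Real.log (mixedEmbedding.norm (mixedEmbedding K (z : K))) = tr (LV z) := by
    rw [tr_LV hz0, mixedEmbedding.norm_eq_norm, Ideal.absNorm_span_singleton,
      ← Algebra.coe_norm_int, Nat.cast_natAbs]
    push_cast; rfl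
  have h3 : ∀ w : InfinitePlace K, w ≠ NumberField.Units.dirichletUnitTheorem.w₀ →
      |(mult w : ℝ) * cen (LV z) w| ≤ max R 0 := by
    intro w hw
    have h4 := (norm_le_pi_norm (mixedEmbedding.logMap (mixedEmbedding K (z : K))) ⟨w, hw⟩).trans h1
    rw [mixedEmbedding.logMap_apply, hlog, mixedEmbedding.normAtPlace_apply] at h4
    refine le_trans (le_of_eq ?_) (h4.trans (le_max_left _ _))
    rw [Real.norm_eq_abs, cen, LV, div_eq_mul_inv]
  have hm1 : ∀ w : InfinitePlace K, (1:ℝ) ≤ mult w := fun w => by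
    exact_mod_cast mult_pos (w := w)
  have hsum : ∑ w, (mult w : ℝ) * cen (LV z) w = 0 := by
    have hp := finrank_pos' (K := K)
    simp only [cen, mul_sub, Finset.sum_sub_distrib]
    rw [← Finset.sum_mul, sum_mult, mul_div_cancel₀ _ hp.ne']
    simp [tr]
  have hcard : (Fintype.card (InfinitePlace K) : ℝ) ≤ Module.finrank ℚ K := by
    rw [← sum_mult (K := K), ← Finset.card_univ, Finset.card_eq_sum_ones]
    push_cast
    exact Finset.sum_le_sum fun w _ => hm1 w
  have hcard1 : (1:ℝ) ≤ Fintype.card (InfinitePlace K) := by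
    exact_mod_cast Fintype.card_pos
  have hR0 : 0 ≤ max R 0 := le_max_right _ _
  have h5 : ∀ w : InfinitePlace K, |(mult w : ℝ) * cen (LV z) w| ≤
      Module.finrank ℚ K * max R 0 := by
    intro w
    by_cases hw : w = NumberField.Units.dirichletUnitTheorem.w₀
    · have h6 := Finset.add_sum_erase Finset.univ (fun w => (mult w : ℝ) * cen (LV z) w)
        (Finset.mem_univ w)
      rw [hsum] at h6
      have h7 : (mult w : ℝ) * cen (LV z) w =
          - ∑ w' ∈ Finset.univ.erase w, (mult w' : ℝ) * cen (LV z) w' := by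
        linarith
      rw [h7, abs_neg]
      refine (Finset.abs_sum_le_sum_abs _ _).trans ?_
      refine (Finset.sum_le_sum (g := fun _ => max R 0) fun w' hw' => h3 w' ?_).trans ?_
      · rw [← hw]; exact Finset.ne_of_mem_erase hw'
      · rw [Finset.sum_const, nsmul_eq_mul]
        refine mul_le_mul_of_nonneg_right (le_trans ?_ hcard) hR0
        exact_mod_cast Finset.card_le_univ _
    · refine (h3 w hw).trans ?_
      nlinarith
  rw [pi_norm_le_iff_of_nonneg (by positivity)]
  intro w
  refine le_trans ?_ (h5 w)
  rw [abs_mul, abs_of_nonneg (by positivity : (0:ℝ) ≤ mult w), Real.norm_eq_abs]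
  nlinarith [hm1 w, abs_nonneg (cen (LV z) w)]

/-- partition of unity for the unit action -/
theorem exists_omega : ∃ (ω : 𝓞 K → ℝ) (κ C : ℝ), 0 ≤ κ ∧ 0 ≤ C ∧
    (∀ y, 0 ≤ ω y) ∧ (∀ y, ω y ≤ 1) ∧
    (∀ y : 𝓞 K, y ≠ 0 → HasSum (fun u : (𝓞 K)ˣ => ω ((u : 𝓞 K) * y)) 1) ∧
    (∀ y : 𝓞 K, y ≠ 0 → ω y ≠ 0 → ‖cen (LV y)‖ ≤ κ) ∧
    (∀ y y' : 𝓞 K, y ≠ 0 → y' ≠ 0 → |ω y - ω y'| ≤ C * ‖LV y - LV y'‖) := by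
  classical
  obtain ⟨κ₀, hκ₀, hex⟩ := exists_kappa (K := K)
  set κ := κ₀ + 1 with hκ
  set F := (finite_units (K := K) (2 * κ)).toFinset with hF
  let φ : 𝓞 K → ℝ := fun y => max 0 (κ - ‖cen (LV y)‖)
  have hφ0 : ∀ y, 0 ≤ φ y := fun y => le_max_left _ _
  have hφκ : ∀ y, φ y ≤ κ := fun y => max_le (by linarith) (by linarith [norm_nonneg (cen (LV y))])
  have hφne : ∀ y, φ y ≠ 0 → ‖cen (LV y)‖ ≤ κ := by
    intro y hy
    by_contra hc
    exact hy (max_eq_left (by linarith [not_le.1 hc]))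
  have hφlip : ∀ y y', |φ y - φ y'| ≤ 2 * ‖LV y - LV y'‖ := by
    intro y y'
    have h1 : |φ y - φ y'| ≤ |(κ - ‖cen (LV y)‖) - (κ - ‖cen (LV y')‖)| := by
      have := abs_max_sub_max_le_abs (κ - ‖cen (LV y)‖) (κ - ‖cen (LV y')‖) 0
      simpa only [φ, max_comm (0:ℝ)] using this
    refine h1.trans ?_
    have h2 : (κ - ‖cen (LV y)‖) - (κ - ‖cen (LV y')‖) = -(‖cen (LV y)‖ - ‖cen (LV y')‖) := by ring
    rw [h2, abs_neg]
    refine (abs_norm_sub_norm_le _ _).trans ?_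
    rw [← cen_sub]; exact norm_cen_le _
  have hsupp : ∀ y : 𝓞 K, y ≠ 0 → ∃ A : Finset (𝓞 K)ˣ, A.card ≤ F.card ∧
      ∀ u ∉ A, φ ((u : 𝓞 K) * y) = 0 := by
    intro y hy
    obtain ⟨u₀, hu₀⟩ := hex y hy
    refine ⟨F.image (fun v => u₀ * v), Finset.card_image_le, fun u hu => ?_⟩
    by_contra hne
    apply hu
    rw [Finset.mem_image]
    refine ⟨u₀⁻¹ * u, ?_, by simp⟩
    rw [hF, Set.Finite.mem_toFinset]
    have h1 := hφne _ hne
    have h2 : LV (((u₀⁻¹ * u : (𝓞 K)ˣ) : 𝓞 K)) = cen (LV ((u:𝓞 K) * y)) - cen (LV ((u₀ : 𝓞 K) * y)) := by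
      rw [LV_mul (Units.ne_zero _) hy, LV_mul (Units.ne_zero _) hy, cen_add, cen_add,
        cen_LV_unit, cen_LV_unit]
      have : (u : 𝓞 K) = (u₀ : 𝓞 K) * ((u₀⁻¹ * u : (𝓞 K)ˣ) : 𝓞 K) := by
        rw [← Units.val_mul]; simp
      conv_rhs => rw [this]
      rw [LV_mul (Units.ne_zero _) (Units.ne_zero _)]
      abel
    change ‖LV _‖ ≤ 2 * κ
    rw [h2]
    refine (norm_sub_le _ _).trans ?_
    linarith
  let Φ : 𝓞 K → ℝ := fun y => ∑' u : (𝓞 K)ˣ, φ ((u : 𝓞 K) * y)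
  have hΦsum : ∀ y : 𝓞 K, y ≠ 0 → Summable (fun u : (𝓞 K)ˣ => φ ((u : 𝓞 K) * y)) := by
    intro y hy
    obtain ⟨A, -, hA⟩ := hsupp y hy
    exact summable_of_ne_finset_zero hA
  have hφΦ : ∀ y : 𝓞 K, y ≠ 0 → φ y ≤ Φ y := by
    intro y hy
    have := (hΦsum y hy).le_tsum 1 (fun u _ => hφ0 _)
    simpa using this
  have hΦ1 : ∀ y : 𝓞 K, y ≠ 0 → 1 ≤ Φ y := by
    intro y hy
    obtain ⟨u₀, hu₀⟩ := hex y hy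
    have := (hΦsum y hy).le_tsum u₀ (fun u _ => hφ0 _)
    refine le_trans ?_ this
    exact le_max_of_le_right (by linarith)
  have hΦu : ∀ (y : 𝓞 K) (v : (𝓞 K)ˣ), Φ ((v : 𝓞 K) * y) = Φ y := by
    intro y v
    have := (Equiv.mulRight v).tsum_eq (fun u : (𝓞 K)ˣ => φ ((u : 𝓞 K) * y))
    simp only [Equiv.coe_mulRight, Units.val_mul, mul_assoc] at this
    exact this
  have hΦlip : ∀ y y' : 𝓞 K, y ≠ 0 → y' ≠ 0 → |Φ y - Φ y'| ≤ (4 * F.card) * ‖LV y - LV y'‖ := by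
    intro y y' hy hy'
    obtain ⟨A, hAc, hA⟩ := hsupp y hy
    obtain ⟨A', hAc', hA'⟩ := hsupp y' hy'
    have e1 : Φ y = ∑ u ∈ A ∪ A', φ ((u : 𝓞 K) * y) :=
      tsum_eq_sum fun u hu => hA u fun h => hu (Finset.mem_union_left _ h)
    have e2 : Φ y' = ∑ u ∈ A ∪ A', φ ((u : 𝓞 K) * y') :=
      tsum_eq_sum fun u hu => hA' u fun h => hu (Finset.mem_union_right _ h)
    rw [e1, e2, ← Finset.sum_sub_distrib]
    refine (Finset.abs_sum_le_sum_abs _ _).trans ?_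
    refine (Finset.sum_le_sum (g := fun _ => 2 * ‖LV y - LV y'‖) fun u _ => ?_).trans ?_
    · refine (hφlip _ _).trans (le_of_eq ?_)
      rw [LV_mul (Units.ne_zero _) hy, LV_mul (Units.ne_zero _) hy', add_sub_add_left_eq_sub]
    · rw [Finset.sum_const, nsmul_eq_mul]
      have h1 : ((A ∪ A').card : ℝ) ≤ 2 * F.card := by
        have := Finset.card_union_le A A'
        have h2 : (A ∪ A').card ≤ 2 * F.card := by omega
        exact_mod_cast h2
      have := norm_nonneg (LV y - LV y')
      nlinarith
  have hκ0 : 0 ≤ κ := by linarith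
  refine ⟨fun y => if y = 0 then 0 else φ y / Φ y, κ, 2 + κ * (4 * F.card), hκ0, by positivity,
    ?_, ?_, ?_, ?_, ?_⟩
  · intro y
    dsimp only
    split_ifs with h
    · exact le_rfl
    · exact div_nonneg (hφ0 y) (by linarith [hΦ1 y h])
  · intro y
    dsimp only
    split_ifs with h
    · exact zero_le_one
    · rw [div_le_one (by linarith [hΦ1 y h])]; exact hφΦ y h
  · intro y hy
    have h1 := ((hΦsum y hy).hasSum).div_const (Φ y)
    have h2 : Φ y ≠ 0 := by linarith [hΦ1 y hy]
    change HasSum _ (Φ y / Φ y) at h1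
    rw [div_self h2] at h1
    refine h1.congr_fun ?_ |> fun h => h
    intro u
    simp only [hΦu]
    rw [if_neg (mul_ne_zero (Units.ne_zero u) hy)]
  · intro y hy hne
    dsimp only at hne
    rw [if_neg hy] at hne
    exact hφne y (fun h => hne (by rw [h, zero_div]))
  · intro y y' hy hy'
    dsimp only
    rw [if_neg hy, if_neg hy']
    have p1 := hΦ1 y hy
    have p2 := hΦ1 y' hy'
    have e : φ y / Φ y - φ y' / Φ y' = ((φ y - φ y') + (φ y' / Φ y') * (Φ y' - Φ y)) / Φ y := by
      field_simp; ring
    rw [e, abs_div, abs_of_pos (by linarith : 0 < Φ y), div_le_iff₀ (by linarith)]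
    have q1 := hφlip y y'
    have q2 := hΦlip y y' hy hy'
    have q3 : |φ y' / Φ y'| ≤ κ := by
      rw [abs_of_nonneg (div_nonneg (hφ0 _) (by linarith)), div_le_iff₀ (by linarith)]
      nlinarith [hφκ y']
    have q4 : |φ y - φ y' + φ y' / Φ y' * (Φ y' - Φ y)| ≤
        2 * ‖LV y - LV y'‖ + κ * ((4 * F.card) * ‖LV y - LV y'‖) := by
      refine (abs_add_le _ _).trans (add_le_add q1 ?_)
      rw [abs_mul, abs_sub_comm]
      exact mul_le_mul q3 q2 (abs_nonneg _) hκ0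
    have q5 : 0 ≤ (2 + κ * (4 * F.card)) * ‖LV y - LV y'‖ := by positivity
    nlinarith

end logspace
end VL

namespace VL
open NumberField InfinitePlace

section gfun
variable {K : Type*} [Field K] [NumberField K]

/-- sup of absolute values -/
noncomputable def MM (y : 𝓞 K) : ℝ :=
  Finset.univ.sup' Finset.univ_nonempty (fun w : InfinitePlace K => w (y : K))

theorem w_le_MM (y : 𝓞 K) (w : InfinitePlace K) : w (y : K) ≤ MM y :=
  Finset.le_sup' (fun w : InfinitePlace K => w (y : K)) (Finset.mem_univ w)

theorem exists_w_eq_MM (y : 𝓞 K) : ∃ w : InfinitePlace K, w (y : K) = MM y := by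
  obtain ⟨w, -, hw⟩ := Finset.exists_mem_eq_sup' Finset.univ_nonempty
    (fun w : InfinitePlace K => w (y : K))
  exact ⟨w, hw.symm⟩

theorem MM_nonneg (y : 𝓞 K) : 0 ≤ MM y := by
  obtain ⟨w, hw⟩ := exists_w_eq_MM y
  rw [← hw]; exact apply_nonneg _ _

theorem MM_neg (x : 𝓞 K) : MM (-x) = MM x := by
  unfold MM
  congr 1
  funext w
  have : ((-x : 𝓞 K) : K) = -(x : K) := rfl
  rw [this]
  exact w.1.map_neg _

theorem MM_zero : MM (0 : 𝓞 K) = 0 := by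
  obtain ⟨w, hw⟩ := exists_w_eq_MM (0 : 𝓞 K)
  rw [← hw]; simp

theorem w_add_le (w : InfinitePlace K) (x y : K) : w (x + y) ≤ w x + w y := w.1.add_le x y

theorem MM_pos {y : 𝓞 K} (hy : y ≠ 0) : 0 < MM y := by
  obtain ⟨w, hw⟩ := exists_w_eq_MM y
  rw [← hw]; exact w_pos hy w

theorem summable_gen {E : Type*} [NormedAddCommGroup E] [NormedSpace ℝ E] [FiniteDimensional ℝ E]
    (L : Submodule ℤ E) [DiscreteTopology L] [IsZLattice ℝ L] {A : Type*} (f : A → E)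
    (hf : Function.Injective f) (hL : ∀ a, f a ∈ L) (r : ℝ) (hr : r < -(Module.finrank ℝ E : ℝ)) :
    Summable fun a => ‖f a‖ ^ r := by
  have h0 : Module.finrank ℤ L = Module.finrank ℝ E := ZLattice.rank ℝ L
  have hr' : r < -(Module.finrank ℤ L : ℝ) := by rw [h0]; exact hr
  have h : Summable (fun z : L => ‖z‖ ^ r) := ZLattice.summable_norm_rpow L r hr'
  let g : A → L := fun a => ⟨f a, hL a⟩
  have hg : Function.Injective g := fun a b hab => hf (congrArg Subtype.val hab)
  have h2 : Summable ((fun z : L => ‖z‖ ^ r) ∘ g) := h.comp_injective hg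
  refine h2.congr fun a => ?_
  rfl

open scoped Classical in
theorem summable_norm_aux (r : ℝ) (hr : r < -(Module.finrank ℚ K : ℝ)) :
    Summable fun y : 𝓞 K => ‖mixedEmbedding K (y : K)‖ ^ r := by
  refine summable_gen (mixedEmbedding.integerLattice K) (fun y : 𝓞 K => mixedEmbedding K (y : K)) ?_ ?_ r ?_
  · intro a b hab
    exact RingOfIntegers.ext (mixedEmbedding_injective K hab)
  · intro a
    exact LinearMap.mem_range_self _ a
  · rw [mixedEmbedding.finrank]; exact hr

open scoped Classical in
theorem summable_MM_rpow (r : ℝ) (hr : r < -(Module.finrank ℚ K : ℝ)) :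
    Summable fun y : 𝓞 K => MM y ^ r := by
  refine (summable_norm_aux r hr).congr fun y => ?_
  rw [mixedEmbedding.norm_eq_sup'_normAtPlace, MM]
  congr 2
  funext w
  rw [mixedEmbedding.normAtPlace_apply]

/-- summable majorant -/
noncomputable def BB (y : 𝓞 K) : ℝ := (1 + MM y) ^ (-((Module.finrank ℚ K : ℝ) + 1))

theorem BB_nonneg (y : 𝓞 K) : 0 ≤ BB y := Real.rpow_nonneg (by linarith [MM_nonneg y]) _

theorem summable_BB : Summable (BB : 𝓞 K → ℝ) := by
  have h := summable_MM_rpow (K := K) (-((Module.finrank ℚ K : ℝ) + 1)) (by linarith)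
  refine Summable.of_norm_bounded_eventually h ?_
  rw [Filter.eventually_cofinite]
  refine (Set.finite_singleton (0 : 𝓞 K)).subset ?_
  intro y hy
  by_contra h0
  apply hy
  have hp := MM_pos (show y ≠ 0 from h0)
  rw [Real.norm_eq_abs, abs_of_nonneg (BB_nonneg y)]
  exact Real.rpow_le_rpow_of_nonpos hp (by linarith) (by
    have := finrank_pos' (K := K); linarith)

/-- A character on ideals, of modulus `D` and the real places. -/
structure DChar (D : Ideal (𝓞 K)) where
  χ : Ideal (𝓞 K) →*₀ ℂ
  norm_one : ∀ I, I ≠ 0 → IsCoprime I D → ‖χ I‖ = 1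
  zero : ∀ I, ¬ IsCoprime I D → χ I = 0
  per : ∀ α β : 𝓞 K, α ≠ 0 → β ≠ 0 → α - β ∈ D → IsCoprime (Ideal.span {α}) D →
    (∀ φ : K →+* ℝ, 0 < φ (α : K) * φ (β : K)) → χ (Ideal.span {α}) = χ (Ideal.span {β})

theorem DChar.norm_le_one {D : Ideal (𝓞 K)} (X : DChar D) (I : Ideal (𝓞 K)) : ‖X.χ I‖ ≤ 1 := by
  by_cases h0 : I = 0
  · rw [h0, map_zero]; simp
  by_cases h : IsCoprime I D
  · rw [X.norm_one I h0 h]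
  · rw [X.zero I h]; simp

theorem isCoprime_span_iff_of_sub_mem {D : Ideal (𝓞 K)} {α β : 𝓞 K} (h : α - β ∈ D) :
    IsCoprime (Ideal.span {α}) D ↔ IsCoprime (Ideal.span {β}) D := by
  have key : ∀ a b : 𝓞 K, a - b ∈ D → IsCoprime (Ideal.span {a}) D →
      IsCoprime (Ideal.span {b}) D := by
    intro a b hab hc
    rw [Ideal.isCoprime_iff_exists] at hc ⊢
    obtain ⟨i, hi, j, hj, hij⟩ := hc
    obtain ⟨c, rfl⟩ := Ideal.mem_span_singleton'.1 hi
    refine ⟨c * b, Ideal.mem_span_singleton'.2 ⟨c, rfl⟩, c * (a - b) + j,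
      D.add_mem (D.mul_mem_left _ hab) hj, ?_⟩
    rw [← hij]; ring
  exact ⟨key _ _ h, key _ _ (by rw [← neg_sub]; exact D.neg_mem h)⟩

theorem N_eq_exp {y : 𝓞 K} (hy : y ≠ 0) (s : ℝ) :
    (Ideal.absNorm (Ideal.span {y}) : ℝ) ^ (-s) = Real.exp (-s * tr (LV y)) := by
  have h : (0:ℝ) < Ideal.absNorm (Ideal.span {y}) := by
    have : Ideal.absNorm (Ideal.span {y}) ≠ 0 := by
      rw [Ne, Ideal.absNorm_eq_zero_iff, Ideal.span_singleton_eq_bot]; exact hy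
    exact_mod_cast Nat.pos_of_ne_zero this
  rw [Real.rpow_def_of_pos h, tr_LV hy]; ring_nf

theorem tr_LV_nonneg {y : 𝓞 K} (hy : y ≠ 0) : 0 ≤ tr (LV y) := by
  rw [tr_LV hy]
  apply Real.log_nonneg
  have : Ideal.absNorm (Ideal.span {y}) ≠ 0 := by
    rw [Ne, Ideal.absNorm_eq_zero_iff, Ideal.span_singleton_eq_bot]; exact hy
  exact_mod_cast Nat.one_le_iff_ne_zero.2 this

theorem tr_ge {y : 𝓞 K} (hy : y ≠ 0) {κ : ℝ} (h : ‖cen (LV y)‖ ≤ κ) :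
    Module.finrank ℚ K * (Real.log (MM y) - κ) ≤ tr (LV y) := by
  obtain ⟨w, hw⟩ := exists_w_eq_MM y
  have h1 := (le_abs_self _).trans ((norm_le_pi_norm (cen (LV y)) w).trans h)
  simp only [cen] at h1
  have hL : LV y w = Real.log (MM y) := by rw [← hw]; rfl
  rw [hL] at h1
  have hp := finrank_pos' (K := K)
  have : Real.log (MM y) - κ ≤ tr (LV y) / Module.finrank ℚ K := by
    linarith
  rw [le_div_iff₀ hp] at this
  linarith

theorem LV_ge {y : 𝓞 K} (hy : y ≠ 0) {κ : ℝ} (h : ‖cen (LV y)‖ ≤ κ) (w : InfinitePlace K) :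
    Real.exp (-(2 * κ)) * MM y ≤ w (y : K) := by
  obtain ⟨w₀, hw₀⟩ := exists_w_eq_MM y
  have h1 := (le_abs_self _).trans ((norm_le_pi_norm (cen (LV y)) w₀).trans h)
  have h2 := (neg_le_abs _).trans ((norm_le_pi_norm (cen (LV y)) w).trans h)
  simp only [cen] at h1 h2
  have h3 : Real.log (MM y) - 2 * κ ≤ Real.log (w (y : K)) := by
    rw [← hw₀]
    change LV y w₀ - 2 * κ ≤ LV y w
    linarith
  have h4 := Real.exp_le_exp.2 h3
  rw [Real.exp_log (w_pos hy w), sub_eq_add_neg, Real.exp_add, Real.exp_log (MM_pos hy)] at h4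
  linarith

theorem one_le_MM {y : 𝓞 K} (hy : y ≠ 0) : 1 ≤ MM y := by
  have h := tr_LV_nonneg hy
  by_contra hc
  push Not at hc
  have : tr (LV y) < 0 := by
    unfold tr
    refine Finset.sum_neg (fun w _ => ?_) Finset.univ_nonempty
    have h1 : LV y w < 0 := Real.log_neg (w_pos hy w) ((w_le_MM y w).trans_lt hc)
    have h2 : (0:ℝ) < mult w := by exact_mod_cast mult_pos
    nlinarith
  linarith

theorem near_log {a b t : ℝ} (ha : 0 < a) (ht : t ≤ a / 2) (h1 : b ≤ a + t)
    (h2 : a - t ≤ b) : |Real.log b - Real.log a| ≤ 2 * t / a := by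
  have ht0 : 0 ≤ t := by linarith
  have hb : 0 < b := by linarith
  rw [abs_le]
  constructor
  · have := Real.log_le_sub_one_of_pos (div_pos ha hb)
    rw [Real.log_div ha.ne' hb.ne'] at this
    have h3 : a / b - 1 ≤ 2 * t / a := by
      rw [div_sub_one hb.ne', div_le_div_iff₀ hb ha]
      nlinarith
    linarith
  · have := Real.log_le_sub_one_of_pos (div_pos hb ha)
    rw [Real.log_div hb.ne' ha.ne'] at this
    have h3 : b / a - 1 ≤ 2 * t / a := by
      rw [div_sub_one ha.ne']
      gcongr
      linarith
    linarith

theorem LV_near {y τ : 𝓞 K} (hy : y ≠ 0) {κ : ℝ} (h : ‖cen (LV y)‖ ≤ κ)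
    (hM : 2 * MM τ * Real.exp (2 * κ) ≤ MM y) :
    y + τ ≠ 0 ∧ ‖LV (y + τ) - LV y‖ ≤ 2 * MM τ * Real.exp (2 * κ) / MM y ∧
      ∀ φ : K →+* ℝ, 0 < φ ((y + τ : 𝓞 K) : K) * φ (y : K) := by
  have hE : 0 < Real.exp (2 * κ) := Real.exp_pos _
  have hMy := MM_pos hy
  have hge : ∀ w : InfinitePlace K, MM y ≤ Real.exp (2 * κ) * w (y : K) := by
    intro w
    have := LV_ge hy h w
    rw [Real.exp_neg, inv_mul_le_iff₀ hE] at this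
    exact this
  have hhalf : ∀ w : InfinitePlace K, w (τ : K) ≤ w (y : K) / 2 := by
    intro w
    have h1 := hge w
    have h2 := w_le_MM τ w
    have : 2 * MM τ * Real.exp (2 * κ) ≤ Real.exp (2 * κ) * w (y : K) := hM.trans h1
    have h3 : 2 * MM τ ≤ w (y : K) := by
      by_contra hc; push Not at hc; nlinarith
    linarith
  have hadd : ∀ w : InfinitePlace K, w (y : K) - w (τ : K) ≤ w ((y + τ : 𝓞 K) : K) := by
    intro w
    have h1 : (y : K) = ((y + τ : 𝓞 K) : K) + (-(τ : K)) := by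
      have : ((y + τ : 𝓞 K) : K) = (y : K) + (τ : K) := rfl
      rw [this]; ring
    have h2 := w_add_le w ((y + τ : 𝓞 K) : K) (-(τ : K))
    have h3 : w (-(τ : K)) = w (τ : K) := w.1.map_neg _
    rw [← h1, h3] at h2
    linarith
  refine ⟨?_, ?_, ?_⟩
  · intro h0
    obtain ⟨w, -⟩ := exists_w_eq_MM y
    have h1 := hadd w
    rw [h0] at h1
    have h2 := hhalf w
    have h3 := w_pos hy w
    simp at h1
    linarith
  · rw [pi_norm_le_iff_of_nonneg (by have := MM_nonneg τ; positivity)]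
    intro w
    have h3 := w_pos hy w
    have h4 := near_log h3 (hhalf w) (w_add_le w _ _) (hadd w)
    refine h4.trans ?_
    rw [div_le_div_iff₀ h3 hMy]
    have h5 := hge w
    have h6 := w_le_MM τ w
    have h7 : 0 ≤ w (τ : K) := apply_nonneg _ _
    calc 2 * w (τ : K) * MM y ≤ 2 * MM τ * (Real.exp (2 * κ) * w (y : K)) := by
          have := MM_nonneg τ
          gcongr
      _ = _ := by ring
  · intro φ
    have hw : ∀ x : K, InfinitePlace.mk (Complex.ofRealHom.comp φ) x = |φ x| := by
      intro x
      rw [InfinitePlace.apply]; simp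
    have h1 := hhalf (InfinitePlace.mk (Complex.ofRealHom.comp φ))
    have h2 := w_pos hy (InfinitePlace.mk (Complex.ofRealHom.comp φ))
    rw [hw, hw] at h1
    rw [hw] at h2
    have h0 : ((y + τ : 𝓞 K) : K) = (y : K) + (τ : K) := rfl
    rw [h0, map_add]
    have h3 : |φ (τ : K) * φ (y : K)| ≤ |φ (y : K)| / 2 * |φ (y : K)| := by
      rw [abs_mul]; gcongr
    have h4 := (abs_le.1 h3).1
    have h5 : φ (y : K) * φ (y : K) = |φ (y : K)| * |φ (y : K)| := (abs_mul_abs_self _).symm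
    nlinarith

/-- local summand -/
noncomputable def GG {D : Ideal (𝓞 K)} (X : DChar D) (ω : 𝓞 K → ℝ) (s : ℝ) (y : 𝓞 K) : ℂ :=
  X.χ (Ideal.span {y}) * ((ω y * (Ideal.absNorm (Ideal.span {y}) : ℝ) ^ (-s) : ℝ) : ℂ)

theorem abs_one_sub_exp {x B : ℝ} (h : |x| ≤ B) : |1 - Real.exp x| ≤ |x| * Real.exp B := by
  have hB : 1 ≤ Real.exp B := Real.one_le_exp ((abs_nonneg x).trans h)
  rcases le_total 0 x with hx | hx
  · rw [abs_of_nonneg hx] at h ⊢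
    have h1 : 1 ≤ Real.exp x := Real.one_le_exp hx
    rw [abs_of_nonpos (by linarith)]
    have h2 := Real.add_one_le_exp (-x)
    have h3 : Real.exp x * Real.exp (-x) = 1 := by rw [← Real.exp_add]; simp
    have h4 : Real.exp x ≤ Real.exp B := Real.exp_le_exp.2 h
    nlinarith [Real.exp_pos x]
  · have h1 : Real.exp x ≤ 1 := Real.exp_le_one_iff.2 hx
    rw [abs_of_nonpos hx, abs_of_nonneg (by linarith)]
    have h2 := Real.add_one_le_exp x
    nlinarith

theorem GG_near {D : Ideal (𝓞 K)} (X : DChar D) (ω : 𝓞 K → ℝ) {κ C : ℝ} (hC : 0 ≤ C)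
    (h0 : ∀ y, 0 ≤ ω y) (h1 : ∀ y, ω y ≤ 1)
    (hlip : ∀ y y' : 𝓞 K, y ≠ 0 → y' ≠ 0 → |ω y - ω y'| ≤ C * ‖LV y - LV y'‖)
    (τ : 𝓞 K) (hτ : τ ∈ D) : ∃ C' : ℝ, 0 ≤ C' ∧ ∀ s : ℝ, 1 < s → s ≤ 2 → ∀ y : 𝓞 K, y ≠ 0 →
      ‖cen (LV y)‖ ≤ κ → 2 * MM τ * Real.exp (2 * κ) ≤ MM y →
      ‖GG X ω s (y + τ) - GG X ω s y‖ ≤ C' * BB y := by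
  set n : ℝ := ((Module.finrank ℚ K : ℕ) : ℝ) with hn
  have hn0 : 0 < n := finrank_pos' (K := K)
  set A := 2 * MM τ * Real.exp (2 * κ) with hA
  have hA0 : 0 ≤ A := by have := MM_nonneg τ; positivity
  set C1 := C + 2 * n * Real.exp (2 * n) with hC1
  have hC10 : 0 ≤ C1 := by positivity
  refine ⟨Real.exp (n * κ) * C1 * A * 2 ^ (n + 1), by positivity, ?_⟩
  intro s hs1 hs2 y hy hcen hM
  have hMy := MM_pos hy
  obtain ⟨hy', hd, hsign⟩ := LV_near hy hcen hM
  set y' := y + τ with hy'def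
  set d := ‖LV y' - LV y‖ with hdd
  have hd0 : 0 ≤ d := norm_nonneg _
  have hd1 : d ≤ 1 := hd.trans (by rw [div_le_one hMy]; exact hM)
  have hmem : y' - y ∈ D := by rw [hy'def, add_sub_cancel_left]; exact hτ
  have hχ : X.χ (Ideal.span {y'}) = X.χ (Ideal.span {y}) := by
    by_cases hc : IsCoprime (Ideal.span {y'}) D
    · exact X.per y' y hy' hy hmem hc hsign
    · rw [X.zero _ hc, X.zero]
      rwa [← isCoprime_span_iff_of_sub_mem hmem]
  have hval : ‖GG X ω s y' - GG X ω s y‖ ≤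
      |ω y' * Real.exp (-s * tr (LV y')) - ω y * Real.exp (-s * tr (LV y))| := by
    unfold GG
    rw [hχ, ← mul_sub, norm_mul, ← Complex.ofReal_sub, Complex.norm_real, N_eq_exp hy,
      N_eq_exp hy', Real.norm_eq_abs]
    have := X.norm_le_one (Ideal.span {y})
    exact mul_le_of_le_one_left (abs_nonneg _) this
  refine hval.trans ?_
  set t := tr (LV y) with ht
  set t' := tr (LV y') with ht'
  have htt : |t' - t| ≤ n * d := by
    rw [ht, ht', ← tr_sub]; exact abs_tr_le _
  have hx : |-s * (t' - t)| ≤ 2 * n * d := by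
    rw [abs_mul, abs_neg, abs_of_pos (by linarith)]
    calc s * |t' - t| ≤ 2 * (n * d) := by gcongr
      _ = _ := by ring
  have hx2 : |-s * (t' - t)| ≤ 2 * n := hx.trans (by nlinarith)
  have hexp : |1 - Real.exp (-s * (t' - t))| ≤ 2 * n * d * Real.exp (2 * n) := by
    refine (abs_one_sub_exp hx2).trans ?_
    gcongr
  have e1 : ω y' * Real.exp (-s * t') - ω y * Real.exp (-s * t) =
      Real.exp (-s * t) * ((ω y' - ω y) - ω y' * (1 - Real.exp (-s * (t' - t)))) := by
    have : Real.exp (-s * t') = Real.exp (-s * t) * Real.exp (-s * (t' - t)) := by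
      rw [← Real.exp_add]; ring_nf
    rw [this]; ring
  rw [e1, abs_mul, abs_of_pos (Real.exp_pos _)]
  have e2 : |(ω y' - ω y) - ω y' * (1 - Real.exp (-s * (t' - t)))| ≤ C1 * d := by
    refine (abs_sub _ _).trans ?_
    have f1 := hlip y' y hy' hy
    have f2 : |ω y' * (1 - Real.exp (-s * (t' - t)))| ≤ 2 * n * d * Real.exp (2 * n) := by
      rw [abs_mul, abs_of_nonneg (h0 _)]
      exact (mul_le_of_le_one_left (abs_nonneg _) (h1 _)).trans hexp
    rw [hC1]
    calc _ ≤ C * d + 2 * n * d * Real.exp (2 * n) := add_le_add f1 f2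
      _ = _ := by ring
  have e3 : Real.exp (-s * t) ≤ Real.exp (n * κ) * MM y ^ (-n) := by
    have g1 := tr_ge hy hcen
    have g2 := tr_LV_nonneg hy
    rw [Real.rpow_def_of_pos hMy, ← Real.exp_add, Real.exp_le_exp]
    nlinarith
  have e4 : MM y ^ (-n) * (1 / MM y) ≤ 2 ^ (n + 1) * BB y := by
    have g1 := one_le_MM hy
    have g3 : MM y ^ (-n) * (1 / MM y) = MM y ^ (-(n + 1)) := by
      rw [neg_add, Real.rpow_add hMy, Real.rpow_neg_one, one_div]
    have g4 : (1 + MM y) / 2 ≤ MM y := by linarith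
    have g5 : MM y ^ (-(n + 1)) ≤ ((1 + MM y) / 2) ^ (-(n + 1)) :=
      Real.rpow_le_rpow_of_nonpos (by linarith) g4 (by linarith)
    rw [g3]
    refine g5.trans (le_of_eq ?_)
    rw [Real.div_rpow (by linarith) (by norm_num), BB, ← hn, Real.rpow_neg (by norm_num : (0:ℝ) ≤ 2),
      div_inv_eq_mul]
    ring
  have hBB := BB_nonneg y
  calc Real.exp (-s * t) * |(ω y' - ω y) - ω y' * (1 - Real.exp (-s * (t' - t)))|
      ≤ (Real.exp (n * κ) * MM y ^ (-n)) * (C1 * (A / MM y)) := by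
        refine mul_le_mul e3 (e2.trans ?_) (abs_nonneg _) (by positivity)
        exact mul_le_mul_of_nonneg_left hd hC10
    _ = Real.exp (n * κ) * C1 * A * (MM y ^ (-n) * (1 / MM y)) := by ring
    _ ≤ Real.exp (n * κ) * C1 * A * (2 ^ (n + 1) * BB y) := by gcongr
    _ = _ := by ring

theorem GG_norm_le_one {D : Ideal (𝓞 K)} (X : DChar D) (ω : 𝓞 K → ℝ)
    (h0 : ∀ y, 0 ≤ ω y) (h1 : ∀ y, ω y ≤ 1) {s : ℝ} (hs : 0 ≤ s) (y : 𝓞 K) :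
    ‖GG X ω s y‖ ≤ 1 := by
  unfold GG
  by_cases hy : y = 0
  · rw [hy, Ideal.span_singleton_eq_bot.2 rfl]
    have : X.χ (⊥ : Ideal (𝓞 K)) = 0 := map_zero X.χ
    rw [this]; simp
  rw [norm_mul, Complex.norm_real, N_eq_exp hy, Real.norm_eq_abs, abs_mul, abs_of_nonneg (h0 _),
    abs_of_pos (Real.exp_pos _)]
  have a1 := X.norm_le_one (Ideal.span {y})
  have a2 : Real.exp (-s * tr (LV y)) ≤ 1 := by
    rw [Real.exp_le_one_iff]; nlinarith [tr_LV_nonneg hy]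
  have a3 := h1 y
  have a4 := h0 y
  have a5 : ω y * Real.exp (-s * tr (LV y)) ≤ 1 := mul_le_one₀ a3 (Real.exp_pos _).le a2
  exact mul_le_one₀ a1 (by positivity) a5

theorem GG_diff {D : Ideal (𝓞 K)} (X : DChar D) (ω : 𝓞 K → ℝ) {κ C : ℝ} (hC : 0 ≤ C)
    (h0 : ∀ y, 0 ≤ ω y) (h1 : ∀ y, ω y ≤ 1)
    (hsupp : ∀ y : 𝓞 K, y ≠ 0 → ω y ≠ 0 → ‖cen (LV y)‖ ≤ κ)
    (hlip : ∀ y y' : 𝓞 K, y ≠ 0 → y' ≠ 0 → |ω y - ω y'| ≤ C * ‖LV y - LV y'‖)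
    (τ : 𝓞 K) (hτ : τ ∈ D) : ∃ C' : ℝ, 0 ≤ C' ∧ ∀ s : ℝ, 1 < s → s ≤ 2 → ∀ y : 𝓞 K,
      ‖GG X ω s (y + τ) - GG X ω s y‖ ≤ C' * (BB y + BB (y + τ)) := by
  obtain ⟨C1, hC1, H1⟩ := GG_near (κ := κ) X ω hC h0 h1 hlip τ hτ
  obtain ⟨C2, hC2, H2⟩ := GG_near (κ := κ) X ω hC h0 h1 hlip (-τ) (D.neg_mem hτ)
  set R := 2 * MM τ * Real.exp (2 * κ) with hR
  have hR0 : 0 ≤ R := by have := MM_nonneg τ; positivity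
  set e := -((Module.finrank ℚ K : ℝ) + 1) with he
  have he0 : e ≤ 0 := by have := finrank_pos' (K := K); linarith
  set C3 := 2 * ((1 + R) ^ e)⁻¹ with hC3
  have hp : 0 < (1 + R) ^ e := Real.rpow_pos_of_pos (by linarith) _
  have hC30 : 0 ≤ C3 := by positivity
  have small : ∀ z : 𝓞 K, MM z ≤ R → 2 ≤ C3 * BB z := by
    intro z hz
    have : (1 + R) ^ e ≤ BB z := Real.rpow_le_rpow_of_nonpos (by linarith [MM_nonneg z])
      (by linarith) he0
    rw [hC3, mul_assoc]
    have : 1 ≤ ((1 + R) ^ e)⁻¹ * BB z := by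
      rw [← div_eq_inv_mul, one_le_div hp]; exact this
    linarith
  refine ⟨C1 + C2 + C3, by positivity, fun s hs1 hs2 y => ?_⟩
  have b1 := BB_nonneg y
  have b2 := BB_nonneg (y + τ)
  have n2 : ‖GG X ω s (y + τ) - GG X ω s y‖ ≤ 2 := by
    have a1 := GG_norm_le_one X ω h0 h1 (by linarith : 0 ≤ s) y
    have a2 := GG_norm_le_one X ω h0 h1 (by linarith : 0 ≤ s) (y + τ)
    exact (norm_sub_le _ _).trans (by linarith)
  by_cases c1 : MM y ≤ R
  · have := small y c1
    nlinarith [mul_nonneg hC1 b1, mul_nonneg hC2 b1, mul_nonneg hC1 b2, mul_nonneg hC2 b2,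
      mul_nonneg hC30 b2]
  by_cases c2 : MM (y + τ) ≤ R
  · have := small (y + τ) c2
    nlinarith [mul_nonneg hC1 b1, mul_nonneg hC2 b1, mul_nonneg hC1 b2, mul_nonneg hC2 b2,
      mul_nonneg hC30 b1]
  push Not at c1 c2
  have hy : y ≠ 0 := by rintro rfl; rw [MM_zero] at c1; linarith
  have hy' : y + τ ≠ 0 := by intro h; rw [h, MM_zero] at c2; linarith
  by_cases w1 : ω y = 0
  · by_cases w2 : ω (y + τ) = 0
    · have : GG X ω s (y + τ) - GG X ω s y = 0 := by simp [GG, w1, w2]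
      rw [this, norm_zero]; positivity
    · have := H2 s hs1 hs2 (y + τ) hy' (hsupp _ hy' w2) (by rw [MM_neg]; exact c2.le)
      rw [add_neg_cancel_right, norm_sub_rev] at this
      nlinarith [mul_nonneg hC1 b1, mul_nonneg hC2 b1, mul_nonneg hC1 b2,
        mul_nonneg hC30 b2, mul_nonneg hC30 b1]
  · have := H1 s hs1 hs2 y hy (hsupp _ hy w1) c1.le
    nlinarith [mul_nonneg hC2 b1, mul_nonneg hC1 b2, mul_nonneg hC2 b2,
        mul_nonneg hC30 b2, mul_nonneg hC30 b1]

theorem GG_summable {D : Ideal (𝓞 K)} (X : DChar D) (ω : 𝓞 K → ℝ) {κ : ℝ}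
    (h0 : ∀ y, 0 ≤ ω y) (h1 : ∀ y, ω y ≤ 1)
    (hsupp : ∀ y : 𝓞 K, y ≠ 0 → ω y ≠ 0 → ‖cen (LV y)‖ ≤ κ) {s : ℝ} (hs : 1 < s) :
    Summable (GG X ω s) := by
  set n : ℝ := ((Module.finrank ℚ K : ℕ) : ℝ) with hn
  have hn0 : 0 < n := finrank_pos' (K := K)
  have h := (summable_MM_rpow (K := K) (-(s * n)) (by nlinarith)).mul_left (Real.exp (s * n * κ))
  refine Summable.of_norm_bounded h fun y => ?_
  by_cases hy : y = 0
  · have : GG X ω s y = 0 := by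
      unfold GG
      rw [hy, Ideal.span_singleton_eq_bot.2 rfl]
      have : X.χ (⊥ : Ideal (𝓞 K)) = 0 := map_zero X.χ
      rw [this]; simp
    rw [this, norm_zero]
    have := MM_nonneg y
    positivity
  by_cases w1 : ω y = 0
  · have : GG X ω s y = 0 := by simp [GG, w1]
    rw [this, norm_zero]
    have := MM_nonneg y
    positivity
  have hMy := MM_pos hy
  unfold GG
  rw [norm_mul, Complex.norm_real, N_eq_exp hy, Real.norm_eq_abs, abs_mul, abs_of_nonneg (h0 _),
    abs_of_pos (Real.exp_pos _)]
  have a1 := X.norm_le_one (Ideal.span {y})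
  have a3 := h1 y
  have a4 := h0 y
  have e3 : Real.exp (-s * tr (LV y)) ≤ Real.exp (s * n * κ) * MM y ^ (-(s * n)) := by
    have g1 := tr_ge hy (hsupp y hy w1)
    rw [Real.rpow_def_of_pos hMy, ← Real.exp_add, Real.exp_le_exp]
    rw [← hn] at g1
    nlinarith
  refine le_trans ?_ e3
  have hp := Real.exp_pos (-s * tr (LV y))
  calc _ ≤ 1 * (1 * Real.exp (-s * tr (LV y))) := by gcongr
    _ = _ := by ring

end gfun
end VL

namespace VL
open NumberField InfinitePlace

section bdd
universe uK
variable {K : Type uK} [Field K] [NumberField K]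

/-- Dirichlet series term -/
noncomputable def tt {D : Ideal (𝓞 K)} (X : DChar D) (s : ℝ) (I : Ideal (𝓞 K)) : ℂ :=
  X.χ I * (((Ideal.absNorm I : ℝ) ^ (-s) : ℝ) : ℂ)

theorem tt_zero {D : Ideal (𝓞 K)} (X : DChar D) (s : ℝ) : tt X s 0 = 0 := by
  unfold tt
  rw [map_zero, zero_mul]

theorem tt_one {D : Ideal (𝓞 K)} (X : DChar D) (s : ℝ) : tt X s 1 = 1 := by
  unfold tt
  rw [map_one, map_one]; simp

theorem tt_mul {D : Ideal (𝓞 K)} (X : DChar D) (s : ℝ) (I J : Ideal (𝓞 K)) :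
    tt X s (I * J) = tt X s I * tt X s J := by
  unfold tt
  rw [map_mul, map_mul, Nat.cast_mul, Real.mul_rpow (by positivity) (by positivity)]
  push_cast; ring

/-- ideals `I` with `g I` principal -/
def Pset (g : Ideal (𝓞 K)) : Set (Ideal (𝓞 K)) := {I | I ≠ 0 ∧ (g * I).IsPrincipal}

theorem SG_hasSum {D : Ideal (𝓞 K)} (X : DChar D) (ω : 𝓞 K → ℝ)
    (hsum : ∀ y : 𝓞 K, y ≠ 0 → HasSum (fun u : (𝓞 K)ˣ => ω (u * y)) 1) {s : ℝ}
    (hS : Summable (GG X ω s)) (g : Ideal (𝓞 K)) (hg : g ≠ 0) :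
    HasSum ((Pset g).indicator (fun I => tt X s (g * I)))
      (∑' y, (g : Set (𝓞 K)).indicator (GG X ω s) y) := by
  have key : ∀ I : Pset g, ∃ y : 𝓞 K, Ideal.span {y} = g * I.1 := fun I => by
    obtain ⟨y, hy⟩ := I.2.2
    exact ⟨y, hy.symm⟩
  choose y hy using key
  have hy0 : ∀ I, y I ≠ 0 := by
    intro I h
    have h1 := hy I
    rw [h, Ideal.span_singleton_eq_bot.2 rfl] at h1
    exact mul_ne_zero hg I.2.1 h1.symm
  have hspan : ∀ I (u : (𝓞 K)ˣ), Ideal.span {(u : 𝓞 K) * y I} = g * I.1 := by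
    intro I u
    rw [← hy I, Ideal.span_singleton_eq_span_singleton]
    exact associated_unit_mul_left _ _ u.isUnit
  let e : Pset g × (𝓞 K)ˣ → 𝓞 K := fun p => p.2 * y p.1
  have he : Function.Injective e := by
    rintro ⟨I, u⟩ ⟨J, v⟩ h
    simp only [e] at h
    have h1 : g * I.1 = g * J.1 := by rw [← hspan I u, ← hspan J v, h]
    have h2 : I = J := Subtype.ext (mul_left_cancel₀ hg h1)
    subst h2
    have h3 := mul_right_cancel₀ (hy0 I) h
    rw [Units.ext h3]
  have hr : ∀ x ∉ Set.range e, (g : Set (𝓞 K)).indicator (GG X ω s) x = 0 := by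
    intro x hx
    by_contra hne
    have hxg : x ∈ g := by
      by_contra hc
      exact hne (Set.indicator_of_notMem (by simpa using hc) _)
    have hx0 : x ≠ 0 := by
      rintro rfl
      apply hne
      rw [Set.indicator_of_mem (by simp)]
      unfold GG
      rw [Ideal.span_singleton_eq_bot.2 rfl]
      have : X.χ (⊥ : Ideal (𝓞 K)) = 0 := map_zero X.χ
      rw [this]; simp
    apply hx
    obtain ⟨I, hI⟩ := Ideal.dvd_span_singleton.2 hxg
    have hI0 : I ≠ 0 := by
      rintro rfl
      rw [mul_zero] at hI
      exact hx0 (Ideal.span_singleton_eq_bot.1 hI)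
    have hIP : I ∈ Pset g := ⟨hI0, ⟨x, hI.symm⟩⟩
    have h1 : Ideal.span {y ⟨I, hIP⟩} = Ideal.span {x} := by rw [hy, hI]
    obtain ⟨u, hu⟩ := Ideal.span_singleton_eq_span_singleton.1 h1
    exact ⟨(⟨I, hIP⟩, u), by simp only [e]; rw [← hu, mul_comm]⟩
  have h1 := (he.hasSum_iff hr).2 (hS.indicator (g : Set (𝓞 K))).hasSum
  rw [← hasSum_subtype_iff_indicator]
  refine h1.prod_fiberwise fun I => ?_
  have h2 : ∀ u : (𝓞 K)ˣ, ((g : Set (𝓞 K)).indicator (GG X ω s) ∘ e) (I, u) =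
      tt X s (g * I.1) * ((ω (u * y I) : ℝ) : ℂ) := by
    intro u
    have hm : (u : 𝓞 K) * y I ∈ g := by
      have : (u : 𝓞 K) * y I ∈ Ideal.span {(u : 𝓞 K) * y I} := Ideal.mem_span_singleton_self _
      rw [hspan] at this
      exact Ideal.mul_le_left this
    simp only [Function.comp, e]
    rw [Set.indicator_of_mem (by simpa using hm)]
    unfold GG tt
    rw [hspan]
    push_cast; ring
  simp_rw [h2]
  have h3 := (Complex.hasSum_ofReal.2 (hsum _ (hy0 I))).mul_left (tt X s (g * I.1))
  simpa using h3

/-- trivial character -/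
noncomputable def trivChar : DChar (⊤ : Ideal (𝓞 K)) where
  χ := { toFun := fun I => by classical exact if I = ⊥ then 0 else 1
         map_zero' := by simp
         map_one' := by simp
         map_mul' := fun I J => by
          by_cases h : I = ⊥ <;> by_cases h' : J = ⊥ <;> simp [h, h'] }
  norm_one I hI _ := by
    rw [Ideal.zero_eq_bot] at hI
    simp [hI]
  zero I h := by
    exfalso; apply h
    rw [Ideal.isCoprime_iff_sup_eq]; simp
  per α β hα hβ _ _ _ := by simp [hα, hβ]

theorem trivChar_apply {I : Ideal (𝓞 K)} (hI : I ≠ 0) : (trivChar (K := K)).χ I = 1 := by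
  rw [Ne, Ideal.zero_eq_bot] at hI
  simp [trivChar, hI]

theorem isPrincipal_iff {I J : Ideal (𝓞 K)} (hI : I ≠ 0) (hJ : J ≠ 0) :
    (I * J).IsPrincipal ↔
      ClassGroup.mk0 ⟨I, mem_nonZeroDivisors_iff_ne_zero.2 hI⟩ =
        (ClassGroup.mk0 ⟨J, mem_nonZeroDivisors_iff_ne_zero.2 hJ⟩)⁻¹ := by
  rw [← ClassGroup.mk0_eq_one_iff (mem_nonZeroDivisors_iff_ne_zero.2 (mul_ne_zero hI hJ)),
    eq_inv_iff_mul_eq_one, ← map_mul]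
  rfl

theorem exists_rep (D : Ideal (𝓞 K)) (hD : D ≠ 0) (c : ClassGroup (𝓞 K)) :
    ∃ (g : Ideal (𝓞 K)) (hg : g ≠ 0), IsCoprime g D ∧
      ClassGroup.mk0 ⟨g, mem_nonZeroDivisors_iff_ne_zero.2 hg⟩ = c := by
  by_cases hDt : D = ⊤
  · obtain ⟨⟨a, ha⟩, hac⟩ := ClassGroup.mk0_surjective c
    refine ⟨a, mem_nonZeroDivisors_iff_ne_zero.1 ha, ?_, hac⟩
    rw [Ideal.isCoprime_iff_sup_eq, hDt]; simp
  obtain ⟨⟨a, ha⟩, hac⟩ := ClassGroup.mk0_surjective c⁻¹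
  have ha0 := mem_nonZeroDivisors_iff_ne_zero.1 ha
  obtain ⟨x, hx⟩ := IsDedekindDomain.exists_sup_span_eq (I := a * D) (J := a) Ideal.mul_le_left
    (mul_ne_zero ha0 hD)
  have hxa : x ∈ a := by
    rw [← hx]; exact Ideal.mem_sup_right (Ideal.mem_span_singleton_self _)
  obtain ⟨g, hg⟩ := Ideal.dvd_span_singleton.2 hxa
  have hcop : D ⊔ g = ⊤ := by
    rw [hg, ← Ideal.mul_sup] at hx
    exact mul_left_cancel₀ ha0 (hx.trans (Ideal.mul_top a).symm)
  have hg0 : g ≠ 0 := by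
    rintro rfl
    apply hDt
    rw [← hcop]; exact (sup_bot_eq D).symm
  refine ⟨g, hg0, ?_, ?_⟩
  · rw [Ideal.isCoprime_iff_sup_eq, sup_comm]; exact hcop
  · have : (g * a).IsPrincipal := by
      rw [mul_comm, ← hg]; exact ⟨x, rfl⟩
    rw [isPrincipal_iff hg0 ha0, hac, inv_inv] at this
    exact this

theorem sum_reps {f : Ideal (𝓞 K) → ℂ} (h0 : f 0 = 0) (g : ClassGroup (𝓞 K) → Ideal (𝓞 K))
    (hg : ∀ c, g c ≠ 0) (σ : Equiv.Perm (ClassGroup (𝓞 K)))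
    (hgc : ∀ c, ClassGroup.mk0 ⟨g c, mem_nonZeroDivisors_iff_ne_zero.2 (hg c)⟩ = σ c)
    (I : Ideal (𝓞 K)) : ∑ c, (Pset (g c)).indicator f I = f I := by
  by_cases hI : I = 0
  · rw [hI, h0]
    refine Finset.sum_eq_zero fun c _ => ?_
    by_cases h : (0 : Ideal (𝓞 K)) ∈ Pset (g c)
    · rw [Set.indicator_of_mem h, h0]
    · rw [Set.indicator_of_notMem h]
  set J := (ClassGroup.mk0 ⟨I, mem_nonZeroDivisors_iff_ne_zero.2 hI⟩)⁻¹ with hJ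
  rw [Finset.sum_eq_single (σ.symm J)]
  · rw [Set.indicator_of_mem]
    refine ⟨hI, ?_⟩
    rw [isPrincipal_iff (hg _) hI, hgc, ← hJ, σ.apply_symm_apply]
  · intro c _ hc
    rw [Set.indicator_of_notMem]
    rintro ⟨-, h⟩
    rw [isPrincipal_iff (hg _) hI, hgc, ← hJ] at h
    apply hc
    rw [← h, σ.symm_apply_apply]
  · simp

theorem summable_tt {D : Ideal (𝓞 K)} (X : DChar D) {s : ℝ} (hs : 1 < s) :
    Summable (tt X s) := by
  obtain ⟨ω, κ, C, hκ, hC, h0, h1, hsum, hsupp, hlip⟩ := exists_omega (K := K)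
  suffices h : Summable (tt (trivChar (K := K)) s) by
    refine Summable.of_norm_bounded h.norm fun I => ?_
    by_cases hI : I = 0
    · rw [hI, tt_zero, norm_zero]; positivity
    unfold tt
    rw [norm_mul, norm_mul, trivChar_apply hI, norm_one]
    gcongr
    exact X.norm_le_one I
  have hS := GG_summable (trivChar (K := K)) ω h0 h1 hsupp hs
  choose g hg hg1 hg2 using exists_rep (K := K) (⊤ : Ideal (𝓞 K))
    (by intro h; exact bot_ne_top h.symm)
  have e : tt (trivChar (K := K)) s = fun I => ∑ c, (Pset (g c)).indicator
      (tt (trivChar (K := K)) s) I := by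
    funext I
    exact (sum_reps (tt_zero _ _) g hg (Equiv.refl _) hg2 I).symm
  rw [e]
  refine summable_sum fun c _ => ?_
  have := (SG_hasSum (trivChar (K := K)) ω hsum hS (g c) (hg c)).summable
  have hne : tt (trivChar (K := K)) s (g c) ≠ 0 := by
    unfold tt
    rw [trivChar_apply (hg c), one_mul, Complex.ofReal_ne_zero]
    have : Ideal.absNorm (g c) ≠ 0 := by
      rw [Ne, Ideal.absNorm_eq_zero_iff]; exact hg c
    have : (0:ℝ) < Ideal.absNorm (g c) := by exact_mod_cast Nat.pos_of_ne_zero this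
    positivity
  refine (this.mul_left (tt (trivChar (K := K)) s (g c))⁻¹).congr fun I => ?_
  by_cases hI : I ∈ Pset (g c)
  · rw [Set.indicator_of_mem hI, Set.indicator_of_mem hI, tt_mul, inv_mul_cancel_left₀ hne]
  · rw [Set.indicator_of_notMem hI, Set.indicator_of_notMem hI, mul_zero]

theorem reps_quot (g b D : Ideal (𝓞 K)) (hg : g ≠ 0) (hbD : IsCoprime b D) :
    ∃ (Q : Type uK) (τ : Q → 𝓞 K), Nat.card Q = Ideal.absNorm b ∧ (∀ q, τ q ∈ D) ∧
      Function.Injective (fun p : Q × (g * b : Ideal (𝓞 K)) => (p.2 : 𝓞 K) + τ p.1) ∧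
      Set.range (fun p : Q × (g * b : Ideal (𝓞 K)) => (p.2 : 𝓞 K) + τ p.1) = g := by
  have hex : ∀ x : g.toAddSubgroup, ∃ t ∈ D, ∃ (ht : t ∈ g), x.1 - t ∈ g * b := by
    intro x
    have hx : x.1 ∈ g * D ⊔ g * b := by
      rw [← Ideal.mul_sup, sup_comm, Ideal.isCoprime_iff_sup_eq.1 hbD, Ideal.mul_top]
      exact x.2
    obtain ⟨t, ht, z, hz, htz⟩ := Submodule.mem_sup.1 hx
    refine ⟨t, Ideal.mul_le_right ht, Ideal.mul_le_left ht, ?_⟩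
    rw [← htz, add_sub_cancel_left]; exact hz
  choose t htD htg ht using hex
  refine ⟨g.toAddSubgroup ⧸ ((g * b).toAddSubgroup.addSubgroupOf g.toAddSubgroup),
    fun q => t q.out, ?_, fun q => htD _, ?_, ?_⟩
  · have h := AddSubgroup.relIndex_mul_index
      (show (g * b).toAddSubgroup ≤ g.toAddSubgroup from fun x hx => Ideal.mul_le_left hx)
    have h1 : g.toAddSubgroup.index = Ideal.absNorm g := rfl
    have h2 : (g * b).toAddSubgroup.index = Ideal.absNorm (g * b) := rfl
    rw [h1, h2, map_mul, mul_comm] at h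
    refine mul_left_cancel₀ ?_ h
    rw [Ne, Ideal.absNorm_eq_zero_iff]; exact hg
  · rintro ⟨q, z⟩ ⟨q', z'⟩ h
    simp only at h
    have hq : q = q' := by
      rw [← Quotient.out_eq' q, ← Quotient.out_eq' q', QuotientAddGroup.eq,
        AddSubgroup.mem_addSubgroupOf]
      have a1 := ht q.out
      have a2 := ht q'.out
      have e : ((-q.out + q'.out : g.toAddSubgroup) : 𝓞 K) =
        -(q.out.1 - t q.out) + (q'.out.1 - t q'.out) + (z.1 - z'.1) := by
        have h' : t q.out = z'.1 + t q'.out - z.1 := by rw [← h]; ring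
        rw [h']
        push_cast
        ring
      rw [e]
      exact (g * b).add_mem ((g * b).add_mem ((g * b).neg_mem a1) a2)
        ((g * b).sub_mem z.2 z'.2)
    subst hq
    have : z = z' := Subtype.ext (add_right_cancel h)
    rw [this]
  · ext x
    constructor
    · rintro ⟨⟨q, z⟩, rfl⟩
      exact g.add_mem (Ideal.mul_le_left z.2) (htg _)
    · intro hx
      let q : g.toAddSubgroup ⧸ ((g * b).toAddSubgroup.addSubgroupOf g.toAddSubgroup) :=
        QuotientAddGroup.mk ⟨x, hx⟩
      have hq : q = QuotientAddGroup.mk q.out := (Quotient.out_eq' q).symm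
      have hq2 := QuotientAddGroup.eq.1 hq
      rw [AddSubgroup.mem_addSubgroupOf] at hq2
      have a1 := ht q.out
      have : x - t q.out ∈ g * b := by
        have e : x - t q.out = (q.out.1 - t q.out) -
          ((-(⟨x, hx⟩ : g.toAddSubgroup) + q.out : g.toAddSubgroup) : 𝓞 K) := by
          push_cast; ring
        rw [e]; exact (g * b).sub_mem a1 hq2
      exact ⟨(q, ⟨x - t q.out, this⟩), by simp⟩

theorem SG_compare {D : Ideal (𝓞 K)} (X : DChar D) (ω : 𝓞 K → ℝ)
    (hdiff : ∀ τ ∈ D, ∃ C' : ℝ, 0 ≤ C' ∧ ∀ s : ℝ, 1 < s → s ≤ 2 → ∀ y : 𝓞 K,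
      ‖GG X ω s (y + τ) - GG X ω s y‖ ≤ C' * (BB y + BB (y + τ)))
    (hS : ∀ s, 1 < s → Summable (GG X ω s)) (g b : Ideal (𝓞 K)) (hg : g ≠ 0) (hb : b ≠ 0)
    (hbD : IsCoprime b D) : ∃ C : ℝ, ∀ s : ℝ, 1 < s → s ≤ 2 →
      ‖(∑' y, (g : Set (𝓞 K)).indicator (GG X ω s) y) -
        Ideal.absNorm b * ∑' y, ((g * b : Ideal (𝓞 K)) : Set (𝓞 K)).indicator (GG X ω s) y‖ ≤ C := by
  obtain ⟨Q, τ, hcard, hτD, hinj, hran⟩ := reps_quot g b D hg hbD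
  have : Finite Q := by
    apply Nat.finite_of_card_ne_zero
    rw [hcard, Ne, Ideal.absNorm_eq_zero_iff]; exact hb
  have : Fintype Q := Fintype.ofFinite Q
  have hd := fun q => hdiff (τ q) (hτD q)
  choose C hC0 hC using hd
  refine ⟨∑ q, C q * (2 * ∑' y : 𝓞 K, BB y), fun s hs1 hs2 => ?_⟩
  have hSs := hS s hs1
  have e1 : (∑' y, (g : Set (𝓞 K)).indicator (GG X ω s) y) =
      ∑ q, ∑' z : (g * b : Ideal (𝓞 K)), GG X ω s (z + τ q) := by
    have h1 := (hSs.indicator (g : Set (𝓞 K))).hasSum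
    rw [← hinj.hasSum_iff] at h1
    · have h2 : ((g : Set (𝓞 K)).indicator (GG X ω s) ∘
          fun p : Q × (g * b : Ideal (𝓞 K)) => (p.2 : 𝓞 K) + τ p.1) =
          fun p => GG X ω s ((p.2 : 𝓞 K) + τ p.1) := by
        funext p
        simp only [Function.comp]
        rw [Set.indicator_of_mem]
        rw [← hran]; exact ⟨p, rfl⟩
      rw [h2] at h1
      rw [← h1.tsum_eq, h1.summable.tsum_prod, tsum_fintype]
    · intro x hx
      rw [hran] at hx
      rw [Set.indicator_of_notMem hx]
  have e2 : (∑' y, ((g * b : Ideal (𝓞 K)) : Set (𝓞 K)).indicator (GG X ω s) y) =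
      ∑' z : (g * b : Ideal (𝓞 K)), GG X ω s z := by
    rw [← tsum_subtype]; rfl
  have e3 : (Ideal.absNorm b : ℂ) = ∑ q : Q, 1 := by
    rw [← hcard, Nat.card_eq_fintype_card]; simp
  have hsub : Summable fun z : (g * b : Ideal (𝓞 K)) => GG X ω s z :=
    hSs.comp_injective Subtype.val_injective
  have hsub' : ∀ q, Summable fun z : (g * b : Ideal (𝓞 K)) => GG X ω s (z + τ q) := fun q =>
    hSs.comp_injective (i := fun z : (g * b : Ideal (𝓞 K)) => (z : 𝓞 K) + τ q)
      (fun a b h => Subtype.ext (add_right_cancel h))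
  rw [e1, e2, e3, Finset.sum_mul, ← Finset.sum_sub_distrib]
  refine (norm_sum_le _ _).trans (Finset.sum_le_sum fun q _ => ?_)
  rw [one_mul, ← (hsub' q).tsum_sub hsub]
  have hB1 : Summable fun z : (g * b : Ideal (𝓞 K)) => BB (z : 𝓞 K) :=
    summable_BB.comp_injective Subtype.val_injective
  have hB2 : Summable fun z : (g * b : Ideal (𝓞 K)) => BB ((z : 𝓞 K) + τ q) :=
    summable_BB.comp_injective (i := fun z : (g * b : Ideal (𝓞 K)) => (z : 𝓞 K) + τ q)
      (fun a b h => Subtype.ext (add_right_cancel h))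
  refine (tsum_of_norm_bounded ((hB1.add hB2).mul_left (C q)).hasSum
    (fun z => hC q s hs1 hs2 z)).trans ?_
  rw [tsum_mul_left, hB1.tsum_add hB2]
  have i1 : ∑' z : (g * b : Ideal (𝓞 K)), BB (z : 𝓞 K) ≤ ∑' y : 𝓞 K, BB y :=
    tsum_comp_le_tsum_of_inj summable_BB BB_nonneg Subtype.val_injective
  have i2 : ∑' z : (g * b : Ideal (𝓞 K)), BB ((z : 𝓞 K) + τ q) ≤ ∑' y : 𝓞 K, BB y :=
    tsum_comp_le_tsum_of_inj (i := fun z : (g * b : Ideal (𝓞 K)) => (z : 𝓞 K) + τ q)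
      summable_BB BB_nonneg (fun a b h => Subtype.ext (add_right_cancel h))
  have := hC0 q
  gcongr
  linarith

/-- L-function -/
noncomputable def LL {D : Ideal (𝓞 K)} (X : DChar D) (s : ℝ) : ℂ := ∑' I, tt X s I

theorem LL_bdd_aux {D : Ideal (𝓞 K)} (hD : D ≠ 0) (X : DChar D) (b : Ideal (𝓞 K)) (hb : b ≠ 0)
    (hbD : IsCoprime b D) : ∃ C : ℝ, ∀ s : ℝ, 1 < s → s ≤ 2 →
      ‖LL X s * (1 - Ideal.absNorm b * tt X s b)‖ ≤ C := by
  obtain ⟨ω, κ, C, hκ, hC, h0, h1, hsum, hsupp, hlip⟩ := exists_omega (K := K)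
  have hS : ∀ s, 1 < s → Summable (GG X ω s) := fun s hs => GG_summable X ω h0 h1 hsupp hs
  have hdiff := fun τ hτ => GG_diff X ω hC h0 h1 hsupp hlip τ hτ
  choose g hg hg1 hg2 using exists_rep (K := K) D hD
  have hcmp := fun c => SG_compare X ω hdiff hS (g c) b (hg c) hb hbD
  choose B hB using hcmp
  refine ⟨∑ c, B c * (Ideal.absNorm (g c) : ℝ) ^ (2:ℝ), fun s hs1 hs2 => ?_⟩
  have hNpos : ∀ c, (1:ℝ) ≤ Ideal.absNorm (g c) := by
    intro c
    have : Ideal.absNorm (g c) ≠ 0 := by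
      rw [Ne, Ideal.absNorm_eq_zero_iff]; exact hg c
    exact_mod_cast Nat.one_le_iff_ne_zero.2 this
  have hnorm : ∀ c, ‖tt X s (g c)‖ = (Ideal.absNorm (g c) : ℝ) ^ (-s) := by
    intro c
    unfold tt
    rw [norm_mul, X.norm_one _ (hg c) (hg1 c), one_mul, Complex.norm_real, Real.norm_eq_abs,
      abs_of_nonneg (by positivity)]
  have hne : ∀ c, tt X s (g c) ≠ 0 := by
    intro c
    rw [← norm_ne_zero_iff, hnorm c]
    have := hNpos c
    positivity
  have htt := summable_tt X hs1
  have e1 : LL X s = ∑ c, ∑' I, (Pset (g c)).indicator (tt X s) I := by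
    rw [← Summable.tsum_finsetSum fun c _ => htt.indicator _]
    exact tsum_congr fun I => (sum_reps (tt_zero _ _) g hg (Equiv.refl _) hg2 I).symm
  have e2 : LL X s = ∑ c, ∑' I, (Pset (g c * b)).indicator (tt X s) I := by
    rw [← Summable.tsum_finsetSum fun c _ => htt.indicator _]
    refine tsum_congr fun I => (sum_reps (tt_zero _ _) (fun c => g c * b)
      (fun c => mul_ne_zero (hg c) hb)
      (Equiv.mulRight (ClassGroup.mk0 ⟨b, mem_nonZeroDivisors_iff_ne_zero.2 hb⟩)) (fun c => ?_) I).symm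
    rw [Equiv.coe_mulRight]
    conv_rhs => rw [← hg2 c]
    change _ = ClassGroup.mk0 _ * ClassGroup.mk0 _
    rw [← map_mul]
    rfl
  have e3 : ∀ h : Ideal (𝓞 K), h ≠ 0 → tt X s h * ∑' I, (Pset h).indicator (tt X s) I =
      ∑' y, (h : Set (𝓞 K)).indicator (GG X ω s) y := by
    intro h hh
    rw [← (SG_hasSum X ω hsum (hS s hs1) h hh).tsum_eq, ← tsum_mul_left]
    refine tsum_congr fun I => ?_
    by_cases hI : I ∈ Pset h
    · rw [Set.indicator_of_mem hI, Set.indicator_of_mem hI, tt_mul]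
    · rw [Set.indicator_of_notMem hI, Set.indicator_of_notMem hI, mul_zero]
  have e4 : LL X s * (1 - Ideal.absNorm b * tt X s b) =
      ∑ c, (tt X s (g c))⁻¹ * ((∑' y, (g c : Set (𝓞 K)).indicator (GG X ω s) y) -
        Ideal.absNorm b *
          ∑' y, ((g c * b : Ideal (𝓞 K)) : Set (𝓞 K)).indicator (GG X ω s) y) := by
    rw [mul_sub, mul_one]
    nth_rw 1 [e1]
    rw [e2, Finset.sum_mul, ← Finset.sum_sub_distrib]
    refine Finset.sum_congr rfl fun c _ => ?_
    rw [← e3 _ (hg c), ← e3 _ (mul_ne_zero (hg c) hb), tt_mul, eq_inv_mul_iff_mul_eq₀ (hne c)]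
    ring
  rw [e4]
  refine (norm_sum_le _ _).trans (Finset.sum_le_sum fun c _ => ?_)
  rw [norm_mul, norm_inv, hnorm, Real.rpow_neg (by positivity), inv_inv, mul_comm]
  have := hNpos c
  have hBc := hB c s hs1 hs2
  refine mul_le_mul hBc ?_ (by positivity) ((norm_nonneg _).trans hBc)
  exact Real.rpow_le_rpow_of_exponent_le this hs2

open Filter Topology in
theorem LL_bdd {D : Ideal (𝓞 K)} (hD : D ≠ 0) (X : DChar D) (b : Ideal (𝓞 K)) (hb : b ≠ 0)
    (hbD : IsCoprime b D) (hb1 : X.χ b ≠ 1) :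
    ∃ C : ℝ, ∀ᶠ s in 𝓝[>] (1:ℝ), ‖LL X s‖ ≤ C := by
  obtain ⟨C, hC⟩ := LL_bdd_aux hD X b hb hbD
  have hN : (0:ℝ) < Ideal.absNorm b := by
    have : Ideal.absNorm b ≠ 0 := by
      rw [Ne, Ideal.absNorm_eq_zero_iff]; exact hb
    exact_mod_cast Nat.pos_of_ne_zero this
  have hcont : ContinuousAt (fun s : ℝ => ‖(1 : ℂ) - Ideal.absNorm b * tt X s b‖) 1 := by
    unfold tt
    have : ContinuousAt (fun s : ℝ => (Ideal.absNorm b : ℝ) ^ (-s)) 1 :=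
      (Real.continuousAt_const_rpow hN.ne').comp continuousAt_neg
    fun_prop
  set δ := ‖(1:ℂ) - X.χ b‖ with hδ
  have hδ0 : 0 < δ := norm_pos_iff.2 (sub_ne_zero.2 (Ne.symm hb1))
  have hval : ‖(1 : ℂ) - Ideal.absNorm b * tt X 1 b‖ = δ := by
    unfold tt
    rw [Real.rpow_neg_one, hδ]
    congr 2
    push_cast
    rw [mul_left_comm, mul_inv_cancel₀ (by exact_mod_cast hN.ne'), mul_one]
  have hev : ∀ᶠ s in 𝓝 (1:ℝ), δ / 2 < ‖(1 : ℂ) - Ideal.absNorm b * tt X s b‖ := by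
    apply hcont.eventually_const_lt
    change δ / 2 < ‖(1 : ℂ) - Ideal.absNorm b * tt X 1 b‖
    rw [hval]; linarith
  refine ⟨C / (δ / 2), ?_⟩
  have hev2 : ∀ᶠ s in 𝓝 (1:ℝ), s < 2 := eventually_lt_nhds (by norm_num)
  filter_upwards [hev.filter_mono nhdsWithin_le_nhds, hev2.filter_mono nhdsWithin_le_nhds,
    self_mem_nhdsWithin] with s h1 h2 h3
  have := hC s h3 h2.le
  rw [norm_mul] at this
  rw [le_div_iff₀ (by positivity)]
  exact le_trans (by gcongr) this

end bdd
end VL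

namespace VL
open NumberField InfinitePlace

section euler
variable {K : Type*} [Field K] [NumberField K]
open Filter Topology

/-- nonzero primes -/
abbrev PS (K : Type*) [Field K] [NumberField K] := IsDedekindDomain.HeightOneSpectrum (𝓞 K)

/-- norm of a prime -/
noncomputable def NN (P : PS K) : ℝ := Ideal.absNorm P.asIdeal

theorem two_le_NN (P : PS K) : 2 ≤ NN P := by
  have h0 : Ideal.absNorm P.asIdeal ≠ 0 := by
    rw [Ne, Ideal.absNorm_eq_zero_iff]; exact P.ne_bot
  have h1 : Ideal.absNorm P.asIdeal ≠ 1 := by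
    rw [Ne, Ideal.absNorm_eq_one_iff]; exact P.isPrime.ne_top
  have : 2 ≤ Ideal.absNorm P.asIdeal := by omega
  unfold NN
  exact_mod_cast this

theorem NN_pos (P : PS K) : 0 < NN P := by linarith [two_le_NN P]

/-- prime-free ideals -/
def Fr (S : Finset (PS K)) : Set (Ideal (𝓞 K)) := {I | ∀ P ∈ S, ¬ P.asIdeal ∣ I}

theorem euler_finite {D : Ideal (𝓞 K)} (X : DChar D) {s : ℝ} (hs : 1 < s) (S : Finset (PS K)) :
    LL X s * ∏ P ∈ S, (1 - tt X s P.asIdeal) = ∑' I, (Fr S).indicator (tt X s) I := by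
  classical
  have htt := summable_tt X hs
  induction S using Finset.induction_on with
  | empty =>
    simp only [Finset.prod_empty, mul_one, LL]
    refine tsum_congr fun I => ?_
    rw [Set.indicator_of_mem]
    intro P hP; simp at hP
  | insert P S hP ih =>
    rw [Finset.prod_insert hP, mul_left_comm, ih, sub_mul, one_mul, ← tsum_mul_left]
    have hinj : Function.Injective (fun J : Ideal (𝓞 K) => P.asIdeal * J) :=
      mul_right_injective₀ P.ne_bot
    have hdiv : ∀ J, P.asIdeal * J ∈ Fr S ↔ J ∈ Fr S := by
      intro J
      refine forall₂_congr fun Q hQ => ?_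
      rw [not_iff_not]
      have hQp : Prime Q.asIdeal := Ideal.prime_of_isPrime Q.ne_bot Q.isPrime
      refine ⟨fun h => ?_, fun h => h.mul_left _⟩
      rcases hQp.dvd_or_dvd h with h | h
      · exfalso
        have h1 : P.asIdeal ≤ Q.asIdeal := Ideal.dvd_iff_le.1 h
        have h2 := P.isMaximal.eq_of_le Q.isPrime.ne_top h1
        have : P = Q := IsDedekindDomain.HeightOneSpectrum.ext h2
        rw [this] at hP
        exact hP hQ
      · exact h
    have e : ∑' I, tt X s P.asIdeal * (Fr S).indicator (tt X s) I =
        ∑' I, ((Fr S) ∩ {I | P.asIdeal ∣ I}).indicator (tt X s) I := by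
      have := hinj.tsum_eq (f := ((Fr S) ∩ {I | P.asIdeal ∣ I}).indicator (tt X s)) (by
        intro I hI
        have := (Set.indicator_apply_ne_zero.1 hI).1.2
        obtain ⟨J, rfl⟩ := this
        exact ⟨J, rfl⟩)
      rw [← this]
      refine tsum_congr fun J => ?_
      by_cases hJ : J ∈ Fr S
      · rw [Set.indicator_of_mem hJ, Set.indicator_of_mem
          (show P.asIdeal * J ∈ Fr S ∩ {I | P.asIdeal ∣ I} from ⟨(hdiv J).2 hJ, Dvd.intro _ rfl⟩), tt_mul]
      · rw [Set.indicator_of_notMem hJ, Set.indicator_of_notMem, mul_zero]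
        rintro ⟨h, -⟩
        exact hJ ((hdiv J).1 h)
    rw [e, ← (htt.indicator _).tsum_sub (htt.indicator _)]
    refine tsum_congr fun I => ?_
    have hm : I ∈ Fr (insert P S) ↔ ¬ P.asIdeal ∣ I ∧ I ∈ Fr S := by
      unfold Fr
      simp only [Finset.mem_insert, forall_eq_or_imp, Set.mem_ofPred_eq]
    simp only [Set.indicator_apply, hm, Set.mem_inter_iff, Set.mem_ofPred_eq]
    by_cases h1 : I ∈ Fr S <;> by_cases h2 : P.asIdeal ∣ I <;> simp [h1, h2]

theorem euler_tendsto {D : Ideal (𝓞 K)} (X : DChar D) {s : ℝ} (hs : 1 < s) :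
    Tendsto (fun S : Finset (PS K) => LL X s * ∏ P ∈ S, (1 - tt X s P.asIdeal)) atTop (𝓝 1) := by
  classical
  simp_rw [euler_finite X hs]
  have h1 : (1 : ℂ) = ∑' I, ({1} : Set (Ideal (𝓞 K))).indicator (tt X s) I := by
    rw [tsum_eq_single 1]
    · rw [Set.indicator_of_mem (by simp), tt_one]
    · intro I hI
      rw [Set.indicator_of_notMem (by simpa using hI)]
  rw [show 𝓝 (1:ℂ) = 𝓝 (∑' I, ({1} : Set (Ideal (𝓞 K))).indicator (tt X s) I) from by rw [← h1]]
  refine tendsto_tsum_of_dominated_convergence (summable_tt X hs).norm ?_ ?_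
  · intro I
    apply tendsto_const_nhds.congr'
    by_cases h0 : I = 0
    · refine Eventually.of_forall fun S => ?_
      simp only [Set.indicator]
      rw [h0, tt_zero]; simp
    by_cases h1 : I = 1
    · refine Eventually.of_forall fun S => ?_
      rw [Set.indicator_of_mem (by simpa using h1)]
      beta_reduce
      rw [Set.indicator_of_mem]
      intro P _ hP
      rw [h1] at hP
      exact P.isPrime.ne_top (Ideal.isUnit_iff.1 (isUnit_of_dvd_one hP))
    · obtain ⟨M, hM, hIM⟩ := Ideal.exists_le_maximal I (by rwa [Ideal.one_eq_top] at h1)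
      have hMb : M ≠ ⊥ := by
        rintro rfl
        exact h0 (le_bot_iff.1 hIM)
      let P : PS K := ⟨M, hM.isPrime, hMb⟩
      filter_upwards [eventually_ge_atTop ({P} : Finset (PS K))] with S hS
      rw [Set.indicator_of_notMem (by simpa using h1), Set.indicator_of_notMem]
      intro h
      exact h P (hS (Finset.mem_singleton_self P)) (Ideal.dvd_iff_le.2 hIM)
  · refine Eventually.of_forall fun S I => ?_
    by_cases h : I ∈ Fr S
    · rw [Set.indicator_of_mem h]
    · rw [Set.indicator_of_notMem h, norm_zero]; positivity

theorem log_approx {a : ℂ} (ha : ‖a‖ ≤ 1 / 2) :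
    1 - a ≠ 0 ∧ |Real.log ‖1 - a‖ + a.re| ≤ ‖a‖ ^ 2 := by
  have h1 : ‖-a‖ < 1 := by rw [norm_neg]; linarith
  have h0 : 1 - a ≠ 0 := by
    intro h
    rw [← sub_eq_zero.1 h, norm_one] at ha
    norm_num at ha
  refine ⟨h0, ?_⟩
  have h2 := Complex.norm_log_one_add_sub_self_le h1
  have h3 := (Complex.abs_re_le_norm _).trans h2
  rw [Complex.sub_re, Complex.log_re, Complex.neg_re, sub_neg_eq_add, ← sub_eq_add_neg,
    norm_neg] at h3
  refine h3.trans ?_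
  have h4 : (1 - ‖a‖)⁻¹ ≤ 2 := by
    rw [inv_le_comm₀ (by linarith) (by norm_num)]; linarith
  have := sq_nonneg ‖a‖
  nlinarith

theorem summable_NN {s : ℝ} (hs : 1 < s) : Summable fun P : PS K => NN P ^ (-s) := by
  have h := (summable_tt (trivChar (K := K)) hs).norm.comp_injective
    (i := fun P : PS K => P.asIdeal) (fun P Q h => IsDedekindDomain.HeightOneSpectrum.ext h)
  refine h.congr fun P => ?_
  simp only [Function.comp, tt]
  rw [trivChar_apply P.ne_bot, one_mul, Complex.norm_real, Real.norm_eq_abs,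
    abs_of_nonneg (by positivity)]
  rfl

theorem norm_tt_le {D : Ideal (𝓞 K)} (X : DChar D) (s : ℝ) (P : PS K) :
    ‖tt X s P.asIdeal‖ ≤ NN P ^ (-s) := by
  have := NN_pos P
  unfold tt
  rw [norm_mul, Complex.norm_real, Real.norm_eq_abs]
  change _ * |NN P ^ (-s)| ≤ _
  rw [abs_of_nonneg (by positivity)]
  exact mul_le_of_le_one_left (by positivity) (X.norm_le_one _)

theorem summable_tt_prime {D : Ideal (𝓞 K)} (X : DChar D) {s : ℝ} (hs : 1 < s) :
    Summable fun P : PS K => tt X s P.asIdeal :=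
  Summable.of_norm_bounded (summable_NN hs) fun P => norm_tt_le X s P

theorem log_LL {D : Ideal (𝓞 K)} (X : DChar D) {s : ℝ} (hs : 1 < s) : LL X s ≠ 0 ∧
    |Real.log ‖LL X s‖ - ∑' P : PS K, (tt X s P.asIdeal).re| ≤ ∑' P : PS K, NN P ^ (-2:ℝ) := by
  have hlim := euler_tendsto X hs
  have hL : LL X s ≠ 0 := by
    intro h
    simp only [h, zero_mul] at hlim
    exact zero_ne_one (tendsto_nhds_unique tendsto_const_nhds hlim)
  refine ⟨hL, ?_⟩
  set E := ∑' P : PS K, NN P ^ (-2:ℝ) with hE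
  have hhalf : ∀ P : PS K, ‖tt X s P.asIdeal‖ ≤ 1 / 2 := by
    intro P
    refine (norm_tt_le X s P).trans ?_
    have h2 := two_le_NN P
    have hp := NN_pos P
    calc NN P ^ (-s) ≤ NN P ^ (-1:ℝ) :=
          Real.rpow_le_rpow_of_exponent_le (by linarith) (by linarith)
      _ = (NN P)⁻¹ := Real.rpow_neg_one _
      _ ≤ 1 / 2 := by rw [inv_le_comm₀ hp (by norm_num)]; linarith
  have hsq : ∀ P : PS K, ‖tt X s P.asIdeal‖ ^ 2 ≤ NN P ^ (-2:ℝ) := by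
    intro P
    have h2 := two_le_NN P
    have hp := NN_pos P
    calc ‖tt X s P.asIdeal‖ ^ 2 ≤ (NN P ^ (-s)) ^ 2 := by
          gcongr; exact norm_tt_le X s P
      _ = NN P ^ (-s * 2) := by rw [Real.rpow_mul hp.le]; norm_cast
      _ ≤ _ := Real.rpow_le_rpow_of_exponent_le (by linarith) (by linarith)
  have hbd : ∀ S : Finset (PS K),
      |Real.log ‖LL X s * ∏ P ∈ S, (1 - tt X s P.asIdeal)‖ -
        (Real.log ‖LL X s‖ - ∑ P ∈ S, (tt X s P.asIdeal).re)| ≤ E := by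
    intro S
    have hne : ∀ P ∈ S, ‖1 - tt X s P.asIdeal‖ ≠ 0 := fun P _ =>
      norm_ne_zero_iff.2 (log_approx (hhalf P)).1
    rw [norm_mul, norm_prod, Real.log_mul (norm_ne_zero_iff.2 hL) (Finset.prod_ne_zero_iff.2 hne),
      Real.log_prod hne]
    have e : Real.log ‖LL X s‖ + ∑ P ∈ S, Real.log ‖1 - tt X s P.asIdeal‖ -
        (Real.log ‖LL X s‖ - ∑ P ∈ S, (tt X s P.asIdeal).re) =
        ∑ P ∈ S, (Real.log ‖1 - tt X s P.asIdeal‖ + (tt X s P.asIdeal).re) := by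
      rw [Finset.sum_add_distrib]; ring
    rw [e]
    refine (Finset.abs_sum_le_sum_abs _ _).trans ?_
    refine (Finset.sum_le_sum fun P _ => ((log_approx (hhalf P)).2.trans (hsq P))).trans ?_
    exact (summable_NN (K := K) (by norm_num : (1:ℝ) < 2)).sum_le_tsum S
      (fun P _ => by have := NN_pos P; positivity)
  have l1 : Tendsto (fun S : Finset (PS K) =>
      Real.log ‖LL X s * ∏ P ∈ S, (1 - tt X s P.asIdeal)‖) atTop (𝓝 0) := by
    have h := hlim.norm.log (by simp)
    simpa using h
  have hsre : Summable fun P : PS K => (tt X s P.asIdeal).re :=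
    (Complex.hasSum_re (summable_tt_prime X hs).hasSum).summable
  have l2 : Tendsto (fun S : Finset (PS K) => ∑ P ∈ S, (tt X s P.asIdeal).re) atTop
      (𝓝 (∑' P : PS K, (tt X s P.asIdeal).re)) := hsre.hasSum
  have l3 := (l1.sub (l2.const_sub (Real.log ‖LL X s‖))).abs
  have := le_of_tendsto l3 (Eventually.of_forall hbd)
  rwa [zero_sub, abs_neg] at this

theorem LL_triv_eq {s : ℝ} (hs : 1 < s) : LL (trivChar (K := K)) s = dedekindZeta K s := by
  unfold dedekindZeta LSeries LL
  have h := (summable_tt (trivChar (K := K)) hs)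
  have h' : Summable (fun x : (Σ n : ℕ, {I : Ideal (𝓞 K) // Ideal.absNorm I = n}) =>
      tt (trivChar (K := K)) s x.2.1) :=
    (Equiv.sigmaFiberEquiv (fun I : Ideal (𝓞 K) => Ideal.absNorm I)).summable_iff
      (f := tt (trivChar (K := K)) s) |>.2 h
  have e1 : ∑' I, tt (trivChar (K := K)) s I =
      ∑' x : (Σ n : ℕ, {I : Ideal (𝓞 K) // Ideal.absNorm I = n}),
        tt (trivChar (K := K)) s x.2.1 :=
    ((Equiv.sigmaFiberEquiv (fun I : Ideal (𝓞 K) => Ideal.absNorm I)).tsum_eq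
      (tt (trivChar (K := K)) s)).symm
  rw [e1, h'.tsum_sigma]
  refine tsum_congr fun n => ?_
  by_cases hn : n = 0
  · subst hn
    rw [LSeries.term_zero]
    convert tsum_zero with x
    obtain ⟨I, hI⟩ := x
    have : I = 0 := Ideal.absNorm_eq_zero_iff.1 hI
    subst this
    exact tt_zero _ _
  rw [LSeries.term_of_ne_zero hn]
  have e : ∀ x : {I : Ideal (𝓞 K) // Ideal.absNorm I = n},
      tt (trivChar (K := K)) s x.1 = (1 : ℂ) / (n : ℂ) ^ (s : ℂ) := by
    rintro ⟨I, hI⟩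
    change tt (trivChar (K := K)) s I = _
    have hI0 : I ≠ 0 := by
      rintro rfl
      apply hn
      rw [← hI]; simp
    unfold tt
    rw [trivChar_apply hI0, one_mul, hI, Real.rpow_neg (by positivity), Complex.ofReal_inv,
      Complex.ofReal_cpow (by positivity), one_div]
    simp
  have hfin : Finite {I : Ideal (𝓞 K) // Ideal.absNorm I = n} :=
    (Ideal.finite_setOfPred_absNorm_eq n).to_subtype
  have : Fintype {I : Ideal (𝓞 K) // Ideal.absNorm I = n} := Fintype.ofFinite _
  rw [tsum_congr e, tsum_fintype]
  simp [div_eq_mul_inv]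

/-- the main term -/
noncomputable def lam (s : ℝ) : ℝ := -Real.log (s - 1)

theorem lam_tendsto : Tendsto lam (𝓝[>] 1) atTop := by
  unfold lam
  apply tendsto_neg_atBot_atTop.comp
  apply Real.tendsto_log_nhdsGT_zero.comp
  rw [tendsto_nhdsWithin_iff]
  constructor
  · have : Tendsto (fun s : ℝ => s - 1) (𝓝 1) (𝓝 (1 - 1)) := (continuous_sub_right 1).tendsto 1
    rw [sub_self] at this
    exact this.mono_left nhdsWithin_le_nhds
  · filter_upwards [self_mem_nhdsWithin] with s hs
    have hs' : (1:ℝ) < s := hs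
    exact sub_pos.2 hs'

/-- weighted prime sum -/
noncomputable def PSum (f : PS K → ℝ) (s : ℝ) : ℝ := ∑' P, f P * NN P ^ (-s)

theorem PSum_summable {f : PS K → ℝ} {B : ℝ} (hf : ∀ P, |f P| ≤ B) {s : ℝ} (hs : 1 < s) :
    Summable fun P => f P * NN P ^ (-s) := by
  refine Summable.of_norm_bounded ((summable_NN hs).mul_left B) fun P => ?_
  have := NN_pos P
  rw [norm_mul, Real.norm_eq_abs, Real.norm_eq_abs, abs_of_nonneg (a := NN P ^ (-s)) (by positivity)]
  gcongr
  exact hf P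

theorem PSum_one : ∃ C : ℝ, ∀ᶠ s in 𝓝[>] (1:ℝ), |PSum (fun _ : PS K => 1) s - lam s| ≤ C := by
  have hres := dedekindZeta_residue_pos K
  have h1 := (tendsto_sub_one_mul_dedekindZeta_nhdsGT K).norm
  have h2 := h1.log (by
    rw [Complex.norm_real, Real.norm_eq_abs, abs_of_pos hres]; exact hres.ne')
  set R := Real.log ‖(dedekindZeta_residue K : ℂ)‖
  have h3 := (h2.sub_const R).abs
  rw [sub_self, abs_zero] at h3
  have h4 := h3.eventually_lt_const (zero_lt_one)
  refine ⟨1 + |R| + ∑' P : PS K, NN P ^ (-2:ℝ), ?_⟩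
  filter_upwards [h4, self_mem_nhdsWithin] with s hs hs1
  have hs1' : (1:ℝ) < s := hs1
  obtain ⟨g1, g2⟩ := log_LL (trivChar (K := K)) hs1'
  rw [← LL_triv_eq hs1', norm_mul, Real.log_mul _ (norm_ne_zero_iff.2 g1)] at hs
  swap
  · rw [Ne, norm_eq_zero, ← Complex.ofReal_one, ← Complex.ofReal_sub, Complex.ofReal_eq_zero]
    linarith
  have e1 : ‖((s:ℂ) - 1)‖ = s - 1 := by
    rw [← Complex.ofReal_one, ← Complex.ofReal_sub, Complex.norm_real, Real.norm_eq_abs,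
      abs_of_pos (by linarith)]
  have e2 : ∑' P : PS K, (tt (trivChar (K := K)) s P.asIdeal).re = PSum (fun _ : PS K => 1) s := by
    unfold PSum
    refine tsum_congr fun P => ?_
    unfold tt
    rw [trivChar_apply P.ne_bot, one_mul, Complex.ofReal_re, one_mul]
    rfl
  rw [e1] at hs
  rw [e2] at g2
  unfold lam
  have a1 := abs_lt.1 hs
  have a2 := abs_le.1 g2
  have a3 := neg_abs_le R
  have a4 := le_abs_self R
  rw [abs_le]
  constructor <;> linarith [a1.1, a1.2, a2.1, a2.2]

theorem PSum_char {D : Ideal (𝓞 K)} (hD : D ≠ 0) (X : DChar D) (b : Ideal (𝓞 K)) (hb : b ≠ 0)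
    (hbD : IsCoprime b D) (hb1 : X.χ b ≠ 1) :
    ∃ C : ℝ, ∀ᶠ s in 𝓝[>] (1:ℝ), PSum (fun P : PS K => (X.χ P.asIdeal).re) s ≤ C := by
  obtain ⟨C, hC⟩ := LL_bdd hD X b hb hbD hb1
  refine ⟨Real.log C + ∑' P : PS K, NN P ^ (-2:ℝ), ?_⟩
  filter_upwards [hC, self_mem_nhdsWithin] with s hs hs1
  obtain ⟨g1, g2⟩ := log_LL X hs1
  have e2 : ∑' P : PS K, (tt X s P.asIdeal).re = PSum (fun P : PS K => (X.χ P.asIdeal).re) s := by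
    unfold PSum
    refine tsum_congr fun P => ?_
    unfold tt
    rw [Complex.re_mul_ofReal]
    rfl
  rw [e2] at g2
  have := Real.log_le_log (norm_pos_iff.2 g1) hs
  linarith [(abs_le.1 g2).1]

end euler
end VL

namespace VL
open NumberField InfinitePlace

section lower
variable {K : Type*} [Field K] [NumberField K]
open Filter Topology

theorem PSum_add {f g : PS K → ℝ} {B B' : ℝ} (hf : ∀ P, |f P| ≤ B) (hg : ∀ P, |g P| ≤ B')
    {s : ℝ} (hs : 1 < s) : PSum (fun P => f P + g P) s = PSum f s + PSum g s := by
  unfold PSum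
  rw [← (PSum_summable hf hs).tsum_add (PSum_summable hg hs)]
  exact tsum_congr fun P => by ring

theorem PSum_smul (c : ℝ) (f : PS K → ℝ) (s : ℝ) : PSum (fun P => c * f P) s = c * PSum f s := by
  unfold PSum
  rw [← tsum_mul_left]
  exact tsum_congr fun P => by ring

theorem PSum_le {f g : PS K → ℝ} {B B' : ℝ} (hf : ∀ P, |f P| ≤ B) (hg : ∀ P, |g P| ≤ B')
    {F : Set (PS K)} (hF : F.Finite) (h : ∀ P, P ∉ F → f P ≤ g P) :
    ∃ C : ℝ, ∀ s : ℝ, 1 < s → PSum f s ≤ PSum g s + C := by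
  classical
  refine ⟨∑ P ∈ hF.toFinset, (|f P| + |g P|), fun s hs => ?_⟩
  have hS : HasSum (fun P => if P ∈ hF.toFinset then (|f P| + |g P|) else 0)
      (∑ P ∈ hF.toFinset, (|f P| + |g P|)) := by
    have := hasSum_sum_of_ne_finset_zero (L := SummationFilter.unconditional _)
      (f := fun P => if P ∈ hF.toFinset then (|f P| + |g P|) else 0) (s := hF.toFinset)
      (fun b hb => by simp [hb])
    rwa [Finset.sum_congr rfl (g := fun P => (|f P| + |g P|)) (fun P hP => by simp [hP])] at this
  have hs2 := PSum_summable hg hs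
  unfold PSum
  rw [← hS.tsum_eq, ← hs2.tsum_add hS.summable]
  refine (PSum_summable hf hs).tsum_le_tsum (fun P => ?_) (hs2.add hS.summable)
  have hp := NN_pos P
  have h2 := two_le_NN P
  have hpos : 0 < NN P ^ (-s) := by positivity
  by_cases hP : P ∈ F
  · simp only [Set.Finite.mem_toFinset, hP, if_true]
    have h1 : NN P ^ (-s) ≤ 1 := Real.rpow_le_one_of_one_le_of_nonpos (by linarith) (by linarith)
    have e1 := le_abs_self (f P)
    have e2 := neg_abs_le (g P)
    have e3 := abs_nonneg (f P)
    have e4 := abs_nonneg (g P)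
    nlinarith
  · simp only [Set.Finite.mem_toFinset, hP, if_false, add_zero]
    exact mul_le_mul_of_nonneg_right (h P hP) hpos.le

open Classical in
/-- real indicator -/
noncomputable def ind (p : Prop) : ℝ := if p then 1 else 0

theorem ind_abs (p : Prop) : |ind p| ≤ 1 := by
  unfold ind; split_ifs <;> simp
theorem ind_nonneg (p : Prop) : 0 ≤ ind p := by
  unfold ind; split_ifs <;> simp
theorem ind_le_one (p : Prop) : ind p ≤ 1 := by
  unfold ind; split_ifs <;> simp
theorem ind_true {p : Prop} (h : p) : ind p = 1 := by simp [ind, h]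
theorem ind_false {p : Prop} (h : ¬ p) : ind p = 0 := by simp [ind, h]

variable {L : Type*} [Field L] [NumberField L] [Algebra K L]

/-- the prime below -/
noncomputable def below (K : Type*) [Field K] [NumberField K] {L : Type*} [Field L] [NumberField L]
    [Algebra K L] (Q : PS L) : PS K :=
  ⟨Q.asIdeal.under (𝓞 K), inferInstance, fun h =>
    Q.ne_bot (Ideal.eq_bot_of_comap_eq_bot h)⟩

theorem below_card (P : PS K) :
    Finite {Q : PS L // below K Q = P} ∧
    Nat.card {Q : PS L // below K Q = P} ≤ Module.finrank K L := by
  classical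
  have := P.isMaximal
  let ι : {Q : PS L // below K Q = P} → IsDedekindDomain.primesOverFinset P.asIdeal (𝓞 L) :=
    fun Q => ⟨Q.1.asIdeal, (IsDedekindDomain.mem_primesOverFinset_iff P.ne_bot _).2
      ⟨Q.1.isPrime, ⟨(congrArg (fun P : PS K => P.asIdeal) Q.2).symm⟩⟩⟩
  have hι : Function.Injective ι := by
    intro Q Q' h
    apply Subtype.ext
    apply IsDedekindDomain.HeightOneSpectrum.ext
    exact congrArg Subtype.val h
  refine ⟨Finite.of_injective ι hι, ?_⟩
  refine (Nat.card_le_card_of_injective ι hι).trans ?_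
  rw [Nat.card_eq_fintype_card, Fintype.card_coe,
    ← Ideal.sum_ramification_inertia (𝓞 L) K L P.ne_bot, Finset.card_eq_sum_ones]
  refine Finset.sum_le_sum fun Q hQ => ?_
  obtain ⟨h1, h2⟩ := (IsDedekindDomain.mem_primesOverFinset_iff P.ne_bot _).1 hQ
  have a1 := Ideal.IsDedekindDomain.ramificationIdx'_ne_zero_of_liesOver Q P.ne_bot
  have a2 : 0 < Ideal.inertiaDeg' P.asIdeal Q := Ideal.inertiaDeg'_pos _ _
  exact Nat.one_le_iff_ne_zero.2 (mul_ne_zero a1 a2.ne')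

theorem NN_below (Q : PS L) : ∃ f : ℕ, 0 < f ∧ NN Q = NN (below K Q) ^ f := by
  have : Q.asIdeal.LiesOver (below K Q).asIdeal := ⟨rfl⟩
  have := (below K Q).isMaximal
  have h := Ideal.absNorm_eq_pow_inertiaDeg'_of_liesOver Q.asIdeal (below K Q).asIdeal
    (below K Q).isPrime (below K Q).ne_bot
  have a2 : 0 < Ideal.inertiaDeg' (below K Q).asIdeal Q.asIdeal := Ideal.inertiaDeg'_pos _ _
  refine ⟨_, a2, ?_⟩
  unfold NN
  rw [h]; push_cast; rfl

theorem lower_bound (L : Type*) [Field L] [NumberField L] [Algebra K L] (g : ℕ)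
    (hg : Module.finrank K L ≤ g) (G : PS K → Prop) {F : Set (PS K)} (hF : F.Finite)
    (hG : ∀ Q : PS L, NN Q = NN (below K Q) → below K Q ∉ F → G (below K Q)) :
    ∃ C : ℝ, ∀ᶠ s in 𝓝[>] (1:ℝ), lam s ≤ g * PSum (fun P => ind (G P)) s + C := by
  obtain ⟨C1, h1⟩ := PSum_one (K := L)
  obtain ⟨C2, h2⟩ := PSum_le (K := K) (f := fun P => ind (∃ Q : PS L, below K Q = P ∧ NN Q = NN P))
    (g := fun P => ind (G P)) (fun P => ind_abs _) (fun P => ind_abs _) hF (by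
      intro P hP
      by_cases h : ∃ Q : PS L, below K Q = P ∧ NN Q = NN P
      · obtain ⟨Q, rfl, hQ⟩ := h
        rw [ind_true (hG Q hQ hP)]
        exact ind_le_one _
      · rw [ind_false h]; exact ind_nonneg _)
  refine ⟨C1 + g * C2 + g * ∑' P : PS K, NN P ^ (-2:ℝ), ?_⟩
  filter_upwards [h1, self_mem_nhdsWithin] with s h1 hs
  have hs : (1:ℝ) < s := hs
  have h2 := h2 s hs
  have h1 := (abs_le.1 h1).1
  set H : PS K → Prop := fun P => ∃ Q : PS L, below K Q = P ∧ NN Q = NN P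
  have key : PSum (fun _ : PS L => 1) s ≤
      g * PSum (fun P => ind (H P)) s + g * ∑' P : PS K, NN P ^ (-2:ℝ) := by
    have hsum := PSum_summable (K := L) (f := fun _ => 1) (B := 1) (fun P => by simp) hs
    have hsum' : Summable (fun x : (Σ P : PS K, {Q : PS L // below K Q = P}) =>
        (1:ℝ) * NN x.2.1 ^ (-s)) :=
      (Equiv.sigmaFiberEquiv (fun Q : PS L => below K Q)).summable_iff
        (f := fun Q : PS L => (1:ℝ) * NN Q ^ (-s)) |>.2 hsum
    have e1 : PSum (fun _ : PS L => 1) s =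
        ∑' x : (Σ P : PS K, {Q : PS L // below K Q = P}), (1:ℝ) * NN x.2.1 ^ (-s) :=
      ((Equiv.sigmaFiberEquiv (fun Q : PS L => below K Q)).tsum_eq
        (fun Q : PS L => (1:ℝ) * NN Q ^ (-s))).symm
    have hr1 := (PSum_summable (f := fun P => ind (H P)) (fun P => ind_abs _) hs).mul_left (g:ℝ)
    have hr2 := (summable_NN (K := K) (by norm_num : (1:ℝ) < 2)).mul_left (g:ℝ)
    rw [e1, hsum'.tsum_sigma]
    unfold PSum
    rw [← tsum_mul_left, ← tsum_mul_left, ← hr1.tsum_add hr2]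
    refine hsum'.sigma.tsum_le_tsum (fun P => ?_) (hr1.add hr2)
    obtain ⟨hfin, hcard⟩ := below_card (K := K) (L := L) P
    have : Fintype {Q : PS L // below K Q = P} := Fintype.ofFinite _
    rw [tsum_fintype]
    have hp := NN_pos P
    have hp2 := two_le_NN P
    have hb : ∀ Q : {Q : PS L // below K Q = P}, (1:ℝ) * NN Q.1 ^ (-s) ≤
        ind (H P) * NN P ^ (-s) + NN P ^ (-2:ℝ) := by
      rintro ⟨Q, rfl⟩
      rw [one_mul]
      obtain ⟨f, hf, hNf⟩ := NN_below (K := K) Q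
      rcases Nat.lt_or_ge 1 f with hf1 | hf1
      · have : NN Q ^ (-s) ≤ NN (below K Q) ^ (-2:ℝ) := by
          rw [hNf, ← Real.rpow_natCast, ← Real.rpow_mul hp.le]
          apply Real.rpow_le_rpow_of_exponent_le (by linarith)
          have : (2:ℝ) ≤ f := by exact_mod_cast hf1
          nlinarith
        have h3 : 0 ≤ ind (H (below K Q)) * NN (below K Q) ^ (-s) :=
          mul_nonneg (ind_nonneg _) (by positivity)
        linarith
      · have : f = 1 := by omega
        rw [this, pow_one] at hNf
        rw [ind_true ⟨Q, rfl, hNf⟩, hNf, one_mul]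
        have : 0 ≤ NN (below K Q) ^ (-2:ℝ) := by positivity
        linarith
    refine (Finset.sum_le_sum fun Q _ => hb Q).trans ?_
    rw [Finset.sum_const, nsmul_eq_mul, ← mul_add]
    apply mul_le_mul_of_nonneg_right
    · rw [Finset.card_univ, ← Nat.card_eq_fintype_card]
      exact_mod_cast hcard.trans hg
    · have := mul_nonneg (ind_nonneg (H P)) (by positivity : 0 ≤ NN P ^ (-s))
      positivity
  have hg0 : (0:ℝ) ≤ g := by positivity
  nlinarith

end lower
end VL

namespace VL
open NumberField InfinitePlace

section normchar
variable {K : Type*} [Field K] [NumberField K]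
open Filter Topology

theorem absNorm_nat (c : ℕ) :
    Ideal.absNorm (Ideal.span {(c : 𝓞 K)}) = c ^ Module.finrank ℚ K := by
  rw [Ideal.absNorm_span_singleton]
  have : (c : 𝓞 K) = algebraMap ℤ (𝓞 K) c := by simp
  rw [this, Algebra.norm_algebraMap, RingOfIntegers.rank]
  simp

theorem coprime_iff_norm (M : ℕ) (I : Ideal (𝓞 K)) :
    IsCoprime I (Ideal.span {(M : 𝓞 K)}) ↔ (Ideal.absNorm I).Coprime M := by
  constructor
  · intro h
    by_contra hc
    obtain ⟨p, hp, hpI, hpM⟩ := Nat.Prime.not_coprime_iff_dvd.1 hc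
    by_cases h0 : Ideal.absNorm I = 0
    · rw [Ideal.absNorm_eq_zero_iff] at h0
      subst h0
      rw [Ideal.isCoprime_iff_sup_eq, bot_sup_eq] at h
      have h3 := absNorm_nat (K := K) M
      rw [h, Ideal.absNorm_top] at h3
      have h4 : p ∣ 1 := by
        rw [h3]
        exact hpM.trans (dvd_pow_self _ Module.finrank_pos.ne')
      exact hp.one_lt.ne' (Nat.dvd_one.1 h4)
    have : Fact p.Prime := ⟨hp⟩
    have hfin : Finite (𝓞 K ⧸ I) := by
      apply Nat.finite_of_card_ne_zero
      rwa [Ideal.absNorm_apply, Submodule.cardQuot_apply] at h0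
    obtain ⟨x, hx⟩ := exists_prime_addOrderOf_dvd_card' (G := 𝓞 K ⧸ I) p (by
      rwa [Ideal.absNorm_apply, Submodule.cardQuot_apply] at hpI)
    obtain ⟨i, hi, j, hj, hij⟩ := Ideal.isCoprime_iff_exists.1 h
    obtain ⟨c, rfl⟩ := Ideal.mem_span_singleton'.1 hj
    obtain ⟨q, rfl⟩ := hpM
    have h1 : (p : 𝓞 K ⧸ I) * x = 0 := by
      rw [← nsmul_eq_mul, ← hx, addOrderOf_nsmul_eq_zero]
    have h2 : (1 : 𝓞 K ⧸ I) = Ideal.Quotient.mk I (c * q) * p := by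
      rw [← map_one (Ideal.Quotient.mk I), ← hij, map_add, Ideal.Quotient.eq_zero_iff_mem.2 hi]
      push_cast
      simp only [map_mul, map_natCast]; ring
    have h3 : x = 0 := by
      rw [← one_mul x, h2, mul_assoc, h1, mul_zero]
    rw [h3, addOrderOf_zero] at hx
    exact hp.one_lt.ne hx
  · intro h
    have h1 : IsCoprime ((Ideal.absNorm I : ℕ) : ℤ) (M : ℤ) := Nat.isCoprime_iff_coprime.2 h
    obtain ⟨a, b, hab⟩ := h1
    rw [Ideal.isCoprime_iff_exists]
    refine ⟨(a : 𝓞 K) * (Ideal.absNorm I : ℕ), I.mul_mem_left _ (Ideal.absNorm_mem I),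
      (b : 𝓞 K) * M, Ideal.mul_mem_left _ _ (Ideal.mem_span_singleton_self _), ?_⟩
    exact_mod_cast congrArg (Int.cast : ℤ → 𝓞 K) hab

theorem norm_congr (M : ℕ) (α β : 𝓞 K) (h : (M : 𝓞 K) ∣ α - β) :
    ((Algebra.norm ℤ α : ℤ) : ZMod M) = ((Algebra.norm ℤ β : ℤ) : ZMod M) := by
  classical
  obtain ⟨γ, hγ⟩ := h
  have hα : α = β + M * γ := by rw [← hγ]; ring
  let b := RingOfIntegers.basis K
  rw [Algebra.norm_eq_matrix_det b, Algebra.norm_eq_matrix_det b]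
  have e : ∀ A : Matrix (Module.Free.ChooseBasisIndex ℤ (𝓞 K)) (Module.Free.ChooseBasisIndex ℤ (𝓞 K)) ℤ,
      ((A.det : ℤ) : ZMod M) = ((Int.castRingHom (ZMod M)).mapMatrix A).det :=
    fun A => RingHom.map_det (Int.castRingHom (ZMod M)) A
  rw [e, e]
  congr 1
  rw [hα, map_add, map_mul, map_add]
  have : Algebra.leftMulMatrix b (M : 𝓞 K) = (M : Matrix _ _ ℤ) := map_natCast _ _
  rw [this, map_mul, map_natCast]
  have h0 : ((M : ℕ) : Matrix (Module.Free.ChooseBasisIndex ℤ (𝓞 K)) (Module.Free.ChooseBasisIndex ℤ (𝓞 K)) (ZMod M)) = 0 := by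
    rw [← Matrix.diagonal_natCast']
    simp
  rw [h0, zero_mul, add_zero]

theorem norm_pos_of_signs {α β : 𝓞 K} (hα : α ≠ 0) (hβ : β ≠ 0)
    (h : ∀ φ : K →+* ℝ, 0 < φ (α : K) * φ (β : K)) :
    0 < Algebra.norm ℤ α * Algebra.norm ℤ β := by
  have h1 := norm_pos_of_totPos ((α : K) * (β : K)) (mul_ne_zero (by exact_mod_cast hα)
    (by exact_mod_cast hβ)) (fun φ => by rw [map_mul]; exact h φ)
  rw [map_mul, ← Algebra.coe_norm_int, ← Algebra.coe_norm_int] at h1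
  exact_mod_cast h1

/-- character through the norm -/
noncomputable def normChar (K : Type*) [Field K] [NumberField K] {M : ℕ} (hM : M ≠ 0)
    (ψ : DirichletCharacter ℂ M) :
    DChar (Ideal.span {(M : 𝓞 K)}) where
  χ := { toFun := fun I => by
          classical exact if I = 0 then 0 else ψ ((Ideal.absNorm I : ℕ) : ZMod M)
         map_zero' := by simp
         map_one' := by
          have : (1 : Ideal (𝓞 K)) ≠ 0 := one_ne_zero
          simp [this]
         map_mul' := fun I J => by
          rw [Ideal.zero_eq_bot]
          by_cases h : I = ⊥ <;> by_cases h' : J = ⊥ <;> simp [h, h'] }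
  norm_one I hI h := by
    have : NeZero M := ⟨hM⟩
    rw [coprime_iff_norm] at h
    simp only [MonoidWithZeroHom.coe_mk, ZeroHom.coe_mk, if_neg hI]
    have := DirichletCharacter.unit_norm_eq_one ψ (ZMod.unitOfCoprime _ h)
    simpa using this
  zero I h := by
    rw [coprime_iff_norm] at h
    simp only [MonoidWithZeroHom.coe_mk, ZeroHom.coe_mk]
    split_ifs
    · rfl
    · apply MulChar.map_nonunit
      rwa [ZMod.isUnit_iff_coprime]
  per α β hα hβ hD hc hs := by
    have h1 : Ideal.span {α} ≠ 0 := by simpa using hα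
    have h2 : Ideal.span {β} ≠ 0 := by simpa using hβ
    simp only [MonoidWithZeroHom.coe_mk, ZeroHom.coe_mk, if_neg h1, if_neg h2,
      Ideal.absNorm_span_singleton]
    congr 1
    have h3 := norm_congr M α β (Ideal.mem_span_singleton.1 hD)
    have h4 := norm_pos_of_signs hα hβ hs
    rcases pos_and_pos_or_neg_and_neg_of_mul_pos h4 with ⟨ha, hb⟩ | ⟨ha, hb⟩
    · have e : ∀ x : ℤ, 0 < x → ((x.natAbs : ℕ) : ZMod M) = (x : ZMod M) := by
        intro x hx
        conv_rhs => rw [← Int.natAbs_of_nonneg hx.le]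
        simp
      rw [e _ ha, e _ hb, h3]
    · have e : ∀ x : ℤ, x < 0 → ((x.natAbs : ℕ) : ZMod M) = -(x : ZMod M) := by
        intro x hx
        have : x = -(x.natAbs : ℤ) := by omega
        conv_rhs => rw [this]
        simp
      rw [e _ ha, e _ hb, h3]

theorem normChar_apply {M : ℕ} (hM : M ≠ 0) (ψ : DirichletCharacter ℂ M) {I : Ideal (𝓞 K)}
    (hI : I ≠ 0) : (normChar K hM ψ).χ I = ψ ((Ideal.absNorm I : ℕ) : ZMod M) := by
  simp only [normChar, MonoidWithZeroHom.coe_mk, ZeroHom.coe_mk, if_neg hI]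

/-- congruence condition on the norm -/
def NCong (M : ℕ) (P : PS K) : Prop := ((Ideal.absNorm P.asIdeal : ℕ) : ZMod M) = 1

theorem span_nat_ne_zero {M : ℕ} (hM : M ≠ 0) : Ideal.span {(M : 𝓞 K)} ≠ 0 := by
  simpa using hM

theorem re_bound {D : Ideal (𝓞 K)} (X : DChar D) (I : Ideal (𝓞 K)) : |(X.χ I).re| ≤ 1 :=
  (Complex.abs_re_le_norm _).trans (X.norm_le_one I)

theorem upper_half (hdeg : 1 < Module.finrank ℚ K) (hreal : Nonempty (K →+* ℝ)) {M : ℕ}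
    (hM : 2 < M) :
    ∃ ψ : DirichletCharacter ℂ M, ψ (-1) = -1 ∧ ∃ y : 𝓞 K, y ≠ 0 ∧ (M : 𝓞 K) ∣ y - 1 ∧
      Algebra.norm ℤ y < 0 ∧ (normChar K (by omega) ψ).χ (Ideal.span {y}) = -1 := by
  have : NeZero M := ⟨by omega⟩
  have : Fact (2 < M) := ⟨hM⟩
  obtain ⟨ψ, hψ⟩ := DirichletCharacter.exists_apply_ne_one_of_hasEnoughRootsOfUnity (n := M) ℂ
    (ZMod.neg_one_ne_one)
  have hψ1 : ψ (-1) = -1 := by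
    have : ψ (-1) * ψ (-1) = 1 := by rw [← map_mul]; simp
    rcases mul_self_eq_one_iff.1 this with h | h
    · exact absurd h hψ
    · exact h
  refine ⟨ψ, hψ1, ?_⟩
  obtain ⟨y, hy, hy2⟩ := exists_neg_norm hdeg hreal M (by omega)
  have hy0 : y ≠ 0 := by
    rintro rfl
    rw [Algebra.norm_zero] at hy2
    exact lt_irrefl _ hy2
  refine ⟨y, hy0, hy, hy2, ?_⟩
  rw [normChar_apply _ _ (by simpa using hy0), Ideal.absNorm_span_singleton]
  have h3 := norm_congr M y 1 hy
  rw [map_one] at h3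
  have : ((Algebra.norm ℤ y).natAbs : ZMod M) = -1 := by
    have e : Algebra.norm ℤ y = -((Algebra.norm ℤ y).natAbs : ℤ) := by omega
    rw [e] at h3
    push_cast at h3
    rw [← h3]
    simp
  rw [this, hψ1]

theorem upper_bound_half (hdeg : 1 < Module.finrank ℚ K) (hreal : Nonempty (K →+* ℝ)) {M : ℕ}
    (hM : 2 < M) :
    ∃ C : ℝ, ∀ᶠ s in 𝓝[>] (1:ℝ), PSum (fun P : PS K => ind (NCong M P)) s ≤ lam s / 2 + C := by
  obtain ⟨ψ, hψ, y, hy0, hy, hyn, hy1⟩ := upper_half hdeg hreal hM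
  have hM0 : M ≠ 0 := by omega
  obtain ⟨C1, h1⟩ := PSum_char (span_nat_ne_zero hM0) (normChar K hM0 ψ) (Ideal.span {y})
    (by simpa using hy0) (by
      rw [isCoprime_span_iff_of_sub_mem (β := 1) (Ideal.mem_span_singleton.2 hy)]
      rw [Ideal.isCoprime_iff_sup_eq]; simp) (by
      rw [hy1]; norm_num)
  obtain ⟨C2, h2⟩ := PSum_one (K := K)
  set f : PS K → ℝ := fun P => ((normChar K hM0 ψ).χ P.asIdeal).re
  have hf : ∀ P, |f P| ≤ 1 := fun P => re_bound _ _
  obtain ⟨C3, h3⟩ := PSum_le (K := K) (f := fun P => ind (NCong M P))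
    (g := fun P => (1/2) * (1 + f P)) (F := ∅) (B := 1) (B' := 1) (fun P => ind_abs _) (fun P => by
      have := abs_le.1 (hf P)
      rw [abs_le]; constructor <;> linarith) Set.finite_empty (by
      intro P _
      by_cases h : NCong M P
      · have : f P = 1 := by
          simp only [f]
          rw [normChar_apply _ _ P.ne_bot, h, map_one, Complex.one_re]
        rw [ind_true h, this]; norm_num
      · rw [ind_false h]
        linarith [(abs_le.1 (hf P)).1])
  refine ⟨C1/2 + C2/2 + C3, ?_⟩
  filter_upwards [h1, h2, self_mem_nhdsWithin] with s h1 h2 hs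
  have hs : (1:ℝ) < s := hs
  have h3 := h3 s hs
  rw [PSum_smul (1/2), PSum_add (f := fun _ => 1) (B := 1) (fun _ => by simp) hf hs] at h3
  have h2 := (abs_le.1 h2).2
  linarith

theorem upper_bound_third {M : ℕ} (hM0 : M ≠ 0) (c : ℕ) (hc0 : c ≠ 0) (hc : c.Coprime M)
    (hc1 : ((c ^ (2 * Module.finrank ℚ K) : ℕ) : ZMod M) ≠ 1) :
    ∃ C : ℝ, ∀ᶠ s in 𝓝[>] (1:ℝ), PSum (fun P : PS K => ind (NCong M P)) s ≤ lam s / 3 + C := by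
  have : NeZero M := ⟨hM0⟩
  obtain ⟨ψ, hψ⟩ := DirichletCharacter.exists_apply_ne_one_of_hasEnoughRootsOfUnity (n := M) ℂ hc1
  have hcop : IsCoprime (Ideal.span {(c : 𝓞 K)}) (Ideal.span {(M : 𝓞 K)}) := by
    rw [Ideal.isCoprime_span_singleton_iff]
    have := Nat.isCoprime_iff_coprime.2 hc
    obtain ⟨a, b, hab⟩ := this
    exact ⟨a, b, by exact_mod_cast congrArg (Int.cast : ℤ → 𝓞 K) hab⟩
  have hcne : Ideal.span {(c : 𝓞 K)} ≠ 0 := by simpa using hc0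
  have hN : Ideal.absNorm (Ideal.span {(c : 𝓞 K)}) = c ^ Module.finrank ℚ K := by
    exact absNorm_nat c
  have hN2 : Ideal.absNorm (Ideal.span {(c : 𝓞 K)}) ^ 2 = c ^ (2 * Module.finrank ℚ K) := by
    rw [hN, ← pow_mul, mul_comm]
  rw [← hN2] at hψ
  push_cast at hψ
  rw [map_pow] at hψ
  obtain ⟨C1, h1⟩ := PSum_char (span_nat_ne_zero hM0) (normChar K hM0 ψ) _ hcne hcop (by
      rw [normChar_apply _ _ hcne]
      intro h
      rw [h] at hψ
      simp at hψ)
  obtain ⟨C4, h4⟩ := PSum_char (span_nat_ne_zero hM0) (normChar K hM0 (ψ ^ 2)) _ hcne hcop (by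
      rw [normChar_apply _ _ hcne, MulChar.pow_apply' _ (by norm_num)]
      exact hψ)
  obtain ⟨C2, h2⟩ := PSum_one (K := K)
  set f : PS K → ℝ := fun P => ((normChar K hM0 ψ).χ P.asIdeal).re with hfdef
  set f2 : PS K → ℝ := fun P => ((normChar K hM0 (ψ ^ 2)).χ P.asIdeal).re with hf2def
  have hf : ∀ P, |f P| ≤ 1 := fun P => re_bound _ _
  have hf2 : ∀ P, |f2 P| ≤ 1 := fun P => re_bound _ _
  have hff : ∀ P, 0 ≤ 3 + (4 * f P + 2 * f2 P) := by
    intro P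
    have e : (normChar K hM0 (ψ ^ 2)).χ P.asIdeal = ((normChar K hM0 ψ).χ P.asIdeal) ^ 2 := by
      rw [normChar_apply _ _ P.ne_bot, normChar_apply _ _ P.ne_bot,
        MulChar.pow_apply' _ (by norm_num)]
    have hn := (normChar K hM0 ψ).norm_le_one P.asIdeal
    simp only [hfdef, hf2def, e]
    set z := (normChar K hM0 ψ).χ P.asIdeal
    have h5 : z.re ^ 2 + z.im ^ 2 ≤ 1 := by
      have := Complex.sq_norm z
      rw [Complex.normSq_apply] at this
      nlinarith [norm_nonneg z]
    have h6 : (z ^ 2).re = z.re ^ 2 - z.im ^ 2 := by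
      rw [pow_two, Complex.mul_re]; ring
    rw [h6]
    nlinarith [sq_nonneg (1 + 2 * z.re)]
  obtain ⟨C3, h3⟩ := PSum_le (K := K) (f := fun P => ind (NCong M P))
    (g := fun P => (1/9) * (3 + (4 * f P + 2 * f2 P))) (F := ∅) (B := 1) (B' := 1)
    (fun P => ind_abs _) (fun P => by
      have := abs_le.1 (hf P)
      have := abs_le.1 (hf2 P)
      rw [abs_le]; constructor <;> linarith) Set.finite_empty (by
      intro P _
      by_cases h : NCong M P
      · have e1 : f P = 1 := by
          simp only [f]
          rw [normChar_apply _ _ P.ne_bot, h, map_one, Complex.one_re]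
        have e2 : f2 P = 1 := by
          simp only [f2]
          rw [normChar_apply _ _ P.ne_bot, h, map_one, Complex.one_re]
        rw [ind_true h, e1, e2]; norm_num
      · rw [ind_false h]
        linarith [hff P])
  refine ⟨4*C1/9 + C2/3 + C3 + 2*C4/9, ?_⟩
  filter_upwards [h1, h2, h4, self_mem_nhdsWithin] with s h1 h2 h4 hs
  have hs : (1:ℝ) < s := hs
  have h3 := h3 s hs
  have b4 : ∀ P, |4 * f P| ≤ 4 := fun P => by rw [abs_mul]; norm_num; linarith [hf P]
  have b2 : ∀ P, |2 * f2 P| ≤ 2 := fun P => by rw [abs_mul]; norm_num; linarith [hf2 P]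
  have b6 : ∀ P, |4 * f P + 2 * f2 P| ≤ 6 := fun P => by
    refine (abs_add_le _ _).trans ?_
    linarith [b4 P, b2 P]
  rw [PSum_smul (1/9), PSum_add (f := fun _ => 3) (B := 3) (fun _ => by norm_num) b6 hs,
    PSum_add b4 b2 hs, PSum_smul 4, PSum_smul 2] at h3
  have e3 : PSum (fun _ : PS K => (3:ℝ)) s = 3 * PSum (fun _ : PS K => (1:ℝ)) s := by
    rw [← PSum_smul]; simp
  rw [e3] at h3
  have h2 := (abs_le.1 h2).2
  linarith

end normchar
end VL

namespace VL
open NumberField InfinitePlace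

section key
variable {K : Type*} [Field K] [NumberField K]
open Filter Topology

theorem coprime_unit_pow {D : Ideal (𝓞 K)} (hD : D ≠ 0) :
    ∃ k : ℕ, 0 < k ∧ ∀ γ : 𝓞 K, IsCoprime (Ideal.span {γ}) D → γ ^ k - 1 ∈ D := by
  have hfin : Finite (𝓞 K ⧸ D) := Ideal.finiteQuotientOfFreeOfNeBot D hD
  refine ⟨Nat.card (𝓞 K ⧸ D)ˣ, Nat.card_pos, fun γ hγ => ?_⟩
  obtain ⟨i, hi, j, hj, hij⟩ := Ideal.isCoprime_iff_exists.1 hγ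
  obtain ⟨c, rfl⟩ := Ideal.mem_span_singleton'.1 hi
  have h1 : Ideal.Quotient.mk D c * Ideal.Quotient.mk D γ = 1 := by
    rw [← map_mul, ← map_one (Ideal.Quotient.mk D), ← hij, map_add,
      Ideal.Quotient.eq_zero_iff_mem.2 hj, add_zero]
  let u : (𝓞 K ⧸ D)ˣ := ⟨Ideal.Quotient.mk D γ, Ideal.Quotient.mk D c, by rw [mul_comm, h1], h1⟩
  have h2 : u ^ Nat.card (𝓞 K ⧸ D)ˣ = 1 := pow_card_eq_one'
  rw [← Ideal.Quotient.eq_zero_iff_mem, map_sub, map_pow, map_one, sub_eq_zero]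
  have h3 := congrArg Units.val h2
  rw [Units.val_pow_eq_pow_val] at h3
  exact h3

theorem ideal_pow {D I : Ideal (𝓞 K)} (hD : D ≠ 0) (hI : I ≠ 0) (h : IsCoprime I D) :
    ∃ k : ℕ, 0 < k ∧ ∃ δ : 𝓞 K, δ ≠ 0 ∧ δ - 1 ∈ D ∧ I ^ k = Ideal.span {δ} := by
  obtain ⟨k, hk, hk1⟩ := coprime_unit_pow hD
  have h1 : (I ^ Nat.card (ClassGroup (𝓞 K))).IsPrincipal := by
    have hI' := mem_nonZeroDivisors_iff_ne_zero.2 hI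
    rw [← ClassGroup.mk0_eq_one_iff (mem_nonZeroDivisors_iff_ne_zero.2 (pow_ne_zero _ hI))]
    have : ClassGroup.mk0 ⟨I, hI'⟩ ^ Nat.card (ClassGroup (𝓞 K)) = 1 := pow_card_eq_one'
    rw [← map_pow] at this
    exact this
  obtain ⟨γ, hγ⟩ := h1.principal
  change _ = Ideal.span {γ} at hγ
  refine ⟨Nat.card (ClassGroup (𝓞 K)) * k, Nat.mul_pos Nat.card_pos hk, γ ^ k, ?_, ?_, ?_⟩
  · apply pow_ne_zero
    rintro rfl
    have := pow_ne_zero (Nat.card (ClassGroup (𝓞 K))) hI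
    rw [hγ] at this
    simp at this
  · apply hk1
    rw [← hγ]
    exact h.pow_left
  · rw [pow_mul, hγ, Ideal.span_singleton_pow]

/-- ideals coprime to the modulus -/
def Mon (D : Ideal (𝓞 K)) : Submonoid (Ideal (𝓞 K)) where
  carrier := {I | I ≠ 0 ∧ IsCoprime I D}
  one_mem' := ⟨one_ne_zero, isCoprime_one_left⟩
  mul_mem' h h' := ⟨mul_ne_zero h.1 h'.1, h.2.mul_left h'.2⟩

/-- ideals with all prime factors good -/
def Gd (D : Ideal (𝓞 K)) (Good : PS K → Prop) : Submonoid (Ideal (𝓞 K)) where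
  carrier := {I | I ≠ 0 ∧ IsCoprime I D ∧ ∀ P : PS K, P.asIdeal ∣ I → Good P}
  one_mem' := ⟨one_ne_zero, isCoprime_one_left, fun P hP =>
    absurd (Ideal.isUnit_iff.1 (isUnit_of_dvd_one hP)) P.isPrime.ne_top⟩
  mul_mem' h h' := ⟨mul_ne_zero h.1 h'.1, h.2.1.mul_left h'.2.1, fun P hP => by
    rcases (Ideal.prime_of_isPrime P.ne_bot P.isPrime).dvd_or_dvd hP with h1 | h1
    · exact h.2.2 P h1
    · exact h'.2.2 P h1⟩

/-- equivalence of ideals -/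
def Rel (D : Ideal (𝓞 K)) (Good : PS K → Prop) (I J : Ideal (𝓞 K)) : Prop :=
  ∃ α β : 𝓞 K, α ≠ 0 ∧ β ≠ 0 ∧ α - β ∈ D ∧ IsCoprime (Ideal.span {α}) D ∧
    IsCoprime (Ideal.span {β}) D ∧ ∃ A ∈ Gd D Good, ∃ C ∈ Gd D Good,
      Ideal.span {α} * A * I = Ideal.span {β} * C * J

theorem Rel.refl (D : Ideal (𝓞 K)) (Good : PS K → Prop) (I : Ideal (𝓞 K)) : Rel D Good I I :=
  ⟨1, 1, one_ne_zero, one_ne_zero, by simp, by simp [Ideal.isCoprime_iff_sup_eq],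
    by simp [Ideal.isCoprime_iff_sup_eq], 1, one_mem _, 1, one_mem _, rfl⟩

theorem Rel.symm {D : Ideal (𝓞 K)} {Good : PS K → Prop} {I J : Ideal (𝓞 K)}
    (h : Rel D Good I J) : Rel D Good J I := by
  obtain ⟨α, β, h1, h2, h3, h4, h5, A, hA, C, hC, h⟩ := h
  exact ⟨β, α, h2, h1, by rw [← neg_sub]; exact D.neg_mem h3, h5, h4, C, hC, A, hA, h.symm⟩

theorem sub_mul_mem {D : Ideal (𝓞 K)} {a b a' b' : 𝓞 K} (h : a - b ∈ D) (h' : a' - b' ∈ D) :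
    a * a' - b * b' ∈ D := by
  have : a * a' - b * b' = a' * (a - b) + b * (a' - b') := by ring
  rw [this]
  exact D.add_mem (D.mul_mem_left _ h) (D.mul_mem_left _ h')

theorem cop_mul {D : Ideal (𝓞 K)} {a b : 𝓞 K} (h : IsCoprime (Ideal.span {a}) D)
    (h' : IsCoprime (Ideal.span {b}) D) : IsCoprime (Ideal.span {a * b}) D := by
  rw [← Ideal.span_singleton_mul_span_singleton]; exact h.mul_left h'

theorem Rel.mul {D : Ideal (𝓞 K)} {Good : PS K → Prop} {I J I' J' : Ideal (𝓞 K)}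
    (h : Rel D Good I J) (h' : Rel D Good I' J') : Rel D Good (I * I') (J * J') := by
  obtain ⟨α, β, h1, h2, h3, h4, h5, A, hA, C, hC, h⟩ := h
  obtain ⟨α', β', h1', h2', h3', h4', h5', A', hA', C', hC', h'⟩ := h'
  refine ⟨α * α', β * β', mul_ne_zero h1 h1', mul_ne_zero h2 h2', sub_mul_mem h3 h3',
    cop_mul h4 h4', cop_mul h5 h5', A * A', mul_mem hA hA', C * C', mul_mem hC hC', ?_⟩
  rw [← Ideal.span_singleton_mul_span_singleton, ← Ideal.span_singleton_mul_span_singleton]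
  calc _ = (Ideal.span {α} * A * I) * (Ideal.span {α'} * A' * I') := by ring
    _ = _ := by rw [h, h']; ring

theorem Rel.trans {D : Ideal (𝓞 K)} {Good : PS K → Prop} {I J L : Ideal (𝓞 K)} (hJ : J ≠ 0)
    (h : Rel D Good I J) (h' : Rel D Good J L) : Rel D Good I L := by
  obtain ⟨α, β, h1, h2, h3, h4, h5, A, hA, C, hC, h⟩ := h.mul h'
  refine ⟨α, β, h1, h2, h3, h4, h5, A, hA, C, hC, mul_right_cancel₀ hJ ?_⟩
  calc _ = Ideal.span {α} * A * (I * J) := by ring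
    _ = _ := by rw [h]; ring

/-- the congruence -/
def RCon (D : Ideal (𝓞 K)) (Good : PS K → Prop) : Con (Mon D) where
  r I J := Rel D Good I J
  iseqv := ⟨fun _ => Rel.refl _ _ _, fun h => h.symm, fun {_ J _} h h' => h.trans J.2.1 h'⟩
  mul' h h' := h.mul h'

theorem Rel.span {D : Ideal (𝓞 K)} {Good : PS K → Prop} {α β : 𝓞 K} (hα : α ≠ 0) (hβ : β ≠ 0)
    (h : α - β ∈ D) (hc : IsCoprime (Ideal.span {α}) D) :
    Rel D Good (Ideal.span {α}) (Ideal.span {β}) :=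
  ⟨β, α, hβ, hα, by rw [← neg_sub]; exact D.neg_mem h, (isCoprime_span_iff_of_sub_mem h).1 hc, hc,
    1, one_mem _, 1, one_mem _, by ring⟩

theorem exists_circle {G : Type*} [CommGroup G] {g : G} (hg : g ≠ 1) :
    ∃ c : G →* Circle, c g ≠ 1 := by
  obtain ⟨c, hc⟩ := CharacterModule.exists_character_apply_ne_zero_of_ne_zero
    (A := Additive G) (a := Additive.ofMul g) (by simpa using hg)
  let ι : AddCircle (1:ℚ) →+ AddCircle (1:ℝ) :=
    QuotientAddGroup.map _ _ (Rat.castHom ℝ).toAddMonoidHom (by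
      rintro x hx
      obtain ⟨n, rfl⟩ := AddSubgroup.mem_zmultiples_iff.1 hx
      refine AddSubgroup.mem_zmultiples_iff.2 ⟨n, ?_⟩
      simp)
  have hι : ∀ x, ι x = 0 → x = 0 := by
    intro x hx
    induction x using QuotientAddGroup.induction_on with
    | H x =>
      have : ((x : ℝ) : AddCircle (1:ℝ)) = 0 := hx
      obtain ⟨n, hn⟩ := (AddCircle.coe_eq_zero_iff (p := (1:ℝ))).1 this
      refine (AddCircle.coe_eq_zero_iff (p := (1:ℚ))).2 ⟨n, ?_⟩
      simp at hn ⊢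
      exact_mod_cast hn
  refine ⟨{ toFun := fun x => AddCircle.toCircle (ι (c (Additive.ofMul x)))
            map_one' := by simp
            map_mul' := fun x y => by
              rw [ofMul_mul, map_add, map_add, AddCircle.toCircle_add] }, ?_⟩
  intro h
  apply hc
  apply hι
  apply AddCircle.injective_toCircle one_ne_zero
  rw [AddCircle.toCircle_zero]
  exact h

theorem isCoprime_mul_iff' {D I J : Ideal (𝓞 K)} :
    IsCoprime (I * J) D ↔ IsCoprime I D ∧ IsCoprime J D :=
  IsCoprime.mul_left_iff

theorem key_lemma {D : Ideal (𝓞 K)} (hD : D ≠ 0) {b : 𝓞 K} (hb : IsCoprime (Ideal.span {b}) D)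
    (Good : PS K → Prop)
    (hno : ¬ ∃ b' : 𝓞 K, b' ≠ 0 ∧ b' - b ∈ D ∧ ∀ P : PS K, P.asIdeal ∣ Ideal.span {b'} → Good P) :
    b ≠ 0 ∧ ∃ X : DChar D, (∀ P : PS K, Good P → IsCoprime P.asIdeal D → X.χ P.asIdeal = 1) ∧
      (∀ α β : 𝓞 K, α ≠ 0 → β ≠ 0 → α - β ∈ D → IsCoprime (Ideal.span {α}) D →
        X.χ (Ideal.span {α}) = X.χ (Ideal.span {β})) ∧ X.χ (Ideal.span {b}) ≠ 1 := by
  classical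
  have hb0 : b ≠ 0 := by
    rintro rfl
    apply hno
    have hDt : D = ⊤ := by
      rw [Ideal.isCoprime_iff_sup_eq] at hb
      simpa using hb
    refine ⟨1, one_ne_zero, by rw [hDt]; trivial, fun P hP => ?_⟩
    rw [Ideal.span_singleton_one, ← Ideal.one_eq_top] at hP
    exact absurd (Ideal.isUnit_iff.1 (isUnit_of_dvd_one hP)) P.isPrime.ne_top
  refine ⟨hb0, ?_⟩
  -- the group
  have hinv : ∀ x : (RCon D Good).Quotient, IsUnit x := by
    intro x
    induction x using Con.induction_on with
    | H I =>
      obtain ⟨k, hk, δ, hδ0, hδ1, hδ⟩ := ideal_pow hD I.2.1 I.2.2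
      have h1 : (((I ^ k : Mon D)) : (RCon D Good).Quotient) = ((1 : Mon D) : (RCon D Good).Quotient) := by
        rw [Con.eq]
        change Rel D Good ((I ^ k : Mon D) : Ideal (𝓞 K)) ((1 : Mon D) : Ideal (𝓞 K))
        rw [SubmonoidClass.coe_pow, hδ, Submonoid.coe_one, Ideal.one_eq_top,
          ← Ideal.span_singleton_one]
        refine Rel.span hδ0 one_ne_zero hδ1 ?_
        rw [← hδ]
        exact I.2.2.pow_left
      have h2 : ((I : (RCon D Good).Quotient)) ^ k = 1 := by
        rw [← Con.coe_one, ← h1]; rfl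
      exact IsUnit.of_pow_eq_one h2 hk.ne'
  let _ : CommGroup (RCon D Good).Quotient := commGroupOfIsUnit hinv
  let bM : Mon D := ⟨Ideal.span {b}, by simpa using hb0, hb⟩
  have hne : (bM : (RCon D Good).Quotient) ≠ 1 := by
    intro h
    rw [← Con.coe_one, Con.eq] at h
    change Rel D Good (Ideal.span {b}) 1 at h
    apply hno
    obtain ⟨α, β, h1, h2, h3, h4, h5, A, hA, C, hC, h⟩ := h
    obtain ⟨k, hk, γ, hγ0, hγ1, hγ⟩ := ideal_pow hD hA.1 hA.2.1
    have h6 : Ideal.span {α * γ * b} = Ideal.span {β} * (C * A ^ (k - 1)) := by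
      rw [← Ideal.span_singleton_mul_span_singleton, ← Ideal.span_singleton_mul_span_singleton, ← hγ]
      have : A ^ k = A * A ^ (k - 1) := by rw [← pow_succ', Nat.sub_add_cancel hk]
      calc _ = (Ideal.span {α} * A * Ideal.span {b}) * A ^ (k - 1) := by rw [this]; ring
        _ = _ := by rw [h]; ring
    have h7 : β ∣ α * γ * b := by
      rw [← Ideal.span_singleton_le_span_singleton, h6]
      exact Ideal.mul_le_left
    obtain ⟨b', hb'⟩ := h7
    have h8 : Ideal.span {b'} = C * A ^ (k - 1) := by
      rw [hb', ← Ideal.span_singleton_mul_span_singleton] at h6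
      exact mul_left_cancel₀ (by simpa using h2) h6
    have h9 : C * A ^ (k - 1) ∈ Gd D Good := mul_mem hC (pow_mem hA _)
    refine ⟨b', ?_, ?_, fun P hP => ?_⟩
    · rintro rfl
      rw [mul_zero] at hb'
      exact mul_ne_zero (mul_ne_zero h1 hγ0) hb0 hb'
    · have e : β * (b' - b) ∈ D := by
        rw [mul_sub, ← hb']
        have := sub_mul_mem (sub_mul_mem h3 hγ1) (show b - b ∈ D by simp)
        rwa [mul_one] at this
      obtain ⟨i, hi, j, hj, hij⟩ := Ideal.isCoprime_iff_exists.1 h5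
      obtain ⟨c, rfl⟩ := Ideal.mem_span_singleton'.1 hi
      have : b' - b = c * (β * (b' - b)) + (b' - b) * j := by
        linear_combination -(b' - b) * hij
      rw [this]
      exact D.add_mem (D.mul_mem_left _ e) (D.mul_mem_left _ hj)
    · rw [h8] at hP
      exact h9.2.2 P hP
  obtain ⟨c, hc⟩ := exists_circle hne
  let F : Ideal (𝓞 K) → ℂ := fun I => if h : I ∈ Mon D then
    (c ((⟨I, h⟩ : Mon D) : (RCon D Good).Quotient) : ℂ) else 0
  have hF : ∀ I (h : I ∈ Mon D), F I = (c ((⟨I, h⟩ : Mon D) : (RCon D Good).Quotient) : ℂ) :=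
    fun I h => by simp only [F, dif_pos h]
  have hFn : ∀ I, I ∉ Mon D → F I = 0 := fun I h => by simp only [F, dif_neg h]
  have hrel : ∀ I J (hI : I ∈ Mon D) (hJ : J ∈ Mon D), Rel D Good I J → F I = F J := by
    intro I J hI hJ h
    rw [hF I hI, hF J hJ]
    congr 2
    rw [Con.eq]
    exact h
  have hmul : ∀ I J, F (I * J) = F I * F J := by
    intro I J
    by_cases hI : I ∈ Mon D
    · by_cases hJ : J ∈ Mon D
      · rw [hF I hI, hF J hJ, hF (I * J) (mul_mem hI hJ)]
        have : ((⟨I * J, mul_mem hI hJ⟩ : Mon D) : (RCon D Good).Quotient) =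
          ((⟨I, hI⟩ : Mon D) : (RCon D Good).Quotient) * ((⟨J, hJ⟩ : Mon D) : (RCon D Good).Quotient) := by
          rw [← Con.coe_mul]; rfl
        rw [this, map_mul, Circle.coe_mul]
      · rw [hFn J hJ, mul_zero, hFn]
        rintro ⟨h1, h2⟩
        exact hJ ⟨right_ne_zero_of_mul h1, (isCoprime_mul_iff'.1 h2).2⟩
    · rw [hFn I hI, zero_mul, hFn]
      rintro ⟨h1, h2⟩
      exact hI ⟨left_ne_zero_of_mul h1, (isCoprime_mul_iff'.1 h2).1⟩
  have h1F : F 1 = 1 := by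
    rw [hF 1 (one_mem _)]
    have : ((⟨1, one_mem _⟩ : Mon D) : (RCon D Good).Quotient) = 1 := by
      rw [← Con.coe_one]; rfl
    rw [this, map_one, Circle.coe_one]
  have hper : ∀ α β : 𝓞 K, α ≠ 0 → β ≠ 0 → α - β ∈ D → IsCoprime (Ideal.span {α}) D →
      F (Ideal.span {α}) = F (Ideal.span {β}) := by
    intro α β hα hβ h hc
    exact hrel _ _ ⟨by simpa using hα, hc⟩
      ⟨by simpa using hβ, (isCoprime_span_iff_of_sub_mem h).1 hc⟩ (Rel.span hα hβ h hc)
  let X : DChar D :=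
    { χ := { toFun := F
             map_zero' := hFn 0 (fun h => h.1 rfl)
             map_one' := h1F
             map_mul' := hmul }
      norm_one := fun I hI h => by
        change ‖F I‖ = 1
        rw [hF I ⟨hI, h⟩, Circle.norm_coe]
      zero := fun I h => hFn I (fun h' => h h'.2)
      per := fun α β hα hβ h hc _ => hper α β hα hβ h hc }
  refine ⟨X, ?_, hper, ?_⟩
  · intro P hP hPD
    change F P.asIdeal = 1
    rw [← h1F]
    refine hrel _ _ ⟨P.ne_bot, hPD⟩ (one_mem _) ?_
    have hPG : P.asIdeal ∈ Gd D Good := by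
      refine ⟨P.ne_bot, hPD, fun Q hQ => ?_⟩
      have h1 : P.asIdeal ≤ Q.asIdeal := Ideal.dvd_iff_le.1 hQ
      have h2 := P.isMaximal.eq_of_le Q.isPrime.ne_top h1
      have : P = Q := IsDedekindDomain.HeightOneSpectrum.ext h2
      rwa [← this]
    refine ⟨1, 1, one_ne_zero, one_ne_zero, by simp, by simp [Ideal.isCoprime_iff_sup_eq],
      by simp [Ideal.isCoprime_iff_sup_eq], 1, one_mem _, _, hPG, ?_⟩
    ring
  · change F (Ideal.span {b}) ≠ 1
    rw [hF _ bM.2]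
    intro h
    exact hc (Circle.ext (by rw [Circle.coe_one]; exact h))

end key
end VL

namespace VL
open NumberField InfinitePlace

section star1
variable {K : Type*} [Field K] [NumberField K]
open Filter Topology

theorem lam_contra {a C : ℝ} (ha : 0 < a) (h : ∀ᶠ s in 𝓝[>] (1:ℝ), a * lam s ≤ C) : False := by
  have h1 := lam_tendsto.eventually_gt_atTop (C / a)
  obtain ⟨s, hs, hs'⟩ := (h.and h1).exists
  rw [div_lt_iff₀ ha] at hs'
  linarith

theorem isCoprime_prime {P : PS K} {D : Ideal (𝓞 K)} : IsCoprime P.asIdeal D ↔ ¬ P.asIdeal ∣ D := by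
  rw [Ideal.isCoprime_iff_sup_eq]
  constructor
  · intro h h2
    rw [sup_eq_left.2 (Ideal.dvd_iff_le.1 h2)] at h
    exact P.isPrime.ne_top h
  · intro h
    by_contra hc
    apply h
    have := P.isMaximal.eq_of_le hc le_sup_left
    rw [Ideal.dvd_iff_le]
    exact sup_eq_left.1 this.symm

theorem good_exists {D : Ideal (𝓞 K)} (hD : D ≠ 0) {b : 𝓞 K} (hb : IsCoprime (Ideal.span {b}) D)
    (Good Bad : PS K → Prop) {F : Set (PS K)} (hF : F.Finite) (hGB : ∀ P, P ∉ F → Good P ∨ Bad P)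
    {a C : ℝ} (ha : a < 1 / 2)
    (hB : ∀ᶠ s in 𝓝[>] (1:ℝ), PSum (fun P => ind (Bad P)) s ≤ a * lam s + C) :
    ∃ b' : 𝓞 K, b' ≠ 0 ∧ b' - b ∈ D ∧ ∀ P : PS K, P.asIdeal ∣ Ideal.span {b'} → Good P := by
  by_contra hno
  obtain ⟨hb0, X, hX1, -, hX2⟩ := key_lemma hD hb Good hno
  obtain ⟨C1, h1⟩ := PSum_char hD X _ (by simpa using hb0) hb hX2
  obtain ⟨C2, h2⟩ := PSum_one (K := K)
  have hbd : ∀ P : PS K, |2 * ind (Bad P)| ≤ 2 := fun P => by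
    rw [abs_mul]; norm_num; exact ind_abs _
  have hbd2 : ∀ P : PS K, |(X.χ P.asIdeal).re| ≤ 1 := fun P => re_bound _ _
  obtain ⟨C3, h3⟩ := PSum_le (K := K) (f := fun _ => 1) (B := 1)
    (g := fun P => (X.χ P.asIdeal).re + 2 * ind (Bad P)) (B' := 3)
    (F := F ∪ {P | P.asIdeal ∣ D}) (fun _ => by simp) (fun P => by
      refine (abs_add_le _ _).trans ?_
      linarith [hbd P, hbd2 P]) (hF.union (Ideal.finite_factors hD)) (by
      intro P hP
      simp only [Set.mem_union, Set.mem_ofPred_eq, not_or] at hP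
      rcases hGB P hP.1 with h | h
      · rw [hX1 P h (isCoprime_prime.2 hP.2), Complex.one_re]
        linarith [ind_nonneg (Bad P)]
      · rw [ind_true h]
        linarith [(abs_le.1 (hbd2 P)).1])
  refine lam_contra (a := 1 - 2 * a) (C := C1 + C2 + C3 + 2 * C) (by linarith) ?_
  filter_upwards [h1, h2, hB, self_mem_nhdsWithin] with s h1 h2 hB hs
  have hs : (1:ℝ) < s := hs
  have h3 := h3 s hs
  rw [PSum_add hbd2 hbd hs, PSum_smul 2] at h3
  have h2 := (abs_le.1 h2).1
  linarith

theorem pow_dvd_lcm {l j a b : ℕ} (hl : l.Prime) (ha : a ≠ 0) (hb : b ≠ 0)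
    (h : l ^ j ∣ Nat.lcm a b) : l ^ j ∣ a ∨ l ^ j ∣ b := by
  rw [hl.pow_dvd_iff_le_factorization (Nat.lcm_ne_zero ha hb), Nat.factorization_lcm ha hb,
    Finsupp.sup_apply, le_sup_iff] at h
  rwa [hl.pow_dvd_iff_le_factorization ha, hl.pow_dvd_iff_le_factorization hb]

theorem one_add_pow_mem {I P : Ideal (𝓞 K)} {y : 𝓞 K} {N : ℕ} (hy : y ∈ I) (hIP : I ≤ P)
    (hN : (N : 𝓞 K) ∈ P) : (1 + y) ^ N - 1 ∈ P * I := by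
  have h : ∀ m : ℕ, (1 + y) ^ m - 1 - m * y ∈ P * I := by
    intro m
    induction m with
    | zero => simp
    | succ m ih =>
      have : (1 + y) ^ (m + 1) - 1 - ((m + 1 : ℕ) : 𝓞 K) * y =
        ((1 + y) ^ m - 1 - m * y) * (1 + y) + m * (y * y) := by push_cast; ring
      rw [this]
      exact Ideal.add_mem _ (Ideal.mul_mem_right _ _ ih)
        (Ideal.mul_mem_left _ _ (Ideal.mul_mem_mul (hIP hy) hy))
  have h2 := h N
  have : (1 + y) ^ N - 1 = ((1 + y) ^ N - 1 - N * y) + N * y := by ring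
  rw [this]
  exact Ideal.add_mem _ h2 (Ideal.mul_mem_mul hN hy)

theorem pow_sub_one_mem {I : Ideal (𝓞 K)} {x : 𝓞 K} {e : ℕ} (k : ℕ) (h : x ^ e - 1 ∈ I) :
    x ^ (e * k) - 1 ∈ I := by
  rw [pow_mul]
  have : x ^ e - 1 ∣ (x ^ e) ^ k - 1 := sub_one_dvd_pow_sub_one _ _
  exact I.mem_of_dvd this h

theorem absNorm_coprime {l : ℕ} {P : PS K} (h : (l : 𝓞 K) ∉ P.asIdeal) :
    (Ideal.absNorm P.asIdeal).Coprime l := by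
  rw [← coprime_iff_norm, isCoprime_prime, Ideal.dvd_iff_le, Ideal.span_singleton_le_iff_mem]
  exact h

theorem fermat (P : PS K) {x : 𝓞 K} (hx : x ∉ P.asIdeal) :
    x ^ (Ideal.absNorm P.asIdeal - 1) - 1 ∈ P.asIdeal := by
  have := P.isMaximal
  let _ := Ideal.Quotient.field P.asIdeal
  have hfin : Finite (𝓞 K ⧸ P.asIdeal) := Ideal.finiteQuotientOfFreeOfNeBot _ P.ne_bot
  have : Fintype (𝓞 K ⧸ P.asIdeal) := Fintype.ofFinite _
  rw [← Ideal.Quotient.eq_zero_iff_mem, map_sub, map_pow, map_one, sub_eq_zero,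
    Ideal.absNorm_apply, Submodule.cardQuot_apply, Nat.card_eq_fintype_card]
  apply FiniteField.pow_card_sub_one_eq_one
  rwa [Ne, Ideal.Quotient.eq_zero_iff_mem]

theorem NCong_iff {M : ℕ} {P : PS K} : NCong M P ↔ M ∣ Ideal.absNorm P.asIdeal - 1 := by
  unfold NCong
  have h : 2 ≤ NN P := two_le_NN P
  have h2 : 2 ≤ Ideal.absNorm P.asIdeal := by unfold NN at h; exact_mod_cast h
  rw [← ZMod.natCast_eq_zero_iff, Nat.cast_sub (by omega), sub_eq_zero, Nat.cast_one]

theorem exists_exponent {l j : ℕ} (hl : l.Prime) (hj : 0 < j) (I : Ideal (𝓞 K)) (hI : I ≠ 0)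
    (hG : ∀ P : PS K, P.asIdeal ∣ I → ¬ NCong (l ^ j) P ∧ (l : 𝓞 K) ∉ P.asIdeal) :
    ∃ e : ℕ, e ≠ 0 ∧ ¬ l ^ j ∣ e ∧ ∀ x : 𝓞 K, IsCoprime (Ideal.span {x}) I → x ^ e - 1 ∈ I := by
  induction I using UniqueFactorizationMonoid.induction_on_prime with
  | h₁ => exact absurd rfl hI
  | h₂ I hu =>
    refine ⟨1, one_ne_zero, ?_, fun x _ => ?_⟩
    · rw [Nat.dvd_one, Nat.pow_eq_one]
      rintro (h | h)
      · exact hl.one_lt.ne' h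
      · exact hj.ne' h
    · rw [Ideal.isUnit_iff.1 hu]; trivial
  | h₃ I Q hI0 hQ ih =>
    obtain ⟨e, he0, he1, he⟩ := ih hI0 (fun P hP => hG P (hP.mul_left _))
    let P : PS K := ⟨Q, Ideal.isPrime_of_prime hQ, hQ.ne_zero⟩
    obtain ⟨hP1, hP2⟩ := hG P (Dvd.intro _ rfl)
    have hN2 : 2 ≤ Ideal.absNorm P.asIdeal := by
      have h : 2 ≤ NN P := two_le_NN P
      unfold NN at h; exact_mod_cast h
    by_cases hQI : Q ∣ I
    · refine ⟨e * Ideal.absNorm P.asIdeal, mul_ne_zero he0 (by omega), ?_, fun x hx => ?_⟩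
      · intro h
        exact he1 ((Nat.Coprime.dvd_of_dvd_mul_right
          ((absNorm_coprime hP2).symm.pow_left j)) h)
      · have h1 := he x (IsCoprime.of_mul_right_right hx)
        have h2 := one_add_pow_mem (P := P.asIdeal) h1 (Ideal.dvd_iff_le.1 hQI)
          (Ideal.absNorm_mem P.asIdeal)
        rw [add_sub_cancel, ← pow_mul] at h2
        exact h2
    · have hcop : IsCoprime Q I := isCoprime_prime (P := P).2 hQI
      refine ⟨Nat.lcm e (Ideal.absNorm P.asIdeal - 1), Nat.lcm_ne_zero he0 (by omega), ?_,
        fun x hx => ?_⟩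
      · intro h
        rcases pow_dvd_lcm hl he0 (by omega) h with h | h
        · exact he1 h
        · exact hP1 (NCong_iff.2 h)
      · rw [Ideal.mul_eq_inf_of_isCoprime hcop]
        constructor
        · obtain ⟨k, hk⟩ := Nat.dvd_lcm_right e (Ideal.absNorm P.asIdeal - 1)
          rw [hk]
          apply pow_sub_one_mem
          apply fermat P
          intro hxP
          have h1 := IsCoprime.of_mul_right_left hx
          rw [Ideal.isCoprime_iff_sup_eq, sup_eq_right.2
            ((Ideal.span_singleton_le_iff_mem _).2 hxP)] at h1
          exact P.isPrime.ne_top h1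
        · obtain ⟨k, hk⟩ := Nat.dvd_lcm_left e (Ideal.absNorm P.asIdeal - 1)
          rw [hk]
          exact pow_sub_one_mem _ (he x (IsCoprime.of_mul_right_right hx))

theorem star1_aux {l j : ℕ} (hl : l.Prime) (hj : 0 < j)
    (hM : 3 ^ (2 * Module.finrank ℚ K) < l ^ j) {D : Ideal (𝓞 K)} (hD : D ≠ 0) {b : 𝓞 K}
    (hb : IsCoprime (Ideal.span {b}) D) :
    ∃ b' : 𝓞 K, b' ≠ 0 ∧ b' - b ∈ D ∧ ∃ e : ℕ, ¬ l ^ j ∣ e ∧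
      ∀ x : 𝓞 K, IsCoprime x b' → b' ∣ x ^ e - 1 := by
  have hub : ∃ C : ℝ, ∀ᶠ s in 𝓝[>] (1:ℝ),
      PSum (fun P : PS K => ind (NCong (l ^ j) P)) s ≤ lam s / 3 + C := by
    have hn : 0 < Module.finrank ℚ K := Module.finrank_pos
    have gen : ∀ c : ℕ, 2 ≤ c → c ≤ 3 → c.Coprime l → ∃ C : ℝ, ∀ᶠ s in 𝓝[>] (1:ℝ),
      PSum (fun P : PS K => ind (NCong (l ^ j) P)) s ≤ lam s / 3 + C := by
      intro c hc2 hc3 hc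
      refine upper_bound_third (pow_ne_zero _ hl.ne_zero) c (by omega) (hc.pow_right _) ?_
      intro h
      have h1 : c ^ (2 * Module.finrank ℚ K) ≤ 3 ^ (2 * Module.finrank ℚ K) :=
        Nat.pow_le_pow_left hc3 _
      have h2 : 1 < c ^ (2 * Module.finrank ℚ K) := Nat.one_lt_pow (by omega) (by omega)
      have h3 : ((c ^ (2 * Module.finrank ℚ K) : ℕ) : ZMod (l ^ j)) = ((1 : ℕ) : ZMod (l ^ j)) := by
        rw [h]; simp
      rw [ZMod.natCast_eq_natCast_iff'] at h3
      rw [Nat.mod_eq_of_lt (by omega), Nat.mod_eq_of_lt (by omega)] at h3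
      omega
    by_cases h2 : l = 2
    · exact gen 3 (by norm_num) le_rfl (by rw [h2]; norm_num)
    · exact gen 2 le_rfl (by norm_num) ((Nat.coprime_primes Nat.prime_two hl).2 (Ne.symm h2))
  obtain ⟨C, hC⟩ := hub
  have hl0 : Ideal.span {(l : 𝓞 K)} ≠ 0 := span_nat_ne_zero hl.ne_zero
  obtain ⟨b', hb0, hb1, hb2⟩ := good_exists hD hb
    (fun P => ¬ NCong (l ^ j) P ∧ (l : 𝓞 K) ∉ P.asIdeal) (fun P => NCong (l ^ j) P)
    (F := {P | P.asIdeal ∣ Ideal.span {(l : 𝓞 K)}}) (Ideal.finite_factors hl0) (by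
      intro P hP
      by_cases h : NCong (l ^ j) P
      · exact Or.inr h
      · left
        refine ⟨h, fun h' => hP ?_⟩
        exact Ideal.dvd_iff_le.2 ((Ideal.span_singleton_le_iff_mem _).2 h'))
    (a := 1/3) (C := C) (by norm_num) (by
      filter_upwards [hC] with s hs
      linarith)
  refine ⟨b', hb0, hb1, ?_⟩
  obtain ⟨e, -, he1, he⟩ := exists_exponent hl hj (Ideal.span {b'}) (by simpa using hb0) hb2
  refine ⟨e, he1, fun x hx => ?_⟩
  rw [← Ideal.mem_span_singleton]
  exact he x (Ideal.isCoprime_span_singleton_iff _ _ |>.2 hx)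

theorem star1 (K : Type*) [Field K] [NumberField K] : ∃ k : ℕ, 0 < k ∧
    ∀ (D : Ideal (𝓞 K)) (b : 𝓞 K), D ≠ 0 → IsCoprime (Ideal.span {b}) D →
    ∀ J : AddSubgroup ℤ, (∀ b' : 𝓞 K, b' ≠ 0 → b' - b ∈ D → ∀ e : ℕ,
      (∀ x : 𝓞 K, IsCoprime x b' → b' ∣ x ^ e - 1) → (e : ℤ) ∈ J) → (k : ℤ) ∈ J := by
  set B := 3 ^ (2 * Module.finrank ℚ K) with hB
  have hBpos : 0 < B := by positivity
  refine ⟨(B.factorial) ^ B, by positivity, fun D b hD hb J hJ => ?_⟩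
  obtain ⟨g, hg⟩ := Int.subgroup_cyclic J
  rw [← AddSubgroup.zmultiples_eq_closure, ← Int.zmultiples_natAbs] at hg
  set n := g.natAbs
  have hmem : ∀ e : ℕ, (e : ℤ) ∈ J ↔ n ∣ e := by
    intro e
    rw [hg, Int.mem_zmultiples_iff, Int.natCast_dvd_natCast]
  rw [hmem]
  have hnd : ∀ l j : ℕ, l.Prime → 0 < j → B < l ^ j → ¬ l ^ j ∣ n := by
    intro l j hl hj hM h
    obtain ⟨b', hb0, hb1, e, he1, he⟩ := star1_aux (K := K) hl hj hM hD hb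
    exact he1 (h.trans ((hmem e).1 (hJ b' hb0 hb1 e he)))
  have hn0 : n ≠ 0 := by
    intro h
    have := hnd 2 B Nat.prime_two hBpos Nat.lt_two_pow_self
    rw [h] at this
    exact this (dvd_zero _)
  rw [← Nat.factorization_prime_le_iff_dvd hn0 (by positivity)]
  intro p hp
  by_cases hpB : p ≤ B
  · have h1 : n.factorization p < B := by
      by_contra hc
      push Not at hc
      have h2 := (hp.pow_dvd_iff_le_factorization hn0).2 hc
      refine hnd p B hp hBpos ?_ h2
      exact lt_of_lt_of_le Nat.lt_two_pow_self (Nat.pow_le_pow_left hp.two_le _)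
    have h3 : 1 ≤ (B.factorial).factorization p := by
      rw [← hp.dvd_iff_one_le_factorization (Nat.factorial_ne_zero _)]
      exact hp.dvd_factorial.2 hpB
    rw [Nat.factorization_pow]
    simp only [Finsupp.smul_apply, smul_eq_mul]
    nlinarith
  · have h1 : ¬ p ∣ n := by
      have := hnd p 1 hp one_pos (by rw [pow_one]; omega)
      rwa [pow_one] at this
    rw [Nat.factorization_eq_zero_of_not_dvd h1]
    exact Nat.zero_le _

end star1
end VL

namespace VL
open NumberField InfinitePlace

section star2
variable {K : Type*} [Field K] [NumberField K]
open Filter Topology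

/-- `t` is an `l`-th power modulo `P`. -/
def PowMod (l : ℕ) (t : 𝓞 K) (P : PS K) : Prop := ∃ β : 𝓞 K, β ^ l - t ∈ P.asIdeal

theorem finite_mem {x : 𝓞 K} (hx : x ≠ 0) : {P : PS K | x ∈ P.asIdeal}.Finite := by
  refine (Ideal.finite_factors (I := Ideal.span {x}) (by simpa using hx)).subset ?_
  intro P hP
  exact Ideal.dvd_span_singleton.2 hP

theorem inv_mod (P : PS K) {x : 𝓞 K} (hx : x ∉ P.asIdeal) : ∃ s : 𝓞 K, 1 + x * s ∈ P.asIdeal := by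
  have := P.isMaximal
  obtain ⟨y, hy⟩ := this.exists_inv hx
  obtain ⟨z, hz, h⟩ := hy
  refine ⟨-y, ?_⟩
  have : 1 + x * -y = z := by rw [← h]; ring
  rwa [this]

theorem pow_lift (l : ℕ) (t : 𝓞 K) (I : Ideal (𝓞 K)) (hI : I ≠ 0)
    (hG : ∀ P : PS K, P.asIdeal ∣ I → (l : 𝓞 K) ∉ P.asIdeal ∧ t ∉ P.asIdeal ∧ PowMod l t P) :
    ∃ β : 𝓞 K, β ^ l - t ∈ I := by
  induction I using UniqueFactorizationMonoid.induction_on_prime with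
  | h₁ => exact absurd rfl hI
  | h₂ I hu => exact ⟨1, by rw [Ideal.isUnit_iff.1 hu]; trivial⟩
  | h₃ I Q hI0 hQ ih =>
    obtain ⟨β, hβ⟩ := ih hI0 (fun P hP => hG P (hP.mul_left _))
    let P : PS K := ⟨Q, Ideal.isPrime_of_prime hQ, hQ.ne_zero⟩
    have hprime := P.isPrime
    obtain ⟨hP1, hP2, γ, hγ⟩ := hG P (Dvd.intro _ rfl)
    have hγ : γ ^ l - t ∈ Q := hγ
    by_cases hQI : Q ∣ I
    · have hIQ : I ≤ Q := Ideal.dvd_iff_le.1 hQI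
      have hl0 : l ≠ 0 := by
        rintro rfl
        exact hP1 (by simp)
      have hβP : (l : 𝓞 K) * β ^ (l - 1) ∉ P.asIdeal := by
        intro h
        rcases hprime.mem_or_mem h with h | h
        · exact hP1 h
        · apply hP2
          have h1 : β ^ l ∈ Q := by
            rw [← Nat.sub_add_cancel (Nat.one_le_iff_ne_zero.2 hl0), pow_succ]
            exact Q.mul_mem_right _ h
          have h2 := Q.sub_mem h1 (hIQ hβ)
          rw [sub_sub_cancel] at h2
          exact h2
      obtain ⟨s, hs⟩ := inv_mod P hβP
      obtain ⟨k, hk⟩ := Polynomial.powAddExpansion β ((β ^ l - t) * s) l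
      refine ⟨β + (β ^ l - t) * s, ?_⟩
      have e : (β + (β ^ l - t) * s) ^ l - t =
          (1 + (l : 𝓞 K) * β ^ (l - 1) * s) * (β ^ l - t) +
          ((β ^ l - t) * (k * s ^ 2)) * (β ^ l - t) := by
        rw [hk]; ring
      rw [e]
      exact Ideal.add_mem _ (Ideal.mul_mem_mul hs hβ)
        (Ideal.mul_mem_mul (Ideal.mul_mem_right _ _ (hIQ hβ)) hβ)
    · have hcop : IsCoprime Q I := isCoprime_prime (P := P).2 hQI
      obtain ⟨q, hq, i, hi, hqi⟩ := Ideal.isCoprime_iff_exists.1 hcop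
      refine ⟨β * q + γ * i, ?_⟩
      have key : ∀ (J : Ideal (𝓞 K)) (x y : 𝓞 K), x - y ∈ J → y ^ l - t ∈ J → x ^ l - t ∈ J := by
        intro J x y h1 h2
        have h3 : x ^ l - y ^ l ∈ J := Ideal.mem_of_dvd _ (sub_dvd_pow_sub_pow x y l) h1
        have := J.add_mem h3 h2
        rwa [sub_add_sub_cancel] at this
      rw [Ideal.mul_eq_inf_of_isCoprime hcop]
      constructor
      · refine key _ _ γ ?_ hγ
        have : β * q + γ * i - γ = (β - γ) * q := by
          linear_combination γ * hqi
        rw [this]; exact Ideal.mul_mem_left _ _ hq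
      · refine key _ _ β ?_ hβ
        have : β * q + γ * i - β = (γ - β) * i := by
          linear_combination β * hqi
        rw [this]; exact Ideal.mul_mem_left _ _ hi

theorem powMod_of_not_NCong {l : ℕ} (hl : l.Prime) {t : 𝓞 K} {P : PS K} (h : ¬ NCong l P)
    (ht : t ∉ P.asIdeal) : PowMod l t P := by
  rw [NCong_iff] at h
  have hc : l.Coprime (Ideal.absNorm P.asIdeal - 1) := (Nat.Prime.coprime_iff_not_dvd hl).2 h
  have hN2 : 2 ≤ Ideal.absNorm P.asIdeal := by
    have h : 2 ≤ NN P := two_le_NN P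
    unfold NN at h; exact_mod_cast h
  obtain ⟨e, he⟩ := Nat.exists_mul_mod_eq_of_coprime 1 hc (by omega)
  refine ⟨t ^ e, ?_⟩
  have h2 := Nat.div_add_mod (l * e) (Ideal.absNorm P.asIdeal - 1)
  have h3 := Nat.div_add_mod 1 (Ideal.absNorm P.asIdeal - 1)
  have hf : ∀ j, t ^ ((Ideal.absNorm P.asIdeal - 1) * j) - 1 ∈ P.asIdeal := fun j =>
    pow_sub_one_mem j (fermat P ht)
  have h4 : ∀ j, t ^ j - t ^ (j % (Ideal.absNorm P.asIdeal - 1)) ∈ P.asIdeal := by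
    intro j
    conv => enter [2, 1]; rw [← Nat.div_add_mod j (Ideal.absNorm P.asIdeal - 1)]
    rw [pow_add, ← sub_one_mul]
    exact Ideal.mul_mem_right _ _ (hf _)
  have h5 := P.asIdeal.sub_mem (h4 (l * e)) (h4 1)
  rw [he.2] at h5
  rw [← pow_mul, mul_comm e l]
  simpa using h5

theorem surj_mod {L : Type*} [Field L] [NumberField L] [Algebra K L] (Q : PS L)
    (h : NN Q = NN (below K Q)) (x : 𝓞 L) : ∃ y : 𝓞 K, algebraMap (𝓞 K) (𝓞 L) y - x ∈ Q.asIdeal := by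
  have hQ : Q.asIdeal.LiesOver (below K Q).asIdeal := ⟨rfl⟩
  have hf1 : Finite (𝓞 L ⧸ Q.asIdeal) := Ideal.finiteQuotientOfFreeOfNeBot _ Q.ne_bot
  have hf2 : Finite (𝓞 K ⧸ (below K Q).asIdeal) :=
    Ideal.finiteQuotientOfFreeOfNeBot _ (below K Q).ne_bot
  let f : (𝓞 K ⧸ (below K Q).asIdeal) →+* (𝓞 L ⧸ Q.asIdeal) :=
    Ideal.quotientMap Q.asIdeal (algebraMap (𝓞 K) (𝓞 L)) le_rfl
  have hinj : Function.Injective f := Ideal.quotientMap_injective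
  have hcard : Nat.card (𝓞 K ⧸ (below K Q).asIdeal) = Nat.card (𝓞 L ⧸ Q.asIdeal) := by
    have : Ideal.absNorm Q.asIdeal = Ideal.absNorm (below K Q).asIdeal := by
      unfold NN at h; exact_mod_cast h
    rw [Ideal.absNorm_apply, Ideal.absNorm_apply, Submodule.cardQuot_apply,
      Submodule.cardQuot_apply] at this
    exact this.symm
  have hs : Function.Surjective f := ((Nat.bijective_iff_injective_and_card f).2 ⟨hinj, hcard⟩).2
  obtain ⟨y, hy⟩ := hs (Ideal.Quotient.mk _ x)
  obtain ⟨y, rfl⟩ := Ideal.Quotient.mk_surjective y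
  refine ⟨y, ?_⟩
  rw [← Ideal.Quotient.eq_zero_iff_mem, map_sub, sub_eq_zero]
  exact hy

theorem powMod_of_root {L : Type*} [Field L] [NumberField L] [Algebra K L] (Q : PS L)
    (h : NN Q = NN (below K Q)) (l : ℕ) (t : 𝓞 K) (τ : 𝓞 L)
    (hτ : τ ^ l = algebraMap (𝓞 K) (𝓞 L) t) : PowMod l t (below K Q) := by
  obtain ⟨y, hy⟩ := surj_mod Q h τ
  refine ⟨y, ?_⟩
  change algebraMap (𝓞 K) (𝓞 L) _ ∈ Q.asIdeal
  rw [map_sub, map_pow, ← hτ]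
  exact Ideal.mem_of_dvd _ (sub_dvd_pow_sub_pow _ _ l) hy

theorem NCong_of_root {L : Type*} [Field L] [NumberField L] [Algebra K L] (Q : PS L)
    (h : NN Q = NN (below K Q)) {l : ℕ} (hl : l.Prime) (hlP : (l : 𝓞 K) ∉ (below K Q).asIdeal)
    (ζ : 𝓞 L) (hζ : ∑ i ∈ Finset.range l, ζ ^ i = 0) : NCong l (below K Q) := by
  have hprime := (below K Q).isPrime
  have hprimeQ := Q.isPrime
  obtain ⟨y, hy⟩ := surj_mod Q h ζ
  rw [NCong_iff]
  have hmem : ∀ z : 𝓞 K, z ∈ (below K Q).asIdeal ↔ algebraMap (𝓞 K) (𝓞 L) z ∈ Q.asIdeal :=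
    fun z => Iff.rfl
  have hg : ∑ i ∈ Finset.range l, y ^ i ∈ (below K Q).asIdeal := by
    rw [hmem, map_sum, ← sub_zero (∑ i ∈ Finset.range l, _), ← hζ, ← Finset.sum_sub_distrib]
    refine Ideal.sum_mem _ fun i _ => ?_
    rw [map_pow]
    exact Ideal.mem_of_dvd _ (sub_dvd_pow_sub_pow _ _ i) hy
  have hyl : y ^ l - 1 ∈ (below K Q).asIdeal := by
    rw [← geom_sum_mul]
    exact Ideal.mul_mem_right _ _ hg
  have hy1 : y - 1 ∉ (below K Q).asIdeal := by
    intro h1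
    apply hlP
    have : ∑ i ∈ Finset.range l, (y ^ i - 1) ∈ (below K Q).asIdeal := by
      refine Ideal.sum_mem _ fun i _ => ?_
      have := sub_dvd_pow_sub_pow y 1 i
      rw [one_pow] at this
      exact Ideal.mem_of_dvd _ this h1
    have h2 := Ideal.sub_mem _ hg this
    rw [← Finset.sum_sub_distrib] at h2
    simpa using h2
  have hyP : y ∉ (below K Q).asIdeal := by
    intro h1
    have h2 := Ideal.sub_mem _ (Ideal.pow_mem_of_mem _ h1 l hl.pos) hyl
    rw [sub_sub_cancel] at h2
    exact hprime.ne_top ((Ideal.eq_top_iff_one _).2 h2)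
  have hF := fermat (below K Q) hyP
  by_contra hnd
  have hcop := (Nat.Prime.coprime_iff_not_dvd hl).2 hnd
  set q := Ideal.Quotient.mk (below K Q).asIdeal
  have e1 : q y ^ l = 1 := by
    rw [← map_pow, ← sub_eq_zero, ← map_one q, ← map_sub]
    exact Ideal.Quotient.eq_zero_iff_mem.2 hyl
  have e2 : q y ^ (Ideal.absNorm (below K Q).asIdeal - 1) = 1 := by
    rw [← map_pow, ← sub_eq_zero, ← map_one q, ← map_sub]
    exact Ideal.Quotient.eq_zero_iff_mem.2 hF
  have e3 : q y = 1 := by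
    have := Nat.dvd_gcd (orderOf_dvd_of_pow_eq_one e1) (orderOf_dvd_of_pow_eq_one e2)
    rw [hcop.gcd_eq_one, Nat.dvd_one, orderOf_eq_one_iff] at this
    exact this
  apply hy1
  rw [← Ideal.Quotient.eq_zero_iff_mem, map_sub, map_one]
  exact sub_eq_zero.2 e3

theorem integral_root {L : Type*} [Field L] [NumberField L] [Algebra K L] {l : ℕ} (hl : l ≠ 0)
    (t : 𝓞 K) {x : L} (hx : x ^ l = algebraMap K L t) :
    ∃ τ : 𝓞 L, (τ : L) = x ∧ τ ^ l = algebraMap (𝓞 K) (𝓞 L) t := by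
  have hinteg : IsIntegral ℤ x := by
    apply IsIntegral.of_pow (Nat.pos_of_ne_zero hl)
    rw [hx]
    exact (RingOfIntegers.isIntegral_coe t).map (algebraMap K L |>.toIntAlgHom)
  refine ⟨⟨x, hinteg⟩, rfl, ?_⟩
  apply RingOfIntegers.ext
  exact hx

theorem lower_pow {l : ℕ} (hl : l.Prime) {t : 𝓞 K} (ht : t ≠ 0) :
    ∃ g : ℕ, 0 < g ∧ ∃ C : ℝ, ∀ᶠ s in 𝓝[>] (1:ℝ),
      lam s ≤ g * PSum (fun P : PS K => ind (NCong l P ∧ PowMod l t P)) s + C := by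
  let A := AlgebraicClosure K
  obtain ⟨x, hx⟩ := IsAlgClosed.exists_pow_nat_eq (algebraMap K A t) hl.pos
  obtain ⟨z, hz⟩ : ∃ z : A, ∑ i ∈ Finset.range l, z ^ i = 0 := by
    obtain ⟨z, hz⟩ := IsAlgClosed.exists_root (Polynomial.cyclotomic l A) (by
      rw [Polynomial.degree_cyclotomic]
      exact_mod_cast (Nat.totient_pos.2 hl.pos).ne')
    have : Fact l.Prime := ⟨hl⟩
    rw [Polynomial.cyclotomic_prime, Polynomial.IsRoot.def, Polynomial.eval_geom_sum] at hz
    exact ⟨z, hz⟩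
  let L := IntermediateField.adjoin K {x, z}
  have hfd : FiniteDimensional K L := by
    apply IntermediateField.finiteDimensional_adjoin
    intro y _
    exact Algebra.IsIntegral.isIntegral y
  have : NumberField L := NumberField.of_module_finite K L
  let x' : L := ⟨x, IntermediateField.subset_adjoin _ _ (by simp)⟩
  let z' : L := ⟨z, IntermediateField.subset_adjoin _ _ (by simp)⟩
  have hx' : x' ^ l = algebraMap K L t := Subtype.ext hx
  have hz' : ∑ i ∈ Finset.range l, z' ^ i = 0 := by
    apply Subtype.ext
    push_cast
    exact hz
  have hzl : z' ^ l = algebraMap K L ((1 : 𝓞 K) : K) := by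
    have := geom_sum_mul z' l
    rw [hz', zero_mul] at this
    simp only [map_one]
    exact (sub_eq_zero.1 this.symm)
  obtain ⟨τ, -, hτ⟩ := integral_root hl.ne_zero t hx'
  obtain ⟨ζ, hζ, -⟩ := integral_root hl.ne_zero 1 hzl
  have hζ : ∑ i ∈ Finset.range l, ζ ^ i = 0 := by
    apply RingOfIntegers.ext
    simp only [map_sum, map_pow, map_zero, hζ]
    exact hz'
  refine ⟨Module.finrank K L, Module.finrank_pos, ?_⟩
  refine lower_bound L _ le_rfl _ (finite_mem (x := (l : 𝓞 K)) (by exact_mod_cast hl.ne_zero)) ?_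
  intro Q hQ hQF
  exact ⟨NCong_of_root Q hQ hl hQF ζ hζ, powMod_of_root Q hQ l t τ hτ⟩

theorem star2 (hdeg : 1 < Module.finrank ℚ K) (hreal : Nonempty (K →+* ℝ)) {l : ℕ} (hl : l.Prime)
    (hl2 : l ≠ 2) {t b : 𝓞 K} (ht : t ≠ 0) {D : Ideal (𝓞 K)} (hD : D ≠ 0)
    (hb : IsCoprime (Ideal.span {b}) D) :
    ∃ b' : 𝓞 K, b' ≠ 0 ∧ b' - b ∈ D ∧ ∃ β : 𝓞 K, b' ∣ t - β ^ l := by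
  obtain ⟨g, hg, C1, h1⟩ := lower_pow hl ht
  have hl3 : 2 < l := lt_of_le_of_ne hl.two_le (Ne.symm hl2)
  obtain ⟨C2, h2⟩ := upper_bound_half hdeg hreal hl3
  have hg' : (0:ℝ) < g := by exact_mod_cast hg
  obtain ⟨b', hb0, hb1, hb2⟩ := good_exists hD hb
    (fun P => (l : 𝓞 K) ∉ P.asIdeal ∧ t ∉ P.asIdeal ∧ PowMod l t P)
    (fun P => NCong l P ∧ ¬ PowMod l t P)
    (F := {P | (l : 𝓞 K) ∈ P.asIdeal} ∪ {P | t ∈ P.asIdeal})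
    ((finite_mem (by exact_mod_cast hl.ne_zero)).union (finite_mem ht)) (by
      intro P hP
      simp only [Set.mem_union, Set.mem_ofPred_eq, not_or] at hP
      by_cases h : PowMod l t P
      · exact Or.inl ⟨hP.1, hP.2, h⟩
      · by_cases h' : NCong l P
        · exact Or.inr ⟨h', h⟩
        · exact absurd (powMod_of_not_NCong hl h' hP.2) h)
    (a := 1 / 2 - 1 / g) (C := C2 + C1 / g) (by
      have : 0 < 1 / (g:ℝ) := by positivity
      linarith) (by
      filter_upwards [h1, h2, self_mem_nhdsWithin] with s h1 h2 hs
      have hs : (1:ℝ) < s := hs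
      have e : (fun P : PS K => ind (NCong l P)) = fun P =>
          ind (NCong l P ∧ PowMod l t P) + ind (NCong l P ∧ ¬ PowMod l t P) := by
        funext P
        by_cases h : NCong l P <;> by_cases h' : PowMod l t P <;> simp [ind, h, h']
      rw [e, PSum_add (fun _ => ind_abs _) (fun _ => ind_abs _) hs] at h2
      have h3 : lam s / g ≤ PSum (fun P : PS K => ind (NCong l P ∧ PowMod l t P)) s + C1 / g := by
        rw [div_le_iff₀ hg', add_mul, div_mul_cancel₀ _ hg'.ne']
        linarith
      have h4 : (1 / 2 - 1 / (g:ℝ)) * lam s = lam s / 2 - lam s / g := by ring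
      rw [h4]
      linarith)
  refine ⟨b', hb0, hb1, ?_⟩
  obtain ⟨β, hβ⟩ := pow_lift l t (Ideal.span {b'}) (by simpa using hb0) hb2
  refine ⟨β, ?_⟩
  rw [dvd_sub_comm]
  exact Ideal.mem_span_singleton.1 hβ

end star2
end VL

namespace VL
open NumberField InfinitePlace

section star3
variable {K : Type*} [Field K] [NumberField K]
open Filter Topology

theorem mul_app (f g : Ideal (𝓞 K) →*₀ ℂ) (I : Ideal (𝓞 K)) : (f * g) I = f I * g I := rfl

/-- product of characters -/
noncomputable def DChar.mul {D E : Ideal (𝓞 K)} (X : DChar D) (Y : DChar E) : DChar (D * E) where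
  χ := X.χ * Y.χ
  norm_one := fun I hI h => by
    rw [mul_app, norm_mul, X.norm_one I hI h.of_mul_right_left,
      Y.norm_one I hI h.of_mul_right_right, one_mul]
  zero := fun I h => by
    rw [mul_app]
    by_cases h1 : IsCoprime I D
    · have h2 : ¬ IsCoprime I E := fun h2 => h (h1.mul_right h2)
      rw [Y.zero I h2, mul_zero]
    · rw [X.zero I h1, zero_mul]
  per := fun α β hα hβ hs hc hφ => by
    rw [mul_app, mul_app,
      X.per α β hα hβ (Ideal.mul_le_left hs) hc.of_mul_right_left hφ,
      Y.per α β hα hβ (Ideal.mul_le_right hs) hc.of_mul_right_right hφ]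

theorem lower_sq (t : 𝓞 K) :
    ∃ C : ℝ, ∀ᶠ s in 𝓝[>] (1:ℝ),
      lam s ≤ 2 * PSum (fun P : PS K => ind (PowMod 2 t P)) s + C := by
  let A := AlgebraicClosure K
  obtain ⟨x, hx⟩ := IsAlgClosed.exists_pow_nat_eq (algebraMap K A t) two_pos
  let L := IntermediateField.adjoin K {x}
  have hxi : IsIntegral K x := Algebra.IsIntegral.isIntegral x
  have hfd : FiniteDimensional K L := IntermediateField.adjoin.finiteDimensional hxi
  have : NumberField L := NumberField.of_module_finite K L
  let x' : L := ⟨x, IntermediateField.subset_adjoin _ _ (by simp)⟩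
  have hx' : x' ^ 2 = algebraMap K L t := Subtype.ext hx
  obtain ⟨τ, -, hτ⟩ := integral_root two_ne_zero t hx'
  have hdeg : Module.finrank K L ≤ 2 := by
    rw [IntermediateField.adjoin.finrank hxi]
    have h1 : minpoly K x ∣ Polynomial.X ^ 2 - Polynomial.C (t : K) := by
      apply minpoly.dvd
      simp [hx]
    have h2 := Polynomial.natDegree_le_of_dvd h1 (Polynomial.X_pow_sub_C_ne_zero two_pos _)
    rwa [Polynomial.natDegree_X_pow_sub_C] at h2
  have := lower_bound L 2 hdeg (fun P => PowMod 2 t P) (F := ∅) Set.finite_empty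
    (fun Q hQ _ => powMod_of_root Q hQ 2 t τ hτ)
  exact_mod_cast this

/-- the mod 4 character -/
noncomputable def psi4 : DirichletCharacter ℂ 4 := ZMod.χ₄.ringHomComp (Int.castRingHom ℂ)

theorem psi4_neg_one : psi4 (-1) = -1 := by
  have : ZMod.χ₄ (-1) = -1 := by decide
  rw [psi4, MulChar.ringHomComp_apply, this]; simp

theorem neg_one_sq_iff {P : PS K} (h2 : (2 : 𝓞 K) ∉ P.asIdeal) :
    (PowMod 2 (-1) P → (normChar K four_ne_zero psi4).χ P.asIdeal = 1) ∧
    (¬ PowMod 2 (-1) P → (normChar K four_ne_zero psi4).χ P.asIdeal = -1) := by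
  have := P.isMaximal
  let _ := Ideal.Quotient.field P.asIdeal
  have hfin : Finite (𝓞 K ⧸ P.asIdeal) := Ideal.finiteQuotientOfFreeOfNeBot _ P.ne_bot
  have : Fintype (𝓞 K ⧸ P.asIdeal) := Fintype.ofFinite _
  have hcard : Ideal.absNorm P.asIdeal = Fintype.card (𝓞 K ⧸ P.asIdeal) := by
    rw [Ideal.absNorm_apply, Submodule.cardQuot_apply, Nat.card_eq_fintype_card]
  have hodd : ¬ 2 ∣ Ideal.absNorm P.asIdeal := by
    have h : ((2:ℕ) : 𝓞 K) ∉ P.asIdeal := by exact_mod_cast h2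
    have := absNorm_coprime h
    intro hd
    have h3 := Nat.dvd_gcd hd (dvd_refl 2)
    rw [this.gcd_eq_one] at h3
    omega
  have hiff : PowMod 2 (-1) P ↔ Ideal.absNorm P.asIdeal % 4 ≠ 3 := by
    rw [hcard, ← FiniteField.isSquare_neg_one_iff]
    constructor
    · rintro ⟨β, hβ⟩
      refine ⟨Ideal.Quotient.mk _ β, ?_⟩
      rw [← Ideal.Quotient.eq_zero_iff_mem, map_sub, sub_eq_zero, map_pow, map_neg, map_one] at hβ
      rw [← hβ, sq]
    · rintro ⟨β, hβ⟩
      obtain ⟨β, rfl⟩ := Ideal.Quotient.mk_surjective β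
      refine ⟨β, ?_⟩
      rw [← Ideal.Quotient.eq_zero_iff_mem, map_sub, sub_eq_zero, map_pow, map_neg, map_one, hβ, sq]
  rw [hiff, normChar_apply _ _ P.ne_bot, ← ZMod.natCast_mod]
  have h4 : Ideal.absNorm P.asIdeal % 4 = 1 ∨ Ideal.absNorm P.asIdeal % 4 = 3 := by omega
  constructor
  · intro h
    rw [h4.resolve_right h]; simp
  · intro h
    rw [not_not.1 h]
    have : ((3 : ℕ) : ZMod 4) = -1 := by decide
    rw [this, psi4_neg_one]

/-- negative primes for the character -/
theorem bad_sum {D : Ideal (𝓞 K)} (hD : D ≠ 0) {b : 𝓞 K} (hb : IsCoprime (Ideal.span {b}) D)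
    {t : 𝓞 K} (ht : t ≠ 0)
    (hno : ¬ ∃ b' : 𝓞 K, b' ≠ 0 ∧ b' - b ∈ D ∧ ∀ P : PS K, P.asIdeal ∣ Ideal.span {b'} →
      ((2 : 𝓞 K) ∉ P.asIdeal ∧ t ∉ P.asIdeal ∧ PowMod 2 t P)) :
    ∃ X : DChar D, (∀ P : PS K, (2 : 𝓞 K) ∉ P.asIdeal → t ∉ P.asIdeal → PowMod 2 t P →
        ¬ P.asIdeal ∣ D → X.χ P.asIdeal = 1) ∧
      (∀ α β, α ≠ 0 → β ≠ 0 → α - β ∈ D → IsCoprime (Ideal.span {α}) D →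
        X.χ (Ideal.span {α}) = X.χ (Ideal.span {β})) ∧
      ∃ C : ℝ, ∀ᶠ s in 𝓝[>] (1:ℝ),
        PSum (fun P : PS K => ind (¬ PowMod 2 t P) * (1 + (X.χ P.asIdeal).re)) s ≤ C := by
  obtain ⟨hb0, X, hX1, hX3, hX2⟩ := key_lemma hD hb _ hno
  refine ⟨X, fun P h2 h3 h4 h5 => hX1 P ⟨h2, h3, h4⟩ (isCoprime_prime.2 h5), hX3, ?_⟩
  obtain ⟨C1, h1⟩ := PSum_char hD X _ (by simpa using hb0) hb hX2
  obtain ⟨C2, h2⟩ := PSum_one (K := K)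
  obtain ⟨C4, h4⟩ := lower_sq t
  have hbd2 : ∀ P : PS K, |(X.χ P.asIdeal).re| ≤ 1 := fun P => re_bound _ _
  have hbd3 : ∀ P : PS K, |1 + (X.χ P.asIdeal).re| ≤ 2 := fun P => by
    have := abs_le.1 (hbd2 P)
    rw [abs_le]; constructor <;> linarith
  have hbd4 : ∀ P : PS K, |ind (¬ PowMod 2 t P) * (1 + (X.χ P.asIdeal).re)| ≤ 2 := fun P => by
    rw [abs_mul]
    have := hbd3 P
    have := ind_abs (¬ PowMod 2 t P)
    nlinarith [abs_nonneg (ind (¬ PowMod 2 t P)), abs_nonneg (1 + (X.χ P.asIdeal).re)]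
  have hbd5 : ∀ P : PS K, |2 * ind (PowMod 2 t P)| ≤ 2 := fun P => by
    rw [abs_mul]; norm_num; exact ind_abs _
  obtain ⟨C3, h3⟩ := PSum_le (K := K) (B := 4) (B' := 2)
    (f := fun P => ind (¬ PowMod 2 t P) * (1 + (X.χ P.asIdeal).re) + 2 * ind (PowMod 2 t P))
    (g := fun P => 1 + (X.χ P.asIdeal).re)
    (F := {P | (2 : 𝓞 K) ∈ P.asIdeal} ∪ {P | t ∈ P.asIdeal} ∪ {P | P.asIdeal ∣ D})
    (fun P => by
      refine (abs_add_le _ _).trans ?_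
      linarith [hbd4 P, hbd5 P]) hbd3
    (((finite_mem two_ne_zero).union (finite_mem ht)).union (Ideal.finite_factors hD)) (by
      intro P hP
      simp only [Set.mem_union, Set.mem_ofPred_eq, not_or] at hP
      by_cases h : PowMod 2 t P
      · rw [ind_true h, ind_false (not_not.2 h),
          hX1 P ⟨hP.1.1, hP.1.2, h⟩ (isCoprime_prime.2 hP.2), Complex.one_re]
        norm_num
      · rw [ind_true h, ind_false h]; simp)
  refine ⟨C1 + C2 + C3 + C4, ?_⟩
  filter_upwards [h1, h2, h4, self_mem_nhdsWithin] with s h1 h2 h4 hs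
  have hs : (1:ℝ) < s := hs
  have h3 := h3 s hs
  rw [PSum_add hbd4 hbd5 hs, PSum_smul 2, PSum_add (B := 1) (fun _ => by simp) hbd2 hs] at h3
  have h2 := (abs_le.1 h2).2
  linarith

theorem re_mul_bound {z w : ℂ} (hz : ‖z‖ = 1) (hw : ‖w‖ = 1) :
    1 - (z * w).re ≤ 2 * ((1 + z.re) + (1 + w.re)) := by
  have h1 : z.re ^ 2 + z.im ^ 2 = 1 := by
    have := Complex.sq_norm z
    rw [hz, Complex.normSq_apply] at this; linarith
  have h2 : w.re ^ 2 + w.im ^ 2 = 1 := by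
    have := Complex.sq_norm w
    rw [hw, Complex.normSq_apply] at this; linarith
  rw [Complex.mul_re]
  nlinarith [sq_nonneg (z.im - w.im), sq_nonneg (z.re - w.re), sq_nonneg (z.re + w.re + 2), sq_nonneg (z.im + w.im)]

theorem local_bound {p1 p2 p3 : Prop} {x y w : ℂ} (h1 : p1 → x = 1) (h2 : p2 → y = 1)
    (nx : ‖x‖ = 1) (ny : ‖y‖ = 1) (hw : p3 → w = 1) (hw' : ¬ p3 → w = -1)
    (q1 : p1 → p2 → p3) (q2 : p1 → ¬ p2 → ¬ p3) (q3 : ¬ p1 → p2 → ¬ p3) (q4 : ¬ p1 → ¬ p2 → p3) :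
    1 ≤ (x * y * w).re + 2 * (ind (¬ p1) * (1 + x.re) + ind (¬ p2) * (1 + y.re)) := by
  have hx := (abs_le.1 ((Complex.abs_re_le_norm x).trans nx.le)).1
  have hy := (abs_le.1 ((Complex.abs_re_le_norm y).trans ny.le)).1
  by_cases a1 : p1
  · rw [h1 a1, ind_false (not_not.2 a1)]
    by_cases a2 : p2
    · rw [h2 a2, ind_false (not_not.2 a2), hw (q1 a1 a2)]
      norm_num
    · rw [ind_true a2, hw' (q2 a1 a2)]
      simp only [one_mul, mul_neg, mul_one, Complex.neg_re]
      linarith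
  · rw [ind_true a1]
    by_cases a2 : p2
    · rw [h2 a2, ind_false (not_not.2 a2), hw' (q3 a1 a2)]
      simp only [one_mul, mul_neg, mul_one, Complex.neg_re]
      linarith
    · rw [ind_true a2, hw (q4 a1 a2), mul_one]
      have := re_mul_bound nx ny
      linarith

theorem sq_cases {P : PS K} (h2 : (2 : 𝓞 K) ∉ P.asIdeal) {t : 𝓞 K} (ht : t ∉ P.asIdeal) :
    (PowMod 2 t P → PowMod 2 (-t) P → PowMod 2 (-1) P) ∧
    (PowMod 2 t P → ¬ PowMod 2 (-t) P → ¬ PowMod 2 (-1) P) ∧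
    (¬ PowMod 2 t P → PowMod 2 (-t) P → ¬ PowMod 2 (-1) P) ∧
    (¬ PowMod 2 t P → ¬ PowMod 2 (-t) P → PowMod 2 (-1) P) := by
  classical
  have := P.isMaximal
  let _ := Ideal.Quotient.field P.asIdeal
  have hfin : Finite (𝓞 K ⧸ P.asIdeal) := Ideal.finiteQuotientOfFreeOfNeBot _ P.ne_bot
  have : Fintype (𝓞 K ⧸ P.asIdeal) := Fintype.ofFinite _
  have hne : ∀ u : 𝓞 K, u ∉ P.asIdeal → Ideal.Quotient.mk P.asIdeal u ≠ 0 := by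
    intro u hu
    rwa [Ne, Ideal.Quotient.eq_zero_iff_mem]
  have hiff : ∀ u : 𝓞 K, u ∉ P.asIdeal →
      (PowMod 2 u P ↔ quadraticChar (𝓞 K ⧸ P.asIdeal) (Ideal.Quotient.mk _ u) = 1) := by
    intro u hu
    rw [quadraticChar_one_iff_isSquare (hne u hu)]
    constructor
    · rintro ⟨β, hβ⟩
      refine ⟨Ideal.Quotient.mk _ β, ?_⟩
      rw [← Ideal.Quotient.eq_zero_iff_mem, map_sub, sub_eq_zero, map_pow] at hβ
      rw [← hβ, sq]
    · rintro ⟨β, hβ⟩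
      obtain ⟨β, rfl⟩ := Ideal.Quotient.mk_surjective β
      refine ⟨β, ?_⟩
      rw [← Ideal.Quotient.eq_zero_iff_mem, map_sub, sub_eq_zero, map_pow, hβ, sq]
  have h1 : (-1 : 𝓞 K) ∉ P.asIdeal := fun h =>
    P.isPrime.ne_top ((Ideal.eq_top_iff_one _).2 (neg_mem_iff.1 h))
  have ht' : -t ∉ P.asIdeal := fun h => ht (neg_mem_iff.1 h)
  rw [hiff t ht, hiff _ ht', hiff _ h1]
  have e : -t = -1 * t := by ring
  rw [e, map_mul, map_mul]
  rcases quadraticChar_dichotomy (hne t ht) with a | a <;>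
  rcases quadraticChar_dichotomy (hne _ h1) with b | b <;> rw [a, b] <;> norm_num

set_option maxHeartbeats 1000000 in
theorem star3 (hdeg : 1 < Module.finrank ℚ K) (hreal : Nonempty (K →+* ℝ)) {t b : 𝓞 K}
    (ht : t ≠ 0) {D : Ideal (𝓞 K)} (hD : D ≠ 0) (hb : IsCoprime (Ideal.span {b}) D) :
    ∃ b' : 𝓞 K, b' ≠ 0 ∧ b' - b ∈ D ∧ ∃ β : 𝓞 K, b' ∣ t - β ^ 2 ∨ b' ∣ t + β ^ 2 := by
  have hfin : ∀ t' : 𝓞 K, (∃ b' : 𝓞 K, b' ≠ 0 ∧ b' - b ∈ D ∧ ∀ P : PS K,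
      P.asIdeal ∣ Ideal.span {b'} → ((2 : 𝓞 K) ∉ P.asIdeal ∧ t' ∉ P.asIdeal ∧ PowMod 2 t' P)) →
      ∃ b' : 𝓞 K, b' ≠ 0 ∧ b' - b ∈ D ∧ ∃ β : 𝓞 K, b' ∣ β ^ 2 - t' := by
    rintro t' ⟨b', h0, h1, h2⟩
    obtain ⟨β, hβ⟩ := pow_lift 2 t' (Ideal.span {b'}) (by simpa using h0)
      (by exact_mod_cast h2)
    exact ⟨b', h0, h1, β, Ideal.mem_span_singleton.1 hβ⟩
  by_cases hy1 : ∃ b' : 𝓞 K, b' ≠ 0 ∧ b' - b ∈ D ∧ ∀ P : PS K,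
      P.asIdeal ∣ Ideal.span {b'} → ((2 : 𝓞 K) ∉ P.asIdeal ∧ t ∉ P.asIdeal ∧ PowMod 2 t P)
  · obtain ⟨b', h0, h1, β, hβ⟩ := hfin _ hy1
    exact ⟨b', h0, h1, β, Or.inl (by rwa [dvd_sub_comm])⟩
  by_cases hy2 : ∃ b' : 𝓞 K, b' ≠ 0 ∧ b' - b ∈ D ∧ ∀ P : PS K,
      P.asIdeal ∣ Ideal.span {b'} → ((2 : 𝓞 K) ∉ P.asIdeal ∧ -t ∉ P.asIdeal ∧ PowMod 2 (-t) P)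
  · obtain ⟨b', h0, h1, β, hβ⟩ := hfin _ hy2
    refine ⟨b', h0, h1, β, Or.inr ?_⟩
    have e : β ^ 2 - -t = t + β ^ 2 := by ring
    rwa [e] at hβ
  exfalso
  obtain ⟨X, hX1, hXp, C1, hXs⟩ := bad_sum hD hb ht hy1
  obtain ⟨Y, hY1, hYp, C2, hYs⟩ := bad_sum hD hb (neg_ne_zero.2 ht) hy2
  obtain ⟨Z, hZ⟩ : ∃ Z : DChar (D * D * Ideal.span {((4:ℕ) : 𝓞 K)}),
      ∀ I, Z.χ I = X.χ I * Y.χ I * (normChar K four_ne_zero psi4).χ I :=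
    ⟨(X.mul Y).mul (normChar K four_ne_zero psi4), fun I => rfl⟩
  have h4D : D * D * Ideal.span {((4:ℕ) : 𝓞 K)} ≠ 0 :=
    mul_ne_zero (mul_ne_zero hD hD) (span_nat_ne_zero four_ne_zero)
  -- test element
  set N := Ideal.absNorm (D * D * Ideal.span {((4:ℕ) : 𝓞 K)}) with hN
  have hNmem : (N : 𝓞 K) ∈ D * D * Ideal.span {((4:ℕ) : 𝓞 K)} := Ideal.absNorm_mem _
  have hNpos : 0 < N := Nat.pos_of_ne_zero (by rw [hN, Ne, Ideal.absNorm_eq_zero_iff]; exact h4D)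
  obtain ⟨y, hy, hyn⟩ := exists_neg_norm hdeg hreal N hNpos
  have hy0 : y ≠ 0 := by
    rintro rfl
    rw [Algebra.norm_zero] at hyn
    exact lt_irrefl _ hyn
  have hyD4 : y - 1 ∈ D * D * Ideal.span {((4:ℕ) : 𝓞 K)} := Ideal.mem_of_dvd _ hy hNmem
  have hyD : y - 1 ∈ D := Ideal.mul_le_left (Ideal.mul_le_left hyD4)
  have hy4 : ((4:ℕ) : 𝓞 K) ∣ y - 1 := Ideal.mem_span_singleton.1 (Ideal.mul_le_right hyD4)
  have hcop : ∀ E : Ideal (𝓞 K), y - 1 ∈ E → IsCoprime (Ideal.span {y}) E := by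
    intro E hE
    rw [isCoprime_span_iff_of_sub_mem hE, Ideal.isCoprime_iff_sup_eq]; simp
  have hZy : Z.χ (Ideal.span {y}) = -1 := by
    rw [hZ, hXp y 1 hy0 one_ne_zero hyD (hcop _ hyD), hYp y 1 hy0 one_ne_zero hyD (hcop _ hyD)]
    rw [normChar_apply _ _ (by simpa using hy0), Ideal.absNorm_span_singleton]
    have h3 := norm_congr 4 y 1 hy4
    rw [map_one] at h3
    have : ((Algebra.norm ℤ y).natAbs : ZMod 4) = -1 := by
      have e : Algebra.norm ℤ y = -((Algebra.norm ℤ y).natAbs : ℤ) := by omega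
      rw [e] at h3
      push_cast at h3
      rw [← h3]
      simp
    rw [this, psi4_neg_one, Ideal.span_singleton_one, ← Ideal.one_eq_top, map_one, map_one]
    simp
  obtain ⟨C3, h3⟩ := PSum_char h4D Z (Ideal.span {y}) (by simpa using hy0) (hcop _ hyD4) (by
    rw [hZy]; norm_num)
  obtain ⟨C4, h4⟩ := PSum_one (K := K)
  set fX : PS K → ℝ := fun P => ind (¬ PowMod 2 t P) * (1 + (X.χ P.asIdeal).re) with hfX
  set fY : PS K → ℝ := fun P => ind (¬ PowMod 2 (-t) P) * (1 + (Y.χ P.asIdeal).re) with hfY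
  have hbd : ∀ (W : DChar D) (p : Prop) (P : PS K), |ind p * (1 + (W.χ P.asIdeal).re)| ≤ 2 ∧
      0 ≤ ind p * (1 + (W.χ P.asIdeal).re) := by
    intro W p P
    have h1 := abs_le.1 (re_bound W P.asIdeal)
    have h2 : 0 ≤ ind p * (1 + (W.χ P.asIdeal).re) := mul_nonneg (ind_nonneg _) (by linarith)
    refine ⟨?_, h2⟩
    rw [abs_of_nonneg h2]
    have := ind_le_one p
    have := ind_nonneg p
    nlinarith
  have bX : ∀ P, |fX P| ≤ 2 := fun P => (hbd X _ P).1
  have bY : ∀ P, |fY P| ≤ 2 := fun P => (hbd Y _ P).1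
  have bZ : ∀ P : PS K, |(Z.χ P.asIdeal).re| ≤ 1 := fun P => re_bound _ _
  have bS : ∀ P, |fX P + fY P| ≤ 4 := fun P => by
    refine (abs_add_le _ _).trans ?_
    linarith [bX P, bY P]
  have b2S : ∀ P, |2 * (fX P + fY P)| ≤ 8 := fun P => by
    rw [abs_mul]; norm_num; linarith [bS P]
  obtain ⟨C5, h5⟩ := PSum_le (K := K) (B := 1) (B' := 9) (f := fun _ => 1)
    (g := fun P => (Z.χ P.asIdeal).re + 2 * (fX P + fY P))
    (F := {P | (2 : 𝓞 K) ∈ P.asIdeal} ∪ {P | t ∈ P.asIdeal} ∪ {P | P.asIdeal ∣ D})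
    (fun P => by simp) (fun P => by
      refine (abs_add_le _ _).trans ?_
      linarith [b2S P, bZ P])
    (((finite_mem two_ne_zero).union (finite_mem ht)).union (Ideal.finite_factors hD)) (by
      intro P hP
      simp only [Set.mem_union, Set.mem_ofPred_eq, not_or] at hP
      obtain ⟨⟨hP2, hPt⟩, hPD⟩ := hP
      have hPt' : -t ∉ P.asIdeal := fun h => hPt (neg_mem_iff.1 h)
      have hn := neg_one_sq_iff hP2
      have nX : ‖X.χ P.asIdeal‖ = 1 := X.norm_one _ P.ne_bot (isCoprime_prime.2 hPD)
      have nY : ‖Y.χ P.asIdeal‖ = 1 := Y.norm_one _ P.ne_bot (isCoprime_prime.2 hPD)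
      obtain ⟨q1, q2, q3, q4⟩ := sq_cases hP2 hPt
      rw [hZ]
      exact local_bound (hX1 P hP2 hPt · hPD) (hY1 P hP2 hPt' · hPD) nX nY hn.1 hn.2 q1 q2 q3 q4)
  refine lam_contra (a := 1) (C := C3 + C4 + C5 + 2 * (C1 + C2)) one_pos ?_
  filter_upwards [h3, h4, hXs, hYs, self_mem_nhdsWithin] with s h3 h4 hXs hYs hs
  have hs : (1:ℝ) < s := hs
  have h5 := h5 s hs
  rw [PSum_add bZ b2S hs, PSum_smul 2, PSum_add bX bY hs] at h5
  have h4 := (abs_le.1 h4).1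
  linarith

end star3
end VL

namespace VL
open NumberField InfinitePlace

section sl2basic
variable {K : Type*} [Field K]

/-- `SL₂(K)` -/
abbrev SS (K : Type*) [Field K] := Matrix.SpecialLinearGroup (Fin 2) K

theorem SS.ext {A B : SS K} (h00 : A 0 0 = B 0 0) (h01 : A 0 1 = B 0 1) (h10 : A 1 0 = B 1 0)
    (h11 : A 1 1 = B 1 1) : A = B := by
  apply Matrix.SpecialLinearGroup.ext
  intro i j
  fin_cases i <;> fin_cases j <;> assumption

theorem SS.m00 (A B : SS K) : (A * B) 0 0 = A 0 0 * B 0 0 + A 0 1 * B 1 0 := by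
  simp [Matrix.mul_apply, Fin.sum_univ_two]
theorem SS.m01 (A B : SS K) : (A * B) 0 1 = A 0 0 * B 0 1 + A 0 1 * B 1 1 := by
  simp [Matrix.mul_apply, Fin.sum_univ_two]
theorem SS.m10 (A B : SS K) : (A * B) 1 0 = A 1 0 * B 0 0 + A 1 1 * B 1 0 := by
  simp [Matrix.mul_apply, Fin.sum_univ_two]
theorem SS.m11 (A B : SS K) : (A * B) 1 1 = A 1 0 * B 0 1 + A 1 1 * B 1 1 := by
  simp [Matrix.mul_apply, Fin.sum_univ_two]
theorem SS.i00 (A : SS K) : A⁻¹ 0 0 = A 1 1 := by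
  rw [Matrix.SpecialLinearGroup.coe_inv, Matrix.adjugate_fin_two]; rfl
theorem SS.i01 (A : SS K) : A⁻¹ 0 1 = -A 0 1 := by
  rw [Matrix.SpecialLinearGroup.coe_inv, Matrix.adjugate_fin_two]; rfl
theorem SS.i10 (A : SS K) : A⁻¹ 1 0 = -A 1 0 := by
  rw [Matrix.SpecialLinearGroup.coe_inv, Matrix.adjugate_fin_two]; rfl
theorem SS.i11 (A : SS K) : A⁻¹ 1 1 = A 0 0 := by
  rw [Matrix.SpecialLinearGroup.coe_inv, Matrix.adjugate_fin_two]; rfl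
theorem SS.o00 : (1 : SS K) 0 0 = 1 := by simp
theorem SS.o01 : (1 : SS K) 0 1 = 0 := by simp
theorem SS.o10 : (1 : SS K) 1 0 = 0 := by simp
theorem SS.o11 : (1 : SS K) 1 1 = 1 := by simp

theorem SS.det (A : SS K) : A 0 0 * A 1 1 - A 0 1 * A 1 0 = 1 := by
  have := A.det_coe
  rwa [Matrix.det_fin_two] at this

/-- matrix from entries -/
def mk4 (a b c d : K) (h : a * d - b * c = 1) : SS K :=
  ⟨!![a, b; c, d], by rw [Matrix.det_fin_two_of]; exact h⟩

theorem mk00 (a b c d : K) (h : a * d - b * c = 1) : mk4 a b c d h 0 0 = a := rfl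
theorem mk01 (a b c d : K) (h : a * d - b * c = 1) : mk4 a b c d h 0 1 = b := rfl
theorem mk10 (a b c d : K) (h : a * d - b * c = 1) : mk4 a b c d h 1 0 = c := rfl
theorem mk11 (a b c d : K) (h : a * d - b * c = 1) : mk4 a b c d h 1 1 = d := rfl

/-- upper elementary -/
def E12 (x : K) : SS K := mk4 1 x 0 1 (by ring)
/-- lower elementary -/
def E21 (x : K) : SS K := mk4 1 0 x 1 (by ring)
/-- diagonal -/
def hh (t : Kˣ) : SS K := mk4 t 0 0 ((t⁻¹ : Kˣ) : K) (by simp)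
/-- Weyl element -/
def ww (K : Type*) [Field K] : SS K := mk4 0 1 (-1) 0 (by ring)
/-- unipotent -/
def NZ (z c d : K) : SS K := mk4 (1 + z * c * d) (z * d ^ 2) (-z * c ^ 2) (1 - z * c * d) (by ring)

theorem e00 (x : K) : E12 x 0 0 = 1 := rfl
theorem e01 (x : K) : E12 x 0 1 = x := rfl
theorem e10 (x : K) : E12 x 1 0 = 0 := rfl
theorem e11 (x : K) : E12 x 1 1 = 1 := rfl
theorem f00 (x : K) : E21 x 0 0 = 1 := rfl
theorem f01 (x : K) : E21 x 0 1 = 0 := rfl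
theorem f10 (x : K) : E21 x 1 0 = x := rfl
theorem f11 (x : K) : E21 x 1 1 = 1 := rfl
theorem h00 (t : Kˣ) : hh t 0 0 = t := rfl
theorem h01 (t : Kˣ) : hh t 0 1 = 0 := rfl
theorem h10 (t : Kˣ) : hh t 1 0 = 0 := rfl
theorem h11 (t : Kˣ) : hh t 1 1 = (t : K)⁻¹ := by simp [hh, mk11]
theorem w00 : ww K 0 0 = 0 := rfl
theorem w01 : ww K 0 1 = 1 := rfl
theorem w10 : ww K 1 0 = -1 := rfl
theorem w11 : ww K 1 1 = 0 := rfl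
theorem n00 (z c d : K) : NZ z c d 0 0 = 1 + z * c * d := rfl
theorem n01 (z c d : K) : NZ z c d 0 1 = z * d ^ 2 := rfl
theorem n10 (z c d : K) : NZ z c d 1 0 = -z * c ^ 2 := rfl
theorem n11 (z c d : K) : NZ z c d 1 1 = 1 - z * c * d := rfl

theorem tne (t : Kˣ) : (t : K) ≠ 0 := t.ne_zero


end sl2basic
end VL
namespace VL
section sl2id
variable {K : Type*} [Field K]

theorem E12_add (x y : K) : E12 (x + y) = E12 x * E12 y := by
  apply SS.ext <;> simp only [SS.m00, SS.m01, SS.m10, SS.m11, e00, e01, e10, e11] <;> ring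
theorem E21_add (x y : K) : E21 (x + y) = E21 x * E21 y := by
  apply SS.ext <;> simp only [SS.m00, SS.m01, SS.m10, SS.m11, f00, f01, f10, f11] <;> ring
theorem E12_zero : E12 (0 : K) = 1 := by
  apply SS.ext <;> simp only [e00, e01, e10, e11, SS.o00, SS.o01, SS.o10, SS.o11]
theorem E21_zero : E21 (0 : K) = 1 := by
  apply SS.ext <;> simp only [f00, f01, f10, f11, SS.o00, SS.o01, SS.o10, SS.o11]
theorem E12_neg (x : K) : E12 (-x) = (E12 x)⁻¹ := by
  rw [eq_inv_iff_mul_eq_one, ← E12_add, neg_add_cancel, E12_zero]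
theorem E21_neg (x : K) : E21 (-x) = (E21 x)⁻¹ := by
  rw [eq_inv_iff_mul_eq_one, ← E21_add, neg_add_cancel, E21_zero]
theorem hh_mul (s t : Kˣ) : hh (s * t) = hh s * hh t := by
  apply SS.ext <;> simp only [SS.m00, SS.m01, SS.m10, SS.m11, h00, h01, h10, h11] <;>
    simp [mul_comm]
theorem hh_one : hh (1 : Kˣ) = 1 := by
  apply SS.ext <;> simp [h00, h01, h10, h11]
theorem hh_inv (t : Kˣ) : hh t⁻¹ = (hh t)⁻¹ := by
  rw [eq_inv_iff_mul_eq_one, ← hh_mul, inv_mul_cancel, hh_one]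
theorem hh_E12 (t : Kˣ) (x : K) : hh t * E12 x * (hh t)⁻¹ = E12 (t ^ 2 * x) := by
  have := tne t
  apply SS.ext <;> simp only [SS.m00, SS.m01, SS.m10, SS.m11, SS.i00, SS.i01, SS.i10, SS.i11,
    h00, h01, h10, h11, e00, e01, e10, e11] <;> field_simp <;> ring
theorem hh_E21 (t : Kˣ) (x : K) : hh t * E21 x * (hh t)⁻¹ = E21 ((t : K)⁻¹ ^ 2 * x) := by
  have := tne t
  apply SS.ext <;> simp only [SS.m00, SS.m01, SS.m10, SS.m11, SS.i00, SS.i01, SS.i10, SS.i11,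
    h00, h01, h10, h11, f00, f01, f10, f11] <;> field_simp <;> ring
theorem ww_E12 (x : K) : ww K * E12 x * (ww K)⁻¹ = E21 (-x) := by
  apply SS.ext <;> simp only [SS.m00, SS.m01, SS.m10, SS.m11, SS.i00, SS.i01, SS.i10, SS.i11,
    w00, w01, w10, w11, e00, e01, e10, e11, f00, f01, f10, f11] <;> ring
theorem ww_E21 (x : K) : ww K * E21 x * (ww K)⁻¹ = E12 (-x) := by
  apply SS.ext <;> simp only [SS.m00, SS.m01, SS.m10, SS.m11, SS.i00, SS.i01, SS.i10, SS.i11,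
    w00, w01, w10, w11, e00, e01, e10, e11, f00, f01, f10, f11] <;> ring

/-- factorisation of diagonal matrices -/
theorem hh_fact (t : Kˣ) (n y : K) (h : (t : K) = 1 + n ^ 2 * y) :
    hh t = E21 (-(n * y * (t : K)⁻¹)) * E12 n * E21 (n * y) * E12 (-(n * (t : K)⁻¹)) := by
  have ht := tne t
  have e : (t : K) - 1 = n ^ 2 * y := by rw [h]; ring
  have ht' : (t : K) * (t : K)⁻¹ = 1 := mul_inv_cancel₀ ht
  set s := (t : K)⁻¹
  apply SS.ext <;> simp only [SS.m00, SS.m01, SS.m10, SS.m11, h00, h01, h10, h11,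
    e00, e01, e10, e11, f00, f01, f10, f11]
  · linear_combination h
  · linear_combination (-n*s)*e + n*ht'
  · linear_combination n * y * ht' - n * y * s * h
  · linear_combination (1 - n ^ 2 * y * s) * ht' - (1 - n ^ 2 * y * s) * s * h

theorem NZ_E12 (A : SS K) (z : K) : A⁻¹ * E12 z * A = NZ z (A 1 0) (A 1 1) := by
  have := A.det
  apply SS.ext <;> simp only [SS.m00, SS.m01, SS.m10, SS.m11, SS.i00, SS.i01, SS.i10, SS.i11,
    e00, e01, e10, e11, n00, n01, n10, n11]
  · linear_combination this
  · ring
  · ring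
  · linear_combination this
theorem NZ_E21 (A : SS K) (z : K) : A⁻¹ * E21 z * A = NZ (-z) (A 0 0) (A 0 1) := by
  have := A.det
  apply SS.ext <;> simp only [SS.m00, SS.m01, SS.m10, SS.m11, SS.i00, SS.i01, SS.i10, SS.i11,
    f00, f01, f10, f11, n00, n01, n10, n11]
  · linear_combination this
  · ring
  · ring
  · linear_combination this
end sl2id
end VL

namespace VL
open NumberField InfinitePlace

section grp
variable {K : Type*} [Field K] [NumberField K]

/-- `x ∈ n O_K` -/
def Dv (n : ℕ) (x : K) : Prop := ∃ y : 𝓞 K, x = n * (y : K)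

theorem Dv.zero (n : ℕ) : Dv n (0 : K) := ⟨0, by simp⟩
theorem Dv.add {n : ℕ} {x y : K} (hx : Dv n x) (hy : Dv n y) : Dv n (x + y) := by
  obtain ⟨a, rfl⟩ := hx; obtain ⟨b, rfl⟩ := hy
  exact ⟨a + b, by push_cast; ring⟩
theorem Dv.neg {n : ℕ} {x : K} (hx : Dv n x) : Dv n (-x) := by
  obtain ⟨a, rfl⟩ := hx
  exact ⟨-a, by push_cast; ring⟩
theorem Dv.sub {n : ℕ} {x y : K} (hx : Dv n x) (hy : Dv n y) : Dv n (x - y) := by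
  rw [sub_eq_add_neg]; exact hx.add hy.neg
theorem Dv.mul {n m : ℕ} {x y : K} (hx : Dv n x) (hy : Dv m y) : Dv (n * m) (x * y) := by
  obtain ⟨a, rfl⟩ := hx; obtain ⟨b, rfl⟩ := hy
  exact ⟨a * b, by push_cast; ring⟩
theorem Dv.mono {n m : ℕ} {x : K} (h : n ∣ m) (hx : Dv m x) : Dv n x := by
  obtain ⟨a, rfl⟩ := hx; obtain ⟨k, rfl⟩ := h
  exact ⟨k * a, by push_cast; ring⟩
theorem Dv.of_int (x : 𝓞 K) : Dv 1 (x : K) := ⟨x, by simp⟩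
theorem Dv.mul_int {n : ℕ} {x y : K} (hx : Dv n x) (hy : Dv 1 y) : Dv n (x * y) := by
  have := hx.mul hy; rwa [mul_one] at this
theorem Dv.int_mul {n : ℕ} {x y : K} (hx : Dv 1 x) (hy : Dv n y) : Dv n (x * y) := by
  have := hx.mul hy; rwa [one_mul] at this
theorem Dv.self (n : ℕ) : Dv n (n : K) := ⟨1, by simp⟩
theorem Dv.int {n : ℕ} {x : K} (hx : Dv n x) : ∃ y : 𝓞 K, x = y := by
  obtain ⟨a, rfl⟩ := hx
  exact ⟨n * a, by push_cast; ring⟩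
theorem Dv.nat (n : ℕ) (x : 𝓞 K) : Dv n ((n : K) * x) := ⟨x, rfl⟩
theorem Dv.one : Dv 1 (1 : K) := ⟨1, by simp⟩

/-- congruence subgroup -/
def GN (K : Type*) [Field K] [NumberField K] (n : ℕ) : Subgroup (SS K) where
  carrier := {A | Dv n (A 0 1) ∧ Dv n (A 1 0) ∧ Dv (n ^ 2) (A 0 0 - 1) ∧ Dv (n ^ 2) (A 1 1 - 1)}
  one_mem' := by
    simp only [Set.mem_setOf_eq, SS.o00, SS.o01, SS.o10, SS.o11, sub_self]
    exact ⟨Dv.zero _, Dv.zero _, Dv.zero _, Dv.zero _⟩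
  mul_mem' := by
    rintro A B ⟨a1, a2, a3, a4⟩ ⟨b1, b2, b3, b4⟩
    have h1 : (1 : ℕ) ∣ n ^ 2 := one_dvd _
    have hn : n ∣ n ^ 2 := dvd_pow_self _ two_ne_zero
    simp only [Set.mem_setOf_eq, SS.m00, SS.m01, SS.m10, SS.m11]
    refine ⟨?_, ?_, ?_, ?_⟩
    · have e : A 0 0 * B 0 1 + A 0 1 * B 1 1 = (A 0 0 - 1) * B 0 1 + B 0 1 +
        (A 0 1 * (B 1 1 - 1) + A 0 1) := by ring
      rw [e]
      exact (((a3.mono h1).int_mul b1).add b1).add ((a1.mul_int (b4.mono h1)).add a1)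
    · have e : A 1 0 * B 0 0 + A 1 1 * B 1 0 = (A 1 0 * (B 0 0 - 1) + A 1 0) +
        ((A 1 1 - 1) * B 1 0 + B 1 0) := by ring
      rw [e]
      exact ((a2.mul_int (b3.mono h1)).add a2).add (((a4.mono h1).int_mul b2).add b2)
    · have e : A 0 0 * B 0 0 + A 0 1 * B 1 0 - 1 = (A 0 0 - 1) * (B 0 0 - 1) + (A 0 0 - 1) +
        (B 0 0 - 1) + A 0 1 * B 1 0 := by ring
      rw [e]
      refine (((a3.mul_int (b3.mono h1)).add a3).add b3).add ?_
      rw [sq]; exact a1.mul b2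
    · have e : A 1 0 * B 0 1 + A 1 1 * B 1 1 - 1 = (A 1 1 - 1) * (B 1 1 - 1) + (A 1 1 - 1) +
        (B 1 1 - 1) + A 1 0 * B 0 1 := by ring
      rw [e]
      refine (((a4.mul_int (b4.mono h1)).add a4).add b4).add ?_
      rw [sq]; exact a2.mul b1
  inv_mem' := by
    rintro A ⟨a1, a2, a3, a4⟩
    simp only [Set.mem_setOf_eq, SS.i00, SS.i01, SS.i10, SS.i11]
    exact ⟨a1.neg, a2.neg, a4, a3⟩

theorem mem_GN {n : ℕ} {A : SS K} : A ∈ GN K n ↔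
    Dv n (A 0 1) ∧ Dv n (A 1 0) ∧ Dv (n ^ 2) (A 0 0 - 1) ∧ Dv (n ^ 2) (A 1 1 - 1) := Iff.rfl

theorem GN_mono {n m : ℕ} (h : n ∣ m) : GN K m ≤ GN K n := by
  rintro A ⟨a1, a2, a3, a4⟩
  exact ⟨a1.mono h, a2.mono h, a3.mono (pow_dvd_pow_of_dvd h 2), a4.mono (pow_dvd_pow_of_dvd h 2)⟩

/-- elementary subgroup -/
def EE (K : Type*) [Field K] [NumberField K] (n : ℕ) : Subgroup (SS K) :=
  Subgroup.closure {A | ∃ x : K, Dv n x ∧ (A = E12 x ∨ A = E21 x)}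

theorem E12_mem {n : ℕ} {x : K} (h : Dv n x) : E12 x ∈ EE K n :=
  Subgroup.subset_closure ⟨x, h, Or.inl rfl⟩
theorem E21_mem {n : ℕ} {x : K} (h : Dv n x) : E21 x ∈ EE K n :=
  Subgroup.subset_closure ⟨x, h, Or.inr rfl⟩

theorem EE_le {n : ℕ} {H : Subgroup (SS K)} (h1 : ∀ x : K, Dv n x → E12 x ∈ H)
    (h2 : ∀ x : K, Dv n x → E21 x ∈ H) : EE K n ≤ H := by
  rw [EE, Subgroup.closure_le]
  rintro A ⟨x, hx, rfl | rfl⟩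
  · exact h1 x hx
  · exact h2 x hx

theorem EE_mono {n m : ℕ} (h : n ∣ m) : EE K m ≤ EE K n :=
  EE_le (fun _ hx => E12_mem (hx.mono h)) (fun _ hx => E21_mem (hx.mono h))

theorem EE_le_GN (n : ℕ) : EE K n ≤ GN K n := by
  apply EE_le
  · intro x hx
    rw [mem_GN]; simp only [e00, e01, e10, e11, sub_self]
    exact ⟨hx, Dv.zero _, Dv.zero _, Dv.zero _⟩
  · intro x hx
    rw [mem_GN]; simp only [f00, f01, f10, f11, sub_self]
    exact ⟨Dv.zero _, hx, Dv.zero _, Dv.zero _⟩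

/-- conjugation criterion -/
theorem EE_conj {n m : ℕ} (u : SS K) (h1 : ∀ x : K, Dv m x → u * E12 x * u⁻¹ ∈ EE K n)
    (h2 : ∀ x : K, Dv m x → u * E21 x * u⁻¹ ∈ EE K n) {e : SS K} (he : e ∈ EE K m) :
    u * e * u⁻¹ ∈ EE K n := by
  have : EE K m ≤ (EE K n).comap (MulAut.conj u).toMonoidHom := by
    apply EE_le
    · intro x hx; exact h1 x hx
    · intro x hx; exact h2 x hx
  exact this he

/-- relative elementary subgroup -/
def EP (K : Type*) [Field K] [NumberField K] (n : ℕ) : Subgroup (SS K) :=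
  Subgroup.closure {A | ∃ g ∈ GN K n, ∃ e ∈ EE K n, A = g * e * g⁻¹}

theorem EP_conj_mem {n : ℕ} {g e : SS K} (hg : g ∈ GN K n) (he : e ∈ EE K n) :
    g * e * g⁻¹ ∈ EP K n := Subgroup.subset_closure ⟨g, hg, e, he, rfl⟩

theorem EE_le_EP (n : ℕ) : EE K n ≤ EP K n := fun e he => by
  have := EP_conj_mem (one_mem (GN K n)) he
  simpa using this

theorem EP_le_GN (n : ℕ) : EP K n ≤ GN K n := by
  rw [EP, Subgroup.closure_le]
  rintro _ ⟨g, hg, e, he, rfl⟩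
  exact mul_mem (mul_mem hg (EE_le_GN n he)) (inv_mem hg)

/-- conjugation -/
theorem EP_conj {n m : ℕ} (u : SS K)
    (h1 : ∀ g ∈ GN K m, ∀ e ∈ EE K m, u * (g * e * g⁻¹) * u⁻¹ ∈ EP K n)
    {e : SS K} (he : e ∈ EP K m) : u * e * u⁻¹ ∈ EP K n := by
  have : EP K m ≤ (EP K n).comap (MulAut.conj u).toMonoidHom := by
    conv_lhs => rw [EP]
    rw [Subgroup.closure_le]
    rintro _ ⟨g, hg, e, he, rfl⟩
    exact h1 g hg e he
  exact this he

theorem EP_normal {n : ℕ} {g e : SS K} (hg : g ∈ GN K n) (he : e ∈ EP K n) :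
    g * e * g⁻¹ ∈ EP K n := by
  refine EP_conj g (fun g' hg' e he => ?_) he
  have := EP_conj_mem (mul_mem hg hg') he
  have e' : g * (g' * e * g'⁻¹) * g⁻¹ = (g * g') * e * (g * g')⁻¹ := by group
  rwa [e']

theorem EP_mono {n m : ℕ} (h : n ∣ m) : EP K m ≤ EP K n := by
  conv_lhs => rw [EP]
  rw [Subgroup.closure_le]
  rintro _ ⟨g, hg, e, he, rfl⟩
  exact EP_conj_mem (GN_mono h hg) (EE_mono h he)

/-- units of the ring of integers in `K` -/
def uK (K : Type*) [Field K] [NumberField K] : (𝓞 K)ˣ →* Kˣ :=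
  Units.map (algebraMap (𝓞 K) K : 𝓞 K →* K)

theorem uK_val (u : (𝓞 K)ˣ) : ((uK K u : Kˣ) : K) = ((u : 𝓞 K) : K) := rfl
theorem uK_inv (u : (𝓞 K)ˣ) : ((uK K u : Kˣ) : K)⁻¹ = (((u⁻¹ : (𝓞 K)ˣ) : 𝓞 K) : K) := by
  rw [← Units.val_inv_eq_inv_val, ← map_inv]; rfl

theorem hh_EE {n : ℕ} (u : (𝓞 K)ˣ) {e : SS K} (he : e ∈ EE K n) :
    hh (uK K u) * e * (hh (uK K u))⁻¹ ∈ EE K n := by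
  refine EE_conj _ (fun x hx => ?_) (fun x hx => ?_) he
  · rw [hh_E12, uK_val]
    apply E12_mem
    rw [sq]; exact ((Dv.of_int _).int_mul (Dv.of_int _)).int_mul hx
  · rw [hh_E21, uK_inv]
    apply E21_mem
    rw [sq]; exact ((Dv.of_int _).int_mul (Dv.of_int _)).int_mul hx

theorem hh_GN {n : ℕ} (u : (𝓞 K)ˣ) {e : SS K} (he : e ∈ GN K n) :
    hh (uK K u) * e * (hh (uK K u))⁻¹ ∈ GN K n := by
  obtain ⟨a1, a2, a3, a4⟩ := he
  have h0 := tne (uK K u)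
  have h1 : Dv 1 ((uK K u : Kˣ) : K) := Dv.of_int _
  have h2 : Dv 1 ((uK K u : Kˣ) : K)⁻¹ := by rw [uK_inv]; exact Dv.of_int _
  rw [mem_GN]
  simp only [SS.m00, SS.m01, SS.m10, SS.m11, SS.i00, SS.i01, SS.i10, SS.i11, h00, h01, h10, h11,
    mul_zero, zero_mul, add_zero, zero_add, neg_zero]
  refine ⟨(h1.int_mul a1).mul_int h1, (h2.int_mul a2).mul_int h2, ?_, ?_⟩
  · rwa [mul_comm, inv_mul_cancel_left₀ h0]
  · rwa [mul_comm, mul_inv_cancel_left₀ h0]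

theorem hh_EP {n : ℕ} (u : (𝓞 K)ˣ) {e : SS K} (he : e ∈ EP K n) :
    hh (uK K u) * e * (hh (uK K u))⁻¹ ∈ EP K n := by
  refine EP_conj _ (fun g hg e he => ?_) he
  have := EP_conj_mem (hh_GN u hg) (hh_EE u he)
  have e : hh (uK K u) * (g * e * g⁻¹) * (hh (uK K u))⁻¹ =
    (hh (uK K u) * g * (hh (uK K u))⁻¹) * (hh (uK K u) * e * (hh (uK K u))⁻¹) *
    (hh (uK K u) * g * (hh (uK K u))⁻¹)⁻¹ := by group
  rwa [e]

theorem hh_mem {n : ℕ} (u : (𝓞 K)ˣ) (h : Dv (n ^ 2) (((u : 𝓞 K) : K) - 1)) :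
    hh (uK K u) ∈ EE K n := by
  obtain ⟨y, hy⟩ := h
  have h2 : Dv 1 ((uK K u : Kˣ) : K)⁻¹ := by rw [uK_inv]; exact Dv.of_int _
  rw [hh_fact (uK K u) (n : K) (y : K) (by rw [uK_val]; push_cast at hy; linear_combination hy)]
  have h3 := (Dv.self (K := K) n).mul_int (Dv.of_int y)
  exact mul_mem (mul_mem (mul_mem (E21_mem (h3.mul_int h2).neg) (E12_mem (Dv.self n)))
    (E21_mem h3)) (E12_mem ((Dv.self n).mul_int h2).neg)

theorem ww_EE {n : ℕ} {e : SS K} (he : e ∈ EE K n) : ww K * e * (ww K)⁻¹ ∈ EE K n := by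
  refine EE_conj _ (fun x hx => ?_) (fun x hx => ?_) he
  · rw [ww_E12]; exact E21_mem hx.neg
  · rw [ww_E21]; exact E12_mem hx.neg

theorem ww_GN {n : ℕ} {e : SS K} (he : e ∈ GN K n) : (ww K)⁻¹ * e * (ww K) ∈ GN K n := by
  obtain ⟨a1, a2, a3, a4⟩ := he
  rw [mem_GN]
  simp only [SS.m00, SS.m01, SS.m10, SS.m11, SS.i00, SS.i01, SS.i10, SS.i11, w00, w01, w10, w11,
    mul_zero, zero_mul, add_zero, zero_add, neg_zero, neg_neg, mul_one, one_mul, mul_neg, neg_mul]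
  exact ⟨a2.neg, a1.neg, a4, a3⟩

/-- denominators -/
theorem exists_den (x : K) : ∃ m : ℕ, 0 < m ∧ Dv 1 ((m : K) * x) := by
  obtain ⟨a, b, hb, rfl⟩ := IsFractionRing.div_surjective (A := 𝓞 K) x
  have hb0 : b ≠ 0 := nonZeroDivisors.ne_zero hb
  have h1 : (Ideal.absNorm (Ideal.span {b}) : 𝓞 K) ∈ Ideal.span {b} := Ideal.absNorm_mem _
  obtain ⟨c, hc⟩ := Ideal.mem_span_singleton.1 h1
  refine ⟨Ideal.absNorm (Ideal.span {b}), Nat.pos_of_ne_zero ?_, ⟨c * a, ?_⟩⟩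
  · rw [Ne, Ideal.absNorm_eq_zero_iff]; simpa using hb0
  · have : ((Ideal.absNorm (Ideal.span {b}) : ℕ) : K) = (b : K) * (c : K) := by
      rw [← map_mul, ← hc]; simp
    have hb0' : (b : K) ≠ 0 := by exact_mod_cast hb0
    rw [this]
    change (b : K) * c * ((a : K) / (b : K)) = _
    push_cast
    field_simp

theorem exists_den' (n : ℕ) (hn : 0 < n) (x : K) : ∃ m : ℕ, 0 < m ∧ n ∣ m ∧ Dv n ((m : K) * x) := by
  obtain ⟨m, hm, h⟩ := exists_den x
  refine ⟨n * m, Nat.mul_pos hn hm, Dvd.intro _ rfl, ?_⟩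
  push_cast
  rw [mul_assoc]
  exact (Dv.self n).mul_int h

end grp
end VL

namespace VL
open NumberField InfinitePlace

section lemT
variable {K : Type*} [Field K] [NumberField K]

theorem stab_adjoin {Z : AddSubgroup K} {e : 𝓞 K} (h : ∀ z ∈ Z, (e : K) * z ∈ Z) {p : 𝓞 K}
    (hp : p ∈ Algebra.adjoin ℤ ({e} : Set (𝓞 K))) : ∀ z ∈ Z, (p : K) * z ∈ Z := by
  induction hp using Algebra.adjoin_induction with
  | mem x hx =>
    rw [Set.mem_singleton_iff] at hx
    rw [hx]; exact h
  | algebraMap r =>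
    intro z hz
    have : (((algebraMap ℤ (𝓞 K)) r : 𝓞 K) : K) * z = r • z := by simp
    rw [this]
    exact Z.zsmul_mem hz r
  | add x y _ _ hx hy =>
    intro z hz
    push_cast
    rw [add_mul]
    exact Z.add_mem (hx z hz) (hy z hz)
  | mul x y _ _ hx hy =>
    intro z hz
    push_cast
    rw [mul_assoc]
    exact hx _ (hy z hz)

theorem NZ_add (z w c d : K) : NZ (z + w) c d = NZ z c d * NZ w c d := by
  apply SS.ext <;> simp only [SS.m00, SS.m01, SS.m10, SS.m11, n00, n01, n10, n11] <;> ring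
theorem NZ_zero (c d : K) : NZ 0 c d = 1 := by
  apply SS.ext <;> simp only [SS.o00, SS.o01, SS.o10, SS.o11, n00, n01, n10, n11] <;> ring
theorem NZ_neg (z c d : K) : NZ (-z) c d = (NZ z c d)⁻¹ := by
  rw [eq_inv_iff_mul_eq_one, ← NZ_add, neg_add_cancel, NZ_zero]

/-- the additive group of `z` with `NZ z c d ∈ H` -/
def ZS (H : Subgroup (SS K)) (c d : K) : AddSubgroup K where
  carrier := {z | NZ z c d ∈ H}
  zero_mem' := by
    change NZ 0 c d ∈ H
    rw [NZ_zero]; exact one_mem _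
  add_mem' := by
    intro a b ha hb
    change NZ (a + b) c d ∈ H
    rw [NZ_add]; exact mul_mem ha hb
  neg_mem' := by
    intro a ha
    change NZ (-a) c d ∈ H
    rw [NZ_neg]; exact inv_mem ha

theorem mem_ZS {H : Subgroup (SS K)} {c d z : K} : z ∈ ZS H c d ↔ NZ z c d ∈ H := Iff.rfl

theorem NZ_c0 (z d : K) : NZ z 0 d = E12 (z * d ^ 2) := by
  apply SS.ext <;> simp only [n00, n01, n10, n11, e00, e01, e10, e11] <;> ring
theorem NZ_d0 (z c : K) : NZ z c 0 = E21 (-z * c ^ 2) := by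
  apply SS.ext <;> simp only [n00, n01, n10, n11, f00, f01, f10, f11] <;> ring

theorem T_id1 (t : Kˣ) (c d : K) (hc : c ≠ 0) (hd : d ≠ 0) :
    (hh t * E21 ((1 - (t : K) ^ 2) * (c / d))) *
    (hh t * E12 (((t : K)⁻¹ ^ 2) * (((t : K) ^ 2 - 1) * (d / c)))) =
    NZ (((t : K) ^ 2 - 1) / (c * d)) c d := by
  have := tne t
  apply SS.ext <;> simp only [SS.m00, SS.m01, SS.m10, SS.m11,
    h00, h01, h10, h11, e00, e01, e10, e11, f00, f01, f10, f11, n00, n01, n10, n11] <;>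
    field_simp <;> ring
theorem T_id2 (t : Kˣ) (c d : K) (hd : d ≠ 0) (z : K) :
    (hh t * E21 ((1 - (t : K) ^ 2) * (c / d))) * NZ z c d *
    (hh t * E21 ((1 - (t : K) ^ 2) * (c / d)))⁻¹ =
    NZ ((t : K) ^ 2 * z) c d := by
  have := tne t
  apply SS.ext <;> simp only [SS.m00, SS.m01, SS.m10, SS.m11, SS.i00, SS.i01, SS.i10, SS.i11,
    h00, h01, h10, h11, f00, f01, f10, f11, n00, n01, n10, n11] <;>
    field_simp <;> ring

theorem span_nat_ne {n : ℕ} (hn : 0 < n) : (Ideal.span {(n : 𝓞 K)}) ≠ 0 := by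
  rw [Ne, Ideal.zero_eq_bot, Ideal.span_singleton_eq_bot]
  exact_mod_cast hn.ne'

theorem isCoprime_unit (u : (𝓞 K)ˣ) (I : Ideal (𝓞 K)) : IsCoprime (Ideal.span {(u : 𝓞 K)}) I := by
  rw [Ideal.span_singleton_eq_top.2 u.isUnit, ← Ideal.one_eq_top]
  exact isCoprime_one_left

theorem unit_pow_dv (u : (𝓞 K)ˣ) {M : ℕ} (hM : 0 < M) :
    ∃ k : ℕ, 0 < k ∧ Dv M ((((u ^ k : (𝓞 K)ˣ) : 𝓞 K) : K) - 1) := by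
  obtain ⟨k, hk, h⟩ := coprime_unit_pow (K := K) (span_nat_ne hM)
  refine ⟨k, hk, ?_⟩
  have := h u (isCoprime_unit u _)
  obtain ⟨y, hy⟩ := Ideal.mem_span_singleton.1 this
  refine ⟨y, ?_⟩
  have h2 : (((u : 𝓞 K) ^ k - 1 : 𝓞 K) : K) = ((M * y : 𝓞 K) : K) := by rw [hy]
  push_cast at h2 ⊢
  exact h2

theorem lemT (hdeg : 1 < Module.finrank ℚ K) (hreal : Nonempty (K →+* ℝ)) (c d : K) (n : ℕ)
    (hn : 0 < n) : ∃ m : ℕ, 0 < m ∧ ∀ z : K, Dv m z → NZ z c d ∈ EE K n := by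
  by_cases hc : c = 0
  · subst hc
    obtain ⟨m, hm, -, h⟩ := exists_den' n hn (d ^ 2)
    refine ⟨m, hm, ?_⟩
    rintro z ⟨y, rfl⟩
    rw [NZ_c0]
    apply E12_mem
    have e : (m : K) * y * d ^ 2 = m * d ^ 2 * y := by ring
    rw [e]; exact h.mul_int (Dv.of_int y)
  by_cases hd : d = 0
  · subst hd
    obtain ⟨m, hm, -, h⟩ := exists_den' n hn (c ^ 2)
    refine ⟨m, hm, ?_⟩
    rintro z ⟨y, rfl⟩
    rw [NZ_d0]
    apply E21_mem
    have e : -((m : K) * y) * c ^ 2 = -(m * c ^ 2 * y) := by ring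
    rw [e]; exact (h.mul_int (Dv.of_int y)).neg
  obtain ⟨m1, hm1, -, h1⟩ := exists_den' n hn (c / d)
  obtain ⟨m2, hm2, -, h2⟩ := exists_den' n hn (d / c)
  have hM : 0 < n ^ 2 * m1 * m2 := by positivity
  obtain ⟨ε, hε⟩ := unit_lemma hdeg hreal
  obtain ⟨k, hk, hkM⟩ := unit_pow_dv ε hM
  obtain ⟨hne, f, hf, hadj⟩ := hε (k * 2) (by positivity)
  set t : Kˣ := uK K (ε ^ k) with ht
  have htv : (t : K) = (((ε ^ k : (𝓞 K)ˣ) : 𝓞 K) : K) := rfl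
  have hti : Dv 1 (t : K)⁻¹ := by rw [ht, uK_inv]; exact Dv.of_int _
  have ht1 : Dv 1 (t : K) := Dv.of_int _
  have htsq : Dv (n ^ 2 * m1 * m2) ((t : K) ^ 2 - 1) := by
    have e : (t : K) ^ 2 - 1 = (t - 1) * (t + 1) := by ring
    rw [e, htv]
    exact hkM.mul_int (ht1.add Dv.one)
  have hhmem : hh t ∈ EE K n := hh_mem _ (hkM.mono ⟨m1 * m2, by ring⟩)
  have hx1 : Dv n ((1 - (t : K) ^ 2) * (c / d)) := by
    obtain ⟨y, hy⟩ := htsq.mono (show m1 ∣ _ from ⟨n ^ 2 * m2, by ring⟩)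
    have e : (1 - (t : K) ^ 2) * (c / d) = -(m1 * (c / d) * y) := by
      linear_combination (-(c / d)) * hy
    rw [e]; exact (h1.mul_int (Dv.of_int y)).neg
  have hx2 : Dv n (((t : K)⁻¹ ^ 2) * (((t : K) ^ 2 - 1) * (d / c))) := by
    obtain ⟨y, hy⟩ := htsq.mono (show m2 ∣ _ from ⟨n ^ 2 * m1, by ring⟩)
    have e : ((t : K) ^ 2 - 1) * (d / c) = m2 * (d / c) * y := by
      linear_combination ((d / c)) * hy
    rw [e, sq]; exact (hti.int_mul hti).int_mul (h2.mul_int (Dv.of_int y))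
  have hW1 := mul_mem hhmem (E21_mem hx1)
  have hW2 := mul_mem hhmem (E12_mem hx2)
  have hz0 : ((t : K) ^ 2 - 1) / (c * d) ∈ ZS (EE K n) c d := by
    rw [mem_ZS, ← T_id1 t c d hc hd]
    exact mul_mem hW1 hW2
  have hst : ∀ z ∈ ZS (EE K n) c d, (((ε ^ (k * 2) : (𝓞 K)ˣ) : 𝓞 K) : K) * z ∈ ZS (EE K n) c d := by
    intro z hz
    have e : (((ε ^ (k * 2) : (𝓞 K)ˣ) : 𝓞 K) : K) = (t : K) ^ 2 := by
      rw [htv, pow_mul]; push_cast; rfl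
    rw [e, mem_ZS, ← T_id2 t c d hd]
    exact mul_mem (mul_mem hW1 hz) (inv_mem hW1)
  set z0 := ((t : K) ^ 2 - 1) / (c * d) with hz0d
  have hz0ne : z0 ≠ 0 := by
    rw [hz0d]
    refine div_ne_zero ?_ (mul_ne_zero hc hd)
    intro h
    apply hne
    have e : (((ε ^ (k * 2) : (𝓞 K)ˣ) : 𝓞 K) : K) = 1 := by
      have : (((ε ^ (k * 2) : (𝓞 K)ˣ) : 𝓞 K) : K) = (t : K) ^ 2 := by
        rw [htv, pow_mul]; push_cast; rfl
      rw [this]; linear_combination h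
    ext; rw [e]; simp
  have hfne : (f : K) ≠ 0 := by exact_mod_cast hf.ne'
  obtain ⟨m, hm, w, hw⟩ := exists_den (1 / (f * z0))
  refine ⟨m, hm, ?_⟩
  rintro z ⟨y, rfl⟩
  rw [← mem_ZS]
  have := stab_adjoin hst (hadj (w * y)) _ hz0
  convert this using 1
  push_cast at hw ⊢
  have : (m : K) = w * (f * z0) := by field_simp at hw; linear_combination hw
  rw [this]; ring

theorem lemT' (hdeg : 1 < Module.finrank ℚ K) (hreal : Nonempty (K →+* ℝ)) (u : SS K) (n : ℕ)
    (hn : 0 < n) : ∃ m : ℕ, 0 < m ∧ ∀ e ∈ EE K m, u * e * u⁻¹ ∈ EE K n := by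
  obtain ⟨m1, hm1, h1⟩ := lemT hdeg hreal (u⁻¹ 1 0) (u⁻¹ 1 1) n hn
  obtain ⟨m2, hm2, h2⟩ := lemT hdeg hreal (u⁻¹ 0 0) (u⁻¹ 0 1) n hn
  refine ⟨m1 * m2, Nat.mul_pos hm1 hm2, fun e he => ?_⟩
  refine EE_conj u (fun x hx => ?_) (fun x hx => ?_) he
  · have := NZ_E12 u⁻¹ x
    rw [inv_inv] at this
    rw [this]
    exact h1 x (hx.mono (Dvd.intro _ rfl))
  · have := NZ_E21 u⁻¹ x
    rw [inv_inv] at this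
    rw [this]
    exact h2 _ (hx.mono (Dvd.intro_left _ rfl)).neg

theorem lemTG (u : SS K) (n : ℕ)
    (hn : 0 < n) : ∃ m : ℕ, 0 < m ∧ ∀ g ∈ GN K m, u * g * u⁻¹ ∈ GN K n := by
  obtain ⟨q1, hq1, h1⟩ := exists_den (u 0 0)
  obtain ⟨q2, hq2, h2⟩ := exists_den (u 0 1)
  obtain ⟨q3, hq3, h3⟩ := exists_den (u 1 0)
  obtain ⟨q4, hq4, h4⟩ := exists_den (u 1 1)
  obtain ⟨q, hq, k1, k2, k3, k4⟩ : ∃ q : ℕ, 0 < q ∧ Dv 1 ((q : K) * u 0 0) ∧ Dv 1 ((q : K) * u 0 1) ∧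
      Dv 1 ((q : K) * u 1 0) ∧ Dv 1 ((q : K) * u 1 1) := by
    refine ⟨q1 * q2 * q3 * q4, by positivity, ?_, ?_, ?_, ?_⟩
    · have := (Dv.of_int ((q2 * q3 * q4 : ℕ) : 𝓞 K)).int_mul h1
      convert this using 1; push_cast; ring
    · have := (Dv.of_int ((q1 * q3 * q4 : ℕ) : 𝓞 K)).int_mul h2
      convert this using 1; push_cast; ring
    · have := (Dv.of_int ((q1 * q2 * q4 : ℕ) : 𝓞 K)).int_mul h3
      convert this using 1; push_cast; ring
    · have := (Dv.of_int ((q1 * q2 * q3 : ℕ) : 𝓞 K)).int_mul h4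
      convert this using 1; push_cast; ring
  refine ⟨q ^ 2 * n ^ 2, by positivity, ?_⟩
  rintro g ⟨g1, g2, g3, g4⟩
  have hd : q ^ 2 * n ^ 2 ∣ (q ^ 2 * n ^ 2) ^ 2 := dvd_pow_self _ two_ne_zero
  replace g3 := g3.mono hd
  replace g4 := g4.mono hd
  have key : ∀ x y z : K, Dv 1 (q * x) → Dv 1 (q * y) → Dv (q ^ 2 * n ^ 2) z →
      Dv (n ^ 2) (x * z * y) := by
    rintro x y _ hx hy ⟨z, rfl⟩
    have h3 := (hx.int_mul (Dv.nat (K := K) (n ^ 2) z)).mul_int hy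
    convert h3 using 1
    push_cast; ring
  have hn1 : n ∣ n ^ 2 := dvd_pow_self _ two_ne_zero
  have hdet := u.det
  rw [mem_GN]
  simp only [SS.m00, SS.m01, SS.m10, SS.m11, SS.i00, SS.i01, SS.i10, SS.i11]
  refine ⟨Dv.mono hn1 ?_, Dv.mono hn1 ?_, ?_, ?_⟩
  · convert (((key _ _ _ k1 k2 g3).neg.add (key _ _ _ k1 k1 g1)).sub (key _ _ _ k2 k2 g2)).add
      (key _ _ _ k2 k1 g4) using 1
    ring
  · convert (((key _ _ _ k3 k4 g3).sub (key _ _ _ k3 k3 g1)).add (key _ _ _ k4 k4 g2)).sub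
      (key _ _ _ k4 k3 g4) using 1
    ring
  · convert (((key _ _ _ k1 k4 g3).sub (key _ _ _ k1 k3 g1)).add (key _ _ _ k2 k4 g2)).sub
      (key _ _ _ k2 k3 g4) using 1
    linear_combination hdet
  · convert (((key _ _ _ k3 k2 g3).neg.add (key _ _ _ k3 k1 g1)).sub (key _ _ _ k4 k2 g2)).add
      (key _ _ _ k4 k1 g4) using 1
    linear_combination hdet

end lemT
end VL

namespace VL
open NumberField InfinitePlace

section lemL2
variable {K : Type*} [Field K] [NumberField K]

/-- the conclusion of `star1` -/
def S1P (K : Type*) [Field K] [NumberField K] (k : ℕ) : Prop :=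
    ∀ (D : Ideal (𝓞 K)) (b : 𝓞 K), D ≠ 0 → IsCoprime (Ideal.span {b}) D →
    ∀ J : AddSubgroup ℤ, (∀ b' : 𝓞 K, b' ≠ 0 → b' - b ∈ D → ∀ e : ℕ,
      (∀ x : 𝓞 K, IsCoprime x b' → b' ∣ x ^ e - 1) → (e : ℤ) ∈ J) → (k : ℤ) ∈ J

theorem GN_ent {n : ℕ} {A : SS K} (hA : A ∈ GN K n) : ∃ a b c d : 𝓞 K, A 0 0 = a ∧
    A 0 1 = n * (b : K) ∧ A 1 0 = n * (c : K) ∧ A 1 1 = d ∧ (∃ d' : 𝓞 K, d = 1 + (n : 𝓞 K) ^ 2 * d') ∧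
    a * d - (n : 𝓞 K) ^ 2 * b * c = 1 := by
  obtain ⟨⟨b, hb⟩, ⟨c, hc⟩, ⟨a, ha⟩, ⟨d, hd⟩⟩ := hA
  refine ⟨1 + (n : 𝓞 K) ^ 2 * a, b, c, 1 + (n : 𝓞 K) ^ 2 * d, ?_, hb, hc, ?_, ⟨d, rfl⟩, ?_⟩
  · push_cast at ha ⊢; linear_combination ha
  · push_cast at hd ⊢; linear_combination hd
  · have h := A.det
    rw [hb, hc, sub_eq_iff_eq_add.1 ha, sub_eq_iff_eq_add.1 hd] at h
    apply RingOfIntegers.ext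
    push_cast at h ⊢
    linear_combination h

/-- membership condition -/
def PB (A : SS K) (n : ℕ) (τ : K) (u : (𝓞 K)ˣ) : Prop :=
  A⁻¹ * (E12 τ * hh (uK K u)) * A * (hh (uK K u))⁻¹ ∈ EE K n

theorem hE (t : Kˣ) (x : K) : hh t * E12 x = E12 (t ^ 2 * x) * hh t := by
  rw [← hh_E12]; group

theorem PB_mul {A : SS K} {n : ℕ} {τ₁ τ₂ : K} {u₁ u₂ : (𝓞 K)ˣ} (h1 : PB A n τ₁ u₁)
    (h2 : PB A n τ₂ u₂) : PB A n (τ₁ + (((u₁ : 𝓞 K)) : K) ^ 2 * τ₂) (u₁ * u₂) := by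
  unfold PB at *
  have h3 := mul_mem h1 (hh_EE u₁ h2)
  convert h3 using 1
  rw [map_mul, hh_mul, E12_add, ← uK_val]
  have := hE (uK K u₁) τ₂
  have e : E12 τ₁ * E12 ((uK K u₁ : K) ^ 2 * τ₂) * (hh (uK K u₁) * hh (uK K u₂)) =
    E12 τ₁ * (hh (uK K u₁) * E12 τ₂) * hh (uK K u₂) := by
    rw [this]; simp only [mul_assoc]
  rw [e]
  group

theorem PB_inv {A : SS K} {n : ℕ} {τ : K} {u : (𝓞 K)ˣ} (h1 : PB A n τ u) :
    PB A n (-((((u⁻¹ : (𝓞 K)ˣ) : 𝓞 K)) : K) ^ 2 * τ) u⁻¹ := by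
  unfold PB at *
  have h3 := hh_EE u⁻¹ (inv_mem h1)
  convert h3 using 1
  have e : E12 (-((((u⁻¹ : (𝓞 K)ˣ) : 𝓞 K)) : K) ^ 2 * τ) * hh (uK K u⁻¹) =
    hh (uK K u⁻¹) * E12 (-τ) := by
    rw [hE, uK_val]; congr 2; ring
  rw [e, map_inv, hh_inv, E12_neg]
  group

theorem PB_one {A : SS K} {n : ℕ} {z : K} :
    PB A n z 1 ↔ z ∈ ZS (EE K n) (A 1 0) (A 1 1) := by
  rw [mem_ZS, ← NZ_E12, PB, map_one, hh_one]; simp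

theorem u_mul_inv (u : (𝓞 K)ˣ) : ((u : 𝓞 K) : K) * (((u⁻¹ : (𝓞 K)ˣ) : 𝓞 K) : K) = 1 := by
  rw [← uK_val, ← uK_inv, mul_inv_cancel₀ (tne _)]

theorem PB_stab {A : SS K} {n : ℕ} {τ z : K} {u : (𝓞 K)ˣ} (h1 : PB A n τ u) (h2 : PB A n z 1) :
    PB A n (((u : 𝓞 K) : K) ^ 2 * z) 1 := by
  have := PB_mul (PB_mul h1 h2) (PB_inv h1)
  have hu := u_mul_inv u
  rw [mul_one, mul_inv_cancel] at this
  convert this using 1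
  linear_combination (τ * (((u : 𝓞 K) : K) * (((u⁻¹ : (𝓞 K)ˣ) : 𝓞 K) : K)) + τ) * hu

theorem PB_comm {A : SS K} {n : ℕ} {τ₁ τ₂ : K} {u₁ u₂ : (𝓞 K)ˣ} (h1 : PB A n τ₁ u₁)
    (h2 : PB A n τ₂ u₂) :
    PB A n ((((u₁ : 𝓞 K) : K) ^ 2 - 1) * τ₂ - (((u₂ : 𝓞 K) : K) ^ 2 - 1) * τ₁) 1 := by
  have := PB_mul (PB_mul h1 h2) (PB_inv (PB_mul h2 h1))
  have hu := u_mul_inv (u₁ * u₂)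
  rw [mul_comm u₂ u₁, mul_inv_cancel] at this
  convert this using 1
  generalize ((((u₁ * u₂)⁻¹ : (𝓞 K)ˣ) : 𝓞 K) : K) = w at hu
  push_cast at hu ⊢
  linear_combination (τ₂ + ((u₂ : 𝓞 K) : K) ^ 2 * τ₁) * 
    (((u₁ : 𝓞 K) : K) * ((u₂ : 𝓞 K) : K) * w + 1) * hu

theorem L2_id (A : SS K) (t : Kˣ) (hd : A 1 1 ≠ 0) :
    E12 (-(((t : K) ^ 2 - 1) * (A 0 1 / A 1 1))) * hh t * A * (hh t)⁻¹ =
    A * E21 (((t : K)⁻¹ ^ 2 - 1) * (A 1 0 / A 1 1)) := by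
  have ht := tne t
  have h := A.det
  have ha : A 0 0 = (1 + A 0 1 * A 1 0) / A 1 1 := by
    field_simp; linear_combination h
  apply SS.ext <;> simp only [SS.m00, SS.m01, SS.m10, SS.m11, SS.i00, SS.i01, SS.i10, SS.i11,
    h00, h01, h10, h11, e00, e01, e10, e11, f00, f01, f10, f11]
  · rw [ha]; field_simp; ring
  · field_simp; ring
  · field_simp; ring
  · field_simp; ring

theorem PB_basic {n : ℕ} {A : SS K} {a b c d : 𝓞 K} (h00 : A 0 0 = a) (h01 : A 0 1 = n * (b : K))
    (h10 : A 1 0 = n * (c : K)) (h11 : A 1 1 = d) (x : 𝓞 K)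
    (hne : d + (n : 𝓞 K) ^ 2 * c * x ≠ 0) (u : (𝓞 K)ˣ)
    (hu : d + (n : 𝓞 K) ^ 2 * c * x ∣ (u : 𝓞 K) - 1) :
    PB A n (-((((u : 𝓞 K) : K) ^ 2 - 1) * ((n * (b : K) + a * (n * x)) /
      ((d + (n : 𝓞 K) ^ 2 * c * x : 𝓞 K) : K)))) u ∧
    Dv n (-((((u : 𝓞 K) : K) ^ 2 - 1) * ((n * (b : K) + a * (n * x)) /
      ((d + (n : 𝓞 K) ^ 2 * c * x : 𝓞 K) : K)))) := by
  have hne' : ((d + (n : 𝓞 K) ^ 2 * c * x : 𝓞 K) : K) ≠ 0 := by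
    rw [Ne, RingOfIntegers.coe_eq_zero_iff]; exact hne
  set δ := d + (n : 𝓞 K) ^ 2 * c * x with hδ
  obtain ⟨q, hq⟩ := hu
  have hq' : ((u : 𝓞 K) : K) - 1 = δ * q := by
    rw [← map_mul, ← hq]; simp
  set x' : K := n * (x : K) with hx'
  set A' := A * E12 x' with hA'
  have r00 : A' 0 0 = a := by rw [hA', SS.m00, e00, e10, h00]; ring
  have r01 : A' 0 1 = n * (b : K) + a * (n * x) := by rw [hA', SS.m01, e01, e11, h00, h01]; ring
  have r10 : A' 1 0 = n * (c : K) := by rw [hA', SS.m10, e00, e10, h10]; ring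
  have r11 : A' 1 1 = δ := by
    rw [hA', SS.m11, e01, e11, h10, h11, hδ]; push_cast; ring
  have hid := L2_id A' (uK K u) (by rw [r11]; exact hne')
  rw [r01, r10, r11, uK_inv, uK_val] at hid
  have hui := u_mul_inv u
  constructor
  · generalize -((((u : 𝓞 K) : K) ^ 2 - 1) * ((n * (b : K) + a * (n * x)) / (δ : K))) = τ at hid ⊢
    unfold PB
    have hy : Dv n (((((u⁻¹ : (𝓞 K)ˣ) : 𝓞 K) : K) ^ 2 - 1) * (n * (c : K) / δ)) := by
      generalize (((u⁻¹ : (𝓞 K)ˣ) : 𝓞 K)) = w at hui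
      refine ⟨-(w * c * q * (w + 1)), ?_⟩
      push_cast
      field_simp
      linear_combination n * (c : K) * (w + 1) * (hui - w * hq')
    have hx : Dv n x' := ⟨x, rfl⟩
    have h1 := mul_mem (mul_mem (E12_mem hx) (E21_mem hy)) (hh_EE u (inv_mem (E12_mem hx)))
    convert h1 using 1
    have e : A' * (E21 (((((u⁻¹ : (𝓞 K)ˣ) : 𝓞 K) : K) ^ 2 - 1) * (n * (c : K) / δ))) *
      (hh (uK K u) * (E12 x')⁻¹ * (hh (uK K u))⁻¹) = E12 τ * hh (uK K u) * A * (hh (uK K u))⁻¹ := by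
      rw [← hid, hA']; group
    have e3 : A⁻¹ * (E12 τ * hh (uK K u)) * A * (hh (uK K u))⁻¹ =
      A⁻¹ * (E12 τ * hh (uK K u) * A * (hh (uK K u))⁻¹) := by group
    rw [e3, ← e, hA']
    group
  · refine ⟨-((q * ((u : 𝓞 K) + 1)) * (b + a * x)), ?_⟩
    push_cast
    field_simp
    linear_combination (-n * (((u : 𝓞 K) : K) + 1) * (b + a * x)) * hq'

theorem lemL2' {k : ℕ} (hk : S1P K k) {n : ℕ} (hn : 0 < n) {A : SS K} (hA : A ∈ GN K n)
    (hc : A 1 0 ≠ 0) (u : (𝓞 K)ˣ) : ∃ τ : K, Dv n τ ∧ PB A n τ (u ^ k) := by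
  obtain ⟨a, b, c, d, h00, h01, h10, h11, ⟨d', hd'⟩, hdet⟩ := GN_ent hA
  have hc0 : c ≠ 0 := by rintro rfl; apply hc; rw [h10]; simp
  have hn0 : (n : 𝓞 K) ≠ 0 := by exact_mod_cast hn.ne'
  let J : AddSubgroup ℤ :=
    { carrier := {j | ∃ τ : K, Dv n τ ∧ PB A n τ (u ^ j)}
      zero_mem' := ⟨0, Dv.zero _, by
        rw [zpow_zero, PB_one]; exact zero_mem _⟩
      add_mem' := by
        rintro i j ⟨τ₁, t1, h1⟩ ⟨τ₂, t2, h2⟩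
        refine ⟨_, ?_, by rw [zpow_add]; exact PB_mul h1 h2⟩
        refine t1.add (Dv.int_mul ?_ t2)
        rw [sq]; exact (Dv.of_int _).int_mul (Dv.of_int _)
      neg_mem' := by
        rintro i ⟨τ₁, t1, h1⟩
        refine ⟨_, ?_, by rw [zpow_neg]; exact PB_inv h1⟩
        refine (Dv.int_mul ?_ t1)
        rw [sq]; exact ((Dv.of_int _).int_mul (Dv.of_int _)).neg }
  have hkJ : (k : ℤ) ∈ J := by
    refine hk (Ideal.span {(n : 𝓞 K) ^ 2 * c}) d ?_ ?_ J ?_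
    · rw [Ne, Ideal.zero_eq_bot, Ideal.span_singleton_eq_bot]
      exact mul_ne_zero (pow_ne_zero _ hn0) hc0
    · rw [Ideal.isCoprime_span_singleton_iff]
      exact ⟨a, -b, by linear_combination hdet⟩
    · intro b' hb' hmem e he
      obtain ⟨x, hx⟩ := Ideal.mem_span_singleton.1 hmem
      have hb'e : b' = d + (n : 𝓞 K) ^ 2 * c * x := by linear_combination hx
      subst hb'e
      have h1 := he u (by
        refine ⟨((u⁻¹ : (𝓞 K)ˣ) : 𝓞 K), 0, by simp⟩)
      obtain ⟨h2, h3⟩ := PB_basic h00 h01 h10 h11 x hb' (u ^ e) (by simpa using h1)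
      exact ⟨_, h3, by rw [zpow_natCast]; exact h2⟩
  obtain ⟨τ, h1, h2⟩ := hkJ
  exact ⟨τ, h1, by simpa using h2⟩

theorem lemL2 {k : ℕ} (hk : S1P K k) {n : ℕ} (hn : 0 < n) {A : SS K} (hA : A ∈ GN K n)
    (u : (𝓞 K)ˣ) : A⁻¹ * hh (uK K (u ^ k)) * A * (hh (uK K (u ^ k)))⁻¹ ∈ EP K n := by
  have main : ∀ A : SS K, A ∈ GN K n → A 1 0 ≠ 0 →
      A⁻¹ * hh (uK K (u ^ k)) * A * (hh (uK K (u ^ k)))⁻¹ ∈ EP K n := by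
    intro A hA hc
    obtain ⟨τ, h1, h2⟩ := lemL2' hk hn hA hc u
    have h3 := EP_conj_mem (inv_mem hA) (inv_mem (E12_mem h1))
    have h4 := mul_mem h3 (EE_le_EP n h2)
    convert h4 using 1
    group
  by_cases hc : A 1 0 = 0
  · have hn' : E21 (n : K) ∈ EE K n := E21_mem (Dv.self n)
    have hA' := mul_mem hA (EE_le_GN n hn')
    have h0 : A 1 1 ≠ 0 := by
      intro h; have := A.det; rw [hc, h] at this; simp at this
    have h1 := main _ hA' (by
      rw [SS.m10, f00, f10, hc, zero_mul, zero_add]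
      exact mul_ne_zero h0 (by exact_mod_cast hn.ne'))
    have h2 := mul_mem (mul_mem (EE_le_EP n hn') h1) (EE_le_EP n (hh_EE (u ^ k) (inv_mem hn')))
    convert h2 using 1
    group
  · exact main A hA hc

end lemL2
end VL

namespace VL
open NumberField InfinitePlace

section lemN
variable {K : Type*} [Field K] [NumberField K]

theorem quot_lemma {l : Ideal (𝓞 K)} (hl : l.IsMaximal) {v : ℕ} {a b : 𝓞 K} (ha : a ∉ l ^ (v + 1))
    (hb : b ∈ l ^ v) : ∃ y, y ∉ l ∧ a ∣ y * b := by
  have ha0 : a ≠ 0 := by rintro rfl; exact ha (Ideal.zero_mem _)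
  have hl0 : l ≠ ⊥ := Ring.ne_bot_of_isMaximal_of_not_isField hl (RingOfIntegers.not_isField K)
  have hp : Prime l := Ideal.prime_of_isPrime hl0 hl.isPrime
  have hs : Ideal.span {a} ≠ 0 := by
    rw [Ne, Ideal.zero_eq_bot, Ideal.span_singleton_eq_bot]; exact ha0
  obtain ⟨u, I, hI, he⟩ := WfDvdMonoid.max_power_factor hs hp.irreducible
  have huv : u ≤ v := by
    by_contra hcon
    apply ha
    have h1 : a ∈ Ideal.span {a} := Ideal.mem_span_singleton_self a
    rw [he] at h1
    have h2 : l ^ u * I ≤ l ^ u := Ideal.mul_le_left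
    have h3 : l ^ u ≤ l ^ (v + 1) := Ideal.pow_le_pow_right (by omega)
    exact h3 (h2 h1)
  have hle : ¬ I ≤ l := by
    rwa [← Ideal.dvd_iff_le]
  obtain ⟨y, hyI, hyl⟩ := Set.not_subset.1 hle
  refine ⟨y, hyl, ?_⟩
  rw [← Ideal.mem_span_singleton, he, mul_comm]
  have h3 : l ^ v ≤ l ^ u := Ideal.pow_le_pow_right huv
  exact Ideal.mul_mem_mul hyI (h3 hb)

theorem val_exists {l : Ideal (𝓞 K)} (hl : l.IsMaximal) {s : 𝓞 K} (hs : s ≠ 0) :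
    ∃ v : ℕ, s ∈ l ^ v ∧ s ∉ l ^ (v + 1) := by
  have hl0 : l ≠ ⊥ := Ring.ne_bot_of_isMaximal_of_not_isField hl (RingOfIntegers.not_isField K)
  have hp : Prime l := Ideal.prime_of_isPrime hl0 hl.isPrime
  have hs' : Ideal.span {s} ≠ 0 := by
    rw [Ne, Ideal.zero_eq_bot, Ideal.span_singleton_eq_bot]; exact hs
  obtain ⟨u, I, hI, he⟩ := WfDvdMonoid.max_power_factor hs' hp.irreducible
  refine ⟨u, ?_, ?_⟩
  · have h1 : s ∈ Ideal.span {s} := Ideal.mem_span_singleton_self s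
    rw [he] at h1
    have h2 : l ^ u * I ≤ l ^ u := Ideal.mul_le_left
    exact h2 h1
  · intro h
    have h2 : Ideal.span {s} ≤ l ^ (u + 1) := by
      rwa [Ideal.span_singleton_le_iff_mem]
    rw [← Ideal.dvd_iff_le, he, pow_succ] at h2
    exact hI ((mul_dvd_mul_iff_left (pow_ne_zero u hp.ne_zero)).1 h2)

/-- exponents -/
def JI (ε : (𝓞 K)ˣ) (I : Ideal (𝓞 K)) : AddSubgroup ℤ where
  carrier := {j | ((ε ^ (j * 2) : (𝓞 K)ˣ) : 𝓞 K) - 1 ∈ I}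
  zero_mem' := by simp
  add_mem' := by
    intro i j hi hj
    change ((ε ^ ((i + j) * 2) : (𝓞 K)ˣ) : 𝓞 K) - 1 ∈ I
    rw [add_mul, zpow_add]
    have e : ((ε ^ (i * 2) * ε ^ (j * 2) : (𝓞 K)ˣ) : 𝓞 K) - 1 =
      ((ε ^ (i * 2) : (𝓞 K)ˣ) : 𝓞 K) * (((ε ^ (j * 2) : (𝓞 K)ˣ) : 𝓞 K) - 1) +
      (((ε ^ (i * 2) : (𝓞 K)ˣ) : 𝓞 K) - 1) := by push_cast; ring
    rw [e]
    exact I.add_mem (I.mul_mem_left _ hj) hi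
  neg_mem' := by
    intro i hi
    change ((ε ^ ((-i) * 2) : (𝓞 K)ˣ) : 𝓞 K) - 1 ∈ I
    rw [neg_mul, zpow_neg]
    have e : (((ε ^ (i * 2))⁻¹ : (𝓞 K)ˣ) : 𝓞 K) - 1 =
      -(((ε ^ (i * 2))⁻¹ : (𝓞 K)ˣ) : 𝓞 K) * (((ε ^ (i * 2) : (𝓞 K)ˣ) : 𝓞 K) - 1) := by
      have := (ε ^ (i * 2)).inv_mul
      linear_combination this
    rw [e]
    exact I.mul_mem_left _ hi

/-- the local step -/
theorem N_local {k : ℕ} (hk : S1P K k) {n : ℕ} (hn : 0 < n) {ε : (𝓞 K)ˣ} {A : SS K}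
    {a b c d : 𝓞 K} (h00 : A 0 0 = a) (h01 : A 0 1 = n * (b : K))
    (h10 : A 1 0 = n * (c : K)) (h11 : A 1 1 = d) (hdet : a * d - (n : 𝓞 K) ^ 2 * b * c = 1)
    (hc : c ≠ 0) {l : Ideal (𝓞 K)} (hl : l.IsMaximal) {v : ℕ}
    (hsv : ((ε ^ (k * 2) : (𝓞 K)ˣ) : 𝓞 K) - 1 ∉ l ^ (v + 1)) (y : 𝓞 K)
    (hy : d + (n : 𝓞 K) ^ 2 * c * y ∉ l) :
    ∃ (x w : 𝓞 K) (u : (𝓞 K)ˣ), x - y ∈ l ∧ d + (n : 𝓞 K) ^ 2 * c * x ≠ 0 ∧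
      d + (n : 𝓞 K) ^ 2 * c * x ∣ (u : 𝓞 K) - 1 ∧
      (u : 𝓞 K) ^ 2 - 1 = (d + (n : 𝓞 K) ^ 2 * c * x) * w ∧ w ∉ l ^ (v + 1) := by
  have hl0 : l ≠ ⊥ := Ring.ne_bot_of_isMaximal_of_not_isField hl (RingOfIntegers.not_isField K)
  have hn0 : (n : 𝓞 K) ≠ 0 := by exact_mod_cast hn.ne'
  have hkJ : (k : ℤ) ∉ JI ε (l ^ (v + 1)) := by
    intro h
    apply hsv
    have h2 : ((ε ^ ((k : ℤ) * 2) : (𝓞 K)ˣ) : 𝓞 K) - 1 ∈ l ^ (v + 1) := h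
    have e : (k : ℤ) * 2 = ((k * 2 : ℕ) : ℤ) := by push_cast; ring
    rwa [e, zpow_natCast] at h2
  by_contra hcon
  push Not at hcon
  apply hkJ
  refine hk (Ideal.span {(n : 𝓞 K) ^ 2 * c} * l) (d + (n : 𝓞 K) ^ 2 * c * y) ?_ ?_ _ ?_
  · refine mul_ne_zero ?_ hl0
    rw [Ne, Ideal.zero_eq_bot, Ideal.span_singleton_eq_bot]
    exact mul_ne_zero (pow_ne_zero _ hn0) hc
  · refine IsCoprime.mul_right ?_ ?_
    · rw [Ideal.isCoprime_span_singleton_iff]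
      exact ⟨a, -b - a * y, by linear_combination hdet⟩
    · rw [Ideal.isCoprime_iff_sup_eq, sup_comm]
      refine hl.1.2 _ (lt_of_le_of_ne le_sup_left ?_)
      intro h
      apply hy
      rw [h]
      exact Ideal.mem_sup_right (Ideal.mem_span_singleton_self _)
  · intro b' hb' hmem e he
    obtain ⟨r, hr, hx⟩ := Ideal.mem_span_singleton_mul.1 hmem
    have hb'e : b' = d + (n : 𝓞 K) ^ 2 * c * (y + r) := by linear_combination -hx
    subst hb'e
    have h1 := he ε ⟨((ε⁻¹ : (𝓞 K)ˣ) : 𝓞 K), 0, by simp⟩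
    obtain ⟨w, hw⟩ : d + (n : 𝓞 K) ^ 2 * c * (y + r) ∣ ((ε ^ e : (𝓞 K)ˣ) : 𝓞 K) ^ 2 - 1 := by
      have e2 : ((ε ^ e : (𝓞 K)ˣ) : 𝓞 K) ^ 2 - 1 = ((ε : 𝓞 K) ^ e - 1) * ((ε : 𝓞 K) ^ e + 1) := by
        push_cast; ring
      rw [e2]; exact h1.mul_right _
    have h2 := hcon (y + r) w (ε ^ e) (by simpa using hr) hb' (by simpa using h1) hw
    change ((ε ^ ((e : ℤ) * 2) : (𝓞 K)ˣ) : 𝓞 K) - 1 ∈ l ^ (v + 1)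
    have e3 : ((ε ^ ((e : ℤ) * 2) : (𝓞 K)ˣ) : 𝓞 K) - 1 = ((ε ^ e : (𝓞 K)ˣ) : 𝓞 K) ^ 2 - 1 := by
      have e4 : (e : ℤ) * 2 = ((e * 2 : ℕ) : ℤ) := by push_cast; ring
      rw [e4, zpow_natCast, pow_mul]; push_cast; rfl
    rw [e3, hw]
    exact Ideal.mul_mem_left _ _ h2

theorem N_choice {n : ℕ} (h2n : 2 ∣ n) {a b c d : 𝓞 K} (hdet : a * d - (n : 𝓞 K) ^ 2 * b * c = 1)
    {l : Ideal (𝓞 K)} (hl : l.IsMaximal) : ∃ y₁ y₂ : 𝓞 K, y₁ - y₂ ∉ l ∧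
      d + (n : 𝓞 K) ^ 2 * c * y₁ ∉ l ∧ d + (n : 𝓞 K) ^ 2 * c * y₂ ∉ l := by
  have hone : (1 : 𝓞 K) ∉ l := fun h => hl.ne_top ((Ideal.eq_top_iff_one l).2 h)
  have hp := hl.isPrime
  obtain ⟨n', rfl⟩ := h2n
  have hA : d ∈ l → (((2 * n' : ℕ) : 𝓞 K) ^ 2 * c) ∉ l := by
    intro h1 h2
    apply hone
    have e : (1 : 𝓞 K) = a * d - b * (((2 * n' : ℕ) : 𝓞 K) ^ 2 * c) := by linear_combination -hdet
    rw [e]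
    exact l.sub_mem (l.mul_mem_left _ h1) (l.mul_mem_left _ h2)
  have hB : (2 : 𝓞 K) ∈ l → (((2 * n' : ℕ) : 𝓞 K) ^ 2 * c) ∈ l := by
    intro h
    have e : (((2 * n' : ℕ) : 𝓞 K) ^ 2 * c) = (2 * n' ^ 2 * c) * 2 := by push_cast; ring
    rw [e]; exact l.mul_mem_left _ h
  set N := (((2 * n' : ℕ) : 𝓞 K) ^ 2 * c) with hN
  by_cases hd : d ∈ l
  · refine ⟨1, -1, ?_, ?_, ?_⟩
    · intro h
      apply hA hd
      apply hB
      convert h using 1; ring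
    · intro h
      apply hA hd
      have e : N = (d + N * 1) - d := by ring
      rw [e]; exact l.sub_mem h hd
    · intro h
      apply hA hd
      have e : N = d - (d + N * (-1)) := by ring
      rw [e]; exact l.sub_mem hd h
  · by_cases hd2 : d + N ∈ l
    · refine ⟨0, -1, ?_, ?_, ?_⟩
      · simpa using hone
      · simpa using hd
      · intro h
        have h2 : d * 2 ∈ l := by
          have e : d * 2 = (d + N) + (d + N * (-1)) := by ring
          rw [e]; exact l.add_mem hd2 h
        have h3 := (hp.mem_or_mem h2).resolve_left hd
        apply hd
        have e : d = (d + N) - N := by ring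
        rw [e]; exact l.sub_mem hd2 (hB h3)
    · refine ⟨1, 0, ?_, ?_, ?_⟩
      · simpa using hone
      · simpa using hd2
      · simpa using hd

theorem N_core {k : ℕ} (hk : S1P K k) {n : ℕ} (hn : 0 < n) (h2n : 2 ∣ n) {ε : (𝓞 K)ˣ} {f : ℕ}
    (hf : ∀ y : 𝓞 K, (f : 𝓞 K) * y ∈ Algebra.adjoin ℤ {((ε ^ (k * 2) : (𝓞 K)ˣ) : 𝓞 K)})
    (hne : ε ^ (k * 2) ≠ 1) {A : SS K} (hA : A ∈ GN K n) (hc : A 1 0 ≠ 0) (y : 𝓞 K) :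
    (f : K) * n * y * (((ε ^ (k * 2) : (𝓞 K)ˣ) : 𝓞 K) - 1 : 𝓞 K) ^ 2 ∈
      ZS (EE K n) (A 1 0) (A 1 1) := by
  set Q := ZS (EE K n) (A 1 0) (A 1 1) with hQ
  obtain ⟨τ, -, hτ⟩ := lemL2' hk hn hA hc ε
  have hst : ∀ z ∈ Q, (((ε ^ (k * 2) : (𝓞 K)ˣ) : 𝓞 K) : K) * z ∈ Q := by
    intro z hz
    have := PB_stab hτ (PB_one.2 hz)
    rw [PB_one] at this
    convert this using 2
    rw [pow_mul]; push_cast; rfl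
  obtain ⟨a, b, c, d, h00, h01, h10, h11, -, hdet⟩ := GN_ent hA
  have hc0 : c ≠ 0 := by rintro rfl; apply hc; rw [h10]; simp
  set s : 𝓞 K := ((ε ^ (k * 2) : (𝓞 K)ˣ) : 𝓞 K) - 1 with hs
  have hs0 : s ≠ 0 := by
    intro h
    apply hne
    ext
    rw [sub_eq_zero.1 h]; rfl
  let q : Ideal (𝓞 K) :=
    { carrier := {w | ∀ y : 𝓞 K, (f : K) * n * y * w ∈ Q}
      zero_mem' := by intro y; simp
      add_mem' := by
        intro w₁ w₂ h1 h2 y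
        push_cast
        rw [mul_add]
        exact Q.add_mem (h1 y) (h2 y)
      smul_mem' := by
        intro r w h y
        have := h (r * y)
        convert this using 1
        simp only [smul_eq_mul]; push_cast; ring }
  have hq : ∀ w : 𝓞 K, (n : K) * w ∈ Q → w ∈ q := by
    intro w hw y
    have := stab_adjoin hst (hf y) _ hw
    convert this using 1
    push_cast; ring
  suffices h : s ^ 2 ∈ q by
    have := h y
    push_cast at this ⊢
    exact this
  let R : Ideal (𝓞 K) := Submodule.comap (LinearMap.mulRight (𝓞 K) (s ^ 2)) q
  have hR : ∀ r, r ∈ R ↔ r * s ^ 2 ∈ q := fun r => Iff.rfl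
  by_contra hcon
  have hRtop : R ≠ ⊤ := by
    intro h
    apply hcon
    have := (hR 1).1 (by rw [h]; trivial)
    rwa [one_mul] at this
  obtain ⟨l, hl, hRl⟩ := Ideal.exists_le_maximal R hRtop
  have hp := hl.isPrime
  obtain ⟨v, hv1, hv2⟩ := val_exists hl hs0
  obtain ⟨y₁, y₂, hy, hy1, hy2⟩ := N_choice h2n hdet hl
  obtain ⟨x₁, w₁, u₁, hx1, hne1, hdvd1, hw1, hwl1⟩ :=
    N_local hk hn h00 h01 h10 h11 hdet hc0 hl hv2 y₁ hy1
  obtain ⟨x₂, w₂, u₂, hx2, hne2, hdvd2, hw2, hwl2⟩ :=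
    N_local hk hn h00 h01 h10 h11 hdet hc0 hl hv2 y₂ hy2
  obtain ⟨z₁, hz1, g₁, hg1⟩ := quot_lemma hl hwl1 hv1
  obtain ⟨z₂, hz2, g₂, hg2⟩ := quot_lemma hl hwl2 hv1
  have hx12 : x₁ - x₂ ∉ l := by
    intro h
    apply hy
    have e : y₁ - y₂ = (x₁ - x₂) - (x₁ - y₁) + (x₂ - y₂) := by ring
    rw [e]; exact l.add_mem (l.sub_mem h hx1) hx2
  have hPB := PB_comm (PB_basic h00 h01 h10 h11 x₁ hne1 u₁ hdvd1).1
    (PB_basic h00 h01 h10 h11 x₂ hne2 u₂ hdvd2).1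
  rw [PB_one] at hPB
  have hw : w₁ * w₂ * (x₁ - x₂) ∈ q := by
    apply hq
    convert hPB using 1
    have k1 : (((u₁ : 𝓞 K) : K)) ^ 2 - 1 = (d + (n : 𝓞 K) ^ 2 * c * x₁ : 𝓞 K) * (w₁ : K) := by
      rw [← map_mul, ← hw1]; push_cast; rfl
    have k2 : (((u₂ : 𝓞 K) : K)) ^ 2 - 1 = (d + (n : 𝓞 K) ^ 2 * c * x₂ : 𝓞 K) * (w₂ : K) := by
      rw [← map_mul, ← hw2]; push_cast; rfl
    have hne1' : ((d + (n : 𝓞 K) ^ 2 * c * x₁ : 𝓞 K) : K) ≠ 0 := by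
      rw [Ne, RingOfIntegers.coe_eq_zero_iff]; exact hne1
    have hne2' : ((d + (n : 𝓞 K) ^ 2 * c * x₂ : 𝓞 K) : K) ≠ 0 := by
      rw [Ne, RingOfIntegers.coe_eq_zero_iff]; exact hne2
    rw [k1, k2]
    have e1 : ∀ p q : K, -(((d + (n : 𝓞 K) ^ 2 * c * x₁ : 𝓞 K) : K) * p *
      (q / ((d + (n : 𝓞 K) ^ 2 * c * x₁ : 𝓞 K) : K))) = -(p * q) := by
      intro p q; field_simp
    have e2 : ∀ p q : K, -(((d + (n : 𝓞 K) ^ 2 * c * x₂ : 𝓞 K) : K) * p *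
      (q / ((d + (n : 𝓞 K) ^ 2 * c * x₂ : 𝓞 K) : K))) = -(p * q) := by
      intro p q; field_simp
    rw [e1, e2]
    have hdet' : (a : K) * d - (n : K) ^ 2 * b * c = 1 := by
      have : ((a * d - (n : 𝓞 K) ^ 2 * b * c : 𝓞 K) : K) = ((1 : 𝓞 K) : K) := by rw [hdet]
      push_cast at this; exact this
    push_cast
    linear_combination (-(n : K) * w₁ * w₂ * (x₁ - x₂)) * hdet'
  have hfin : z₁ * z₂ * (x₁ - x₂) ∈ R := by
    rw [hR]
    have e : z₁ * z₂ * (x₁ - x₂) * s ^ 2 = (g₁ * g₂) * (w₁ * w₂ * (x₁ - x₂)) := by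
      linear_combination (z₂ * s * (x₁ - x₂)) * hg1 + (w₁ * g₁ * (x₁ - x₂)) * hg2
    rw [e]
    exact q.mul_mem_left _ hw
  rcases hp.mem_or_mem (hRl hfin) with h | h
  · rcases hp.mem_or_mem h with h | h
    · exact hz1 h
    · exact hz2 h
  · exact hx12 h

theorem lemN (hdeg : 1 < Module.finrank ℚ K) (hreal : Nonempty (K →+* ℝ)) {n : ℕ} (hn : 0 < n)
    (h2n : 2 ∣ n) : ∃ m : ℕ, 0 < m ∧ n ∣ m ∧ ∀ A ∈ GN K n, ∀ e ∈ EE K m,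
      A * e * A⁻¹ ∈ EE K n := by
  obtain ⟨k, hk0, hk⟩ := star1 K
  obtain ⟨ε, hε⟩ := unit_lemma hdeg hreal
  obtain ⟨hne, f, hf0, hf⟩ := hε (k * 2) (by positivity)
  set s : 𝓞 K := ((ε ^ (k * 2) : (𝓞 K)ˣ) : 𝓞 K) - 1 with hs
  have hs0 : s ≠ 0 := by
    intro h
    apply hne
    ext
    rw [sub_eq_zero.1 h]; rfl
  have hsK : (s : K) ≠ 0 := by rw [Ne, RingOfIntegers.coe_eq_zero_iff]; exact hs0
  have hfK : (f : K) ≠ 0 := by exact_mod_cast hf0.ne'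
  have hnK : (n : K) ≠ 0 := by exact_mod_cast hn.ne'
  obtain ⟨m, hm, r, hr⟩ := exists_den (1 / ((f : K) * n * (s : K) ^ 2))
  have hmr : (m : K) = f * n * r * (s : K) ^ 2 := by
    push_cast at hr
    field_simp at hr; linear_combination hr
  have key : ∀ A ∈ GN K n, ∀ x : K, Dv (n * m) x → A⁻¹ * E12 x * A ∈ EE K n := by
    rintro A hA _ ⟨y, rfl⟩
    rw [NZ_E12]
    by_cases hc : A 1 0 = 0
    · rw [hc, NZ_c0]
      apply E12_mem
      obtain ⟨-, -, -, h4⟩ := hA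
      have h5 : Dv 1 (A 1 1) := by
        have := (h4.mono (one_dvd _)).add Dv.one
        simpa using this
      push_cast
      rw [sq, mul_assoc, mul_assoc]
      exact (Dv.self n).mul_int ((Dv.of_int (m : 𝓞 K)).int_mul
        ((Dv.of_int y).int_mul (h5.int_mul h5)))
    · have := N_core hk hn h2n hf hne hA hc (n * r * y)
      rw [mem_ZS, ← hs] at this
      convert this using 2
      push_cast at hmr ⊢
      rw [hmr]; ring
  refine ⟨n * m, Nat.mul_pos hn hm, Dvd.intro _ rfl, fun A hA e he => ?_⟩
  refine EE_conj A (fun x hx => ?_) (fun x hx => ?_) he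
  · have := key A⁻¹ (inv_mem hA) x hx
    rwa [inv_inv] at this
  · have h1 := key _ (inv_mem (ww_GN hA)) (-x) hx.neg
    have h2 := ww_EE h1
    convert h2 using 1
    have h3 : E21 x = ww K * E12 (-x) * (ww K)⁻¹ := by rw [ww_E12, neg_neg]
    rw [h3]; group

theorem lemN' (hdeg : 1 < Module.finrank ℚ K) (hreal : Nonempty (K →+* ℝ)) {n : ℕ} (hn : 0 < n) :
    ∃ m : ℕ, 0 < m ∧ n ∣ m ∧ EP K m ≤ EE K n := by
  obtain ⟨m, hm, hnm, h⟩ := lemN hdeg hreal (n := 2 * n) (by positivity) (Dvd.intro _ rfl)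
  refine ⟨m, hm, (Dvd.intro_left _ rfl : n ∣ 2 * n).trans hnm, ?_⟩
  rw [EP, Subgroup.closure_le]
  rintro _ ⟨g, hg, e, he, rfl⟩
  exact EE_mono (Dvd.intro_left _ rfl : n ∣ 2 * n) (h g (GN_mono hnm hg) e he)

end lemN
end VL

namespace VL
open NumberField InfinitePlace

section lemP
variable {K : Type*} [Field K] [NumberField K]

theorem lemTE (hdeg : 1 < Module.finrank ℚ K) (hreal : Nonempty (K →+* ℝ)) (u : SS K) {n : ℕ}
    (hn : 0 < n) : ∃ m : ℕ, 0 < m ∧ ∀ e ∈ EP K m, u * e * u⁻¹ ∈ EP K n := by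
  obtain ⟨m1, hm1, h1⟩ := lemT' hdeg hreal u n hn
  obtain ⟨m, hm, -, h2⟩ := lemN' hdeg hreal hm1
  exact ⟨m, hm, fun e he => EE_le_EP n (h1 e (h2 he))⟩

/-- near-centrality -/
def PP (u : SS K) : Prop :=
  ∀ n : ℕ, 0 < n → ∃ m : ℕ, 0 < m ∧ ∀ g ∈ GN K m, g⁻¹ * u * g * u⁻¹ ∈ EP K n

theorem PP_mul (hdeg : 1 < Module.finrank ℚ K) (hreal : Nonempty (K →+* ℝ)) {u v : SS K}
    (hu : PP u) (hv : PP v) : PP (u * v) := by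
  intro n hn
  obtain ⟨m1, hm1, h1⟩ := hu n hn
  obtain ⟨m', hm', h'⟩ := lemTE hdeg hreal u hn
  obtain ⟨m2, hm2, h2⟩ := hv m' hm'
  refine ⟨m1 * m2, Nat.mul_pos hm1 hm2, fun g hg => ?_⟩
  have k1 := h1 g (GN_mono (Dvd.intro _ rfl) hg)
  have k2 := h' _ (h2 g (GN_mono (Dvd.intro_left _ rfl) hg))
  convert mul_mem k1 k2 using 1
  group

theorem PP_inv (hdeg : 1 < Module.finrank ℚ K) (hreal : Nonempty (K →+* ℝ)) {u : SS K}
    (hu : PP u) : PP u⁻¹ := by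
  intro n hn
  obtain ⟨m', hm', h'⟩ := lemTE hdeg hreal u⁻¹ hn
  obtain ⟨m, hm, h⟩ := hu m' hm'
  refine ⟨m, hm, fun g hg => ?_⟩
  convert h' _ (inv_mem (h g hg)) using 1
  group

theorem PP_conj (hdeg : 1 < Module.finrank ℚ K) (hreal : Nonempty (K →+* ℝ)) (w : SS K) {u : SS K}
    (hu : PP u) : PP (w * u * w⁻¹) := by
  intro n hn
  obtain ⟨m', hm', h'⟩ := lemTE hdeg hreal w hn
  obtain ⟨m'', hm'', h''⟩ := hu m' hm'
  obtain ⟨m, hm, h⟩ := lemTG w⁻¹ m'' hm''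
  refine ⟨m, hm, fun g hg => ?_⟩
  convert h' _ (h'' _ (h g hg)) using 1
  group

theorem PP_hh (hdeg : 1 < Module.finrank ℚ K) (hreal : Nonempty (K →+* ℝ)) (t : Kˣ) :
    PP (hh t) := by
  obtain ⟨k, hk0, hk⟩ := star1 K
  obtain ⟨ε, hε⟩ := unit_lemma hdeg hreal
  obtain ⟨hne, -⟩ := hε (k * 2) (by positivity)
  set s : Kˣ := uK K (ε ^ k) with hs
  have hs2 : (s : K) ^ 2 - 1 ≠ 0 := by
    intro h
    apply hne
    have e : (((ε ^ (k * 2) : (𝓞 K)ˣ) : 𝓞 K) : K) = 1 := by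
      have : (((ε ^ (k * 2) : (𝓞 K)ˣ) : 𝓞 K) : K) = (s : K) ^ 2 := by
        rw [hs, uK_val, pow_mul]; push_cast; rfl
      rw [this]; linear_combination h
    ext; rw [e]; simp
  have hs0 := tne s
  have hs3 : (s : K)⁻¹ ^ 2 - 1 ≠ 0 := by
    intro h
    apply hs2
    field_simp at h
    linear_combination -h
  have h1 : PP (hh s) := fun n hn => ⟨n, hn, fun g hg => lemL2 hk hn hg ε⟩
  have h12 : ∀ x : K, PP (E12 x) := by
    intro x
    have h2 := PP_mul hdeg hreal h1 (PP_conj hdeg hreal (E12 (x / ((s : K) ^ 2 - 1)))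
      (PP_inv hdeg hreal h1))
    convert h2 using 1
    have e : hh s * (E12 (x / ((s : K) ^ 2 - 1)) * (hh s)⁻¹ * (E12 (x / ((s : K) ^ 2 - 1)))⁻¹) =
      (hh s * E12 (x / ((s : K) ^ 2 - 1)) * (hh s)⁻¹) * (E12 (x / ((s : K) ^ 2 - 1)))⁻¹ := by group
    rw [e, hh_E12, ← E12_neg, ← E12_add]
    congr 1
    field_simp
    ring
  have h21 : ∀ x : K, PP (E21 x) := by
    intro x
    have h2 := PP_mul hdeg hreal h1 (PP_conj hdeg hreal (E21 (x / ((s : K)⁻¹ ^ 2 - 1)))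
      (PP_inv hdeg hreal h1))
    convert h2 using 1
    have e : hh s * (E21 (x / ((s : K)⁻¹ ^ 2 - 1)) * (hh s)⁻¹ *
      (E21 (x / ((s : K)⁻¹ ^ 2 - 1)))⁻¹) =
      (hh s * E21 (x / ((s : K)⁻¹ ^ 2 - 1)) * (hh s)⁻¹) * (E21 (x / ((s : K)⁻¹ ^ 2 - 1)))⁻¹ := by group
    rw [e, hh_E21, ← E21_neg, ← E21_add]
    congr 1
    have : x = x / ((s : K)⁻¹ ^ 2 - 1) * ((s : K)⁻¹ ^ 2 - 1) := by
      rw [div_mul_cancel₀ _ hs3]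
    linear_combination this
  rw [hh_fact t 1 ((t : K) - 1) (by ring)]
  exact PP_mul hdeg hreal (PP_mul hdeg hreal (PP_mul hdeg hreal (h21 _) (h12 _)) (h21 _)) (h12 _)

/-- coprime shift -/
theorem coprime_shift {a b : 𝓞 K} (hab : IsCoprime a b) {I : Ideal (𝓞 K)} (hI : I ≠ 0) :
    ∃ x, IsCoprime (Ideal.span {a + b * x}) I := by
  induction I using UniqueFactorizationMonoid.induction_on_prime with
  | h₁ => exact absurd rfl hI
  | h₂ J hJ =>
    refine ⟨0, ?_⟩
    rw [Ideal.isUnit_iff.1 hJ, ← Ideal.one_eq_top]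
    exact isCoprime_one_right
  | h₃ J p hJ hp ih =>
    obtain ⟨x, hx⟩ := ih hJ
    have hpm : p.IsMaximal := (Ideal.isPrime_of_prime hp).isMaximal hp.ne_zero
    have hcop : ∀ y, y ∉ p → IsCoprime (Ideal.span {y}) p := by
      intro y hy
      rw [Ideal.isCoprime_iff_sup_eq, sup_comm]
      refine hpm.1.2 _ (lt_of_le_of_ne le_sup_left ?_)
      intro h
      apply hy
      rw [h]
      exact Ideal.mem_sup_right (Ideal.mem_span_singleton_self _)
    by_cases h : a + b * x ∈ p
    · have hone : (1 : 𝓞 K) ∉ p := fun h => hpm.ne_top ((Ideal.eq_top_iff_one p).2 h)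
      have hb : b ∉ p := by
        intro hb
        apply hone
        obtain ⟨α, β, e⟩ := hab
        have e2 : (1 : 𝓞 K) = α * (a + b * x) + (β - α * x) * b := by linear_combination -e
        rw [e2]
        exact p.add_mem (p.mul_mem_left _ h) (p.mul_mem_left _ hb)
      have hJp : ¬ J ≤ p := by
        intro hle
        obtain ⟨i, hi, j, hj, hij⟩ := Ideal.isCoprime_iff_exists.1 hx
        apply hone
        rw [← hij]
        obtain ⟨r, rfl⟩ := Ideal.mem_span_singleton'.1 hi
        exact p.add_mem (p.mul_mem_left _ h) (hle hj)
      obtain ⟨i, hiJ, hip⟩ := Set.not_subset.1 hJp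
      refine ⟨x + i, IsCoprime.mul_right (hcop _ ?_) ?_⟩
      · intro h2
        have h3 : b * i ∈ p := by
          have e : b * i = (a + b * (x + i)) - (a + b * x) := by ring
          rw [e]; exact p.sub_mem h2 h
        rcases hpm.isPrime.mem_or_mem h3 with h4 | h4
        · exact hb h4
        · exact hip h4
      · obtain ⟨i', hi', j, hj, hij⟩ := Ideal.isCoprime_iff_exists.1 hx
        obtain ⟨r, rfl⟩ := Ideal.mem_span_singleton'.1 hi'
        refine Ideal.isCoprime_iff_exists.2 ⟨r * (a + b * (x + i)), 
          Ideal.mem_span_singleton'.2 ⟨r, rfl⟩, j - r * b * i,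
          J.sub_mem hj (J.mul_mem_left _ hiJ), ?_⟩
        linear_combination hij
    · exact ⟨x, IsCoprime.mul_right (hcop _ h) hx⟩

end lemP
end VL

namespace VL
open NumberField InfinitePlace

section symb
variable {K : Type*} [Field K] [NumberField K]

/-- normal subgroup -/
def NEP (K : Type*) [Field K] [NumberField K] (n : ℕ) : Subgroup (GN K n) :=
  (EP K n).subgroupOf (GN K n)

instance NEP_normal (n : ℕ) : (NEP K n).Normal := by
  constructor
  intro e he g
  rw [NEP, Subgroup.mem_subgroupOf] at *
  exact EP_normal g.2 he

/-- quotient -/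
abbrev QQ (K : Type*) [Field K] [NumberField K] (n : ℕ) := GN K n ⧸ NEP K n

theorem QQ_eq {n : ℕ} (A B : GN K n) (e : SS K) (he : e ∈ EP K n) (h : (B : SS K) = A * e) :
    (QuotientGroup.mk B : QQ K n) = QuotientGroup.mk A := by
  symm
  rw [QuotientGroup.eq, NEP, Subgroup.mem_subgroupOf]
  have : ((A⁻¹ * B : GN K n) : SS K) = e := by
    push_cast
    rw [h]; group
  rwa [this]

theorem QQ_eq' {n : ℕ} (A B : GN K n) (e : SS K) (he : e ∈ EP K n) (h : (B : SS K) = e * A) :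
    (QuotientGroup.mk B : QQ K n) = QuotientGroup.mk A := by
  refine QQ_eq A B ((A : SS K)⁻¹ * e * A) ?_ (by rw [h]; group)
  have := EP_normal (inv_mem A.2) he
  rwa [inv_inv] at this

theorem QQ_row {n : ℕ} (A B : GN K n) (h0 : (A : SS K) 1 0 = (B : SS K) 1 0)
    (h1 : (A : SS K) 1 1 = (B : SS K) 1 1) :
    (QuotientGroup.mk A : QQ K n) = QuotientGroup.mk B := by
  have hA := (A : SS K).det
  have hB := (B : SS K).det
  obtain ⟨a1, a2, a3, a4⟩ := A.2
  obtain ⟨b1, b2, b3, b4⟩ := B.2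
  refine QQ_eq' B A (E12 (-(A : SS K) 0 0 * (B : SS K) 0 1 + (A : SS K) 0 1 * (B : SS K) 0 0)) ?_ ?_
  · apply EE_le_EP
    apply E12_mem
    have ha : Dv 1 ((A : SS K) 0 0) := by
      simpa using (a3.mono (one_dvd _)).add Dv.one
    have hb : Dv 1 ((B : SS K) 0 0) := by
      simpa using (b3.mono (one_dvd _)).add Dv.one
    exact (ha.neg.int_mul b1).add (a1.mul_int hb)
  · rw [h0, h1] at hA
    apply SS.ext <;> simp only [SS.m00, SS.m01, SS.m10, SS.m11, e00, e01, e10, e11]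
    · linear_combination (-(A : SS K) 0 0) * hB + (B : SS K) 0 0 * hA
    · linear_combination (-(A : SS K) 0 1) * hB + (B : SS K) 0 1 * hA
    · linear_combination h0
    · linear_combination h1

/-- admissible bottom rows -/
def VV (n : ℕ) (c d : 𝓞 K) : Prop := (∃ d' : 𝓞 K, d = 1 + (n : 𝓞 K) ^ 2 * d') ∧ IsCoprime c d

theorem VV.exists {n : ℕ} {c d : 𝓞 K} (h : VV n c d) : ∃ A : GN K n, (A : SS K) 1 0 = n * (c : K) ∧
    (A : SS K) 1 1 = d := by
  obtain ⟨⟨d', rfl⟩, hcd⟩ := h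
  have h1 : IsCoprime ((n : 𝓞 K) ^ 2) (1 + (n : 𝓞 K) ^ 2 * d') := ⟨-d', 1, by ring⟩
  obtain ⟨b, a, hab⟩ := h1.mul_left hcd
  have habK : (b : K) * ((n : K) ^ 2 * c) + a * (1 + (n : K) ^ 2 * d') = 1 := by
    have : ((b * ((n : 𝓞 K) ^ 2 * c) + a * (1 + (n : 𝓞 K) ^ 2 * d') : 𝓞 K) : K) =
      ((1 : 𝓞 K) : K) := by rw [hab]
    push_cast at this; exact this
  refine ⟨⟨mk4 (a : K) (n * (-b : 𝓞 K)) (n * (c : K)) ((1 + (n : 𝓞 K) ^ 2 * d' : 𝓞 K) : K) ?_, ?_⟩, ?_, ?_⟩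
  · push_cast; linear_combination habK
  · rw [mem_GN]
    simp only [mk00, mk01, mk10, mk11]
    refine ⟨⟨_, rfl⟩, ⟨_, rfl⟩, ⟨-b * c - a * d', ?_⟩, ⟨d', ?_⟩⟩
    · push_cast; linear_combination habK
    · push_cast; ring
  · rfl
  · rfl

open Classical in
/-- the symbol -/
noncomputable def sy (n : ℕ) (c d : 𝓞 K) : QQ K n :=
  if h : ∃ A : GN K n, (A : SS K) 1 0 = n * (c : K) ∧ (A : SS K) 1 1 = d then
    QuotientGroup.mk h.choose else 1

theorem sy_eq {n : ℕ} {c d : 𝓞 K} (A : GN K n) (h0 : (A : SS K) 1 0 = n * (c : K))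
    (h1 : (A : SS K) 1 1 = d) : sy n c d = QuotientGroup.mk A := by
  have h : ∃ A : GN K n, (A : SS K) 1 0 = n * (c : K) ∧ (A : SS K) 1 1 = d := ⟨A, h0, h1⟩
  rw [sy, dif_pos h]
  exact QQ_row _ _ (by rw [h.choose_spec.1, h0]) (by rw [h.choose_spec.2, h1])

theorem S1a {n : ℕ} {c d : 𝓞 K} (h : VV n c d) (x : 𝓞 K) : sy n (c + d * x) d = sy n c d := by
  obtain ⟨A, h0, h1⟩ := h.exists
  have hE : E21 ((n : K) * x) ∈ EE K n := E21_mem ⟨x, rfl⟩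
  have hg : (A : SS K) * E21 ((n : K) * x) ∈ GN K n := mul_mem A.2 (EE_le_GN n hE)
  rw [sy_eq A h0 h1, sy_eq ⟨_, hg⟩ ?_ ?_]
  · exact QQ_eq _ _ _ (EE_le_EP n hE) rfl
  · change ((A : SS K) * E21 ((n : K) * x)) 1 0 = _
    rw [SS.m10, f00, f10, h0, h1]; push_cast; ring
  · change ((A : SS K) * E21 ((n : K) * x)) 1 1 = _
    rw [SS.m11, f01, f11, h1]; ring

theorem S1 {n : ℕ} {c c' d : 𝓞 K} (h : VV n c d) (hx : d ∣ c' - c) : sy n c' d = sy n c d := by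
  obtain ⟨x, hx⟩ := hx
  have e : c' = c + d * x := by linear_combination hx
  rw [e, S1a h]

theorem S2 {n : ℕ} {c d : 𝓞 K} (h : VV n c d) (x : 𝓞 K) :
    sy n c (d + (n : 𝓞 K) ^ 2 * c * x) = sy n c d := by
  obtain ⟨A, h0, h1⟩ := h.exists
  have hE : E12 ((n : K) * x) ∈ EE K n := E12_mem ⟨x, rfl⟩
  have hg : (A : SS K) * E12 ((n : K) * x) ∈ GN K n := mul_mem A.2 (EE_le_GN n hE)
  rw [sy_eq A h0 h1, sy_eq ⟨_, hg⟩ ?_ ?_]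
  · exact QQ_eq _ _ _ (EE_le_EP n hE) rfl
  · change ((A : SS K) * E12 ((n : K) * x)) 1 0 = _
    rw [SS.m10, e00, e10, h0]; ring
  · change ((A : SS K) * E12 ((n : K) * x)) 1 1 = _
    rw [SS.m11, e01, e11, h0, h1]; push_cast; ring

theorem VV.shift {n : ℕ} {c d : 𝓞 K} (h : VV n c d) (x y : 𝓞 K) :
    VV n c (d + (n : 𝓞 K) ^ 2 * (c * y) * x) := by
  obtain ⟨⟨d', rfl⟩, a, b, hab⟩ := h
  refine ⟨⟨d' + c * y * x, by ring⟩, a - b * (n : 𝓞 K) ^ 2 * y * x, b, ?_⟩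
  linear_combination hab

theorem VV.left {n : ℕ} {c c' d : 𝓞 K} (h : VV n (c * c') d) : VV n c d :=
  ⟨h.1, h.2.of_mul_left_left⟩
theorem VV.right {n : ℕ} {c c' d : 𝓞 K} (h : VV n (c * c') d) : VV n c' d :=
  ⟨h.1, h.2.of_mul_left_right⟩
theorem VV.congr {n : ℕ} {c c' d : 𝓞 K} (h : VV n c d) (hx : d ∣ c' - c) : VV n c' d := by
  obtain ⟨x, hx⟩ := hx
  obtain ⟨a, b, hab⟩ := h.2
  exact ⟨h.1, a, b - a * x, by linear_combination hab + a * hx⟩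

theorem S3' {n : ℕ} : sy n (0 : 𝓞 K) 1 = 1 := by
  rw [sy_eq (1 : GN K n) (by simp) (by simp)]; rfl

theorem S3 {n : ℕ} {d u : 𝓞 K} (hu : u * u = 1) (h : VV n u d) : sy n u d = 1 := by
  obtain ⟨d', hd'⟩ := h.1
  have e1 : d + (n : 𝓞 K) ^ 2 * u * (-u * d') = 1 := by
    linear_combination hd' - (n : 𝓞 K) ^ 2 * d' * hu
  have h1 := S2 h (-u * d')
  rw [e1] at h1
  rw [← h1, ← S3', S1 (c := u) (c' := 0) (d := 1)]
  · exact ⟨⟨0, by ring⟩, isCoprime_one_right⟩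
  · exact one_dvd _

theorem S4 (hdeg : 1 < Module.finrank ℚ K) (hreal : Nonempty (K →+* ℝ)) {n : ℕ} (hn : 0 < n)
    {t c d : 𝓞 K} (ht : t ≠ 0) (h : VV n (t ^ 2 * c) d) :
    sy n (t ^ 2 * c) d = sy n c d * sy n (t ^ 2) d := by
  have htK : (t : K) ≠ 0 := by rw [Ne, RingOfIntegers.coe_eq_zero_iff]; exact ht
  set T : Kˣ := Units.mk0 (t : K) htK with hT
  have hTv : (T : K) = t := rfl
  obtain ⟨m, hm, hP⟩ := PP_inv hdeg hreal (PP_hh hdeg hreal T) n hn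
  -- reduction to `d` coprime to `m`
  have hcopd : IsCoprime d ((n : 𝓞 K) ^ 2 * (t ^ 2 * c)) := by
    obtain ⟨⟨d', hd'⟩, h2⟩ := h
    refine IsCoprime.mul_right ⟨1, -d', by rw [hd']; ring⟩ h2.symm
  obtain ⟨x, hx⟩ := coprime_shift hcopd (span_nat_ne (K := K) (n := m ^ 2) (by positivity))
  have h' := h.shift x 1
  rw [mul_one] at h'
  have q1 := S2 h x
  have q2 := S2 h.right (t ^ 2 * x)
  have q3 := S2 h.left (c * x)
  have r2 : d + (n : 𝓞 K) ^ 2 * c * (t ^ 2 * x) = d + (n : 𝓞 K) ^ 2 * (t ^ 2 * c) * x := by ring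
  have r3 : d + (n : 𝓞 K) ^ 2 * t ^ 2 * (c * x) = d + (n : 𝓞 K) ^ 2 * (t ^ 2 * c) * x := by ring
  rw [r2] at q2
  rw [r3] at q3
  rw [← q1, ← q2, ← q3]
  clear q1 q2 q3 r2 r3 hcopd h
  generalize d + (n : 𝓞 K) ^ 2 * (t ^ 2 * c) * x = d at hx h'
  clear x
  rename_i d0
  clear d0
  rw [Ideal.isCoprime_span_singleton_iff] at hx
  obtain ⟨α, β, hαβ⟩ := hx
  set e : 𝓞 K := (c - 1) * β * (m : 𝓞 K) ^ 2 with he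
  have hαβ' : α * d + β * (m : 𝓞 K) ^ 2 = 1 := by push_cast at hαβ; exact hαβ
  have hc1 : d ∣ (1 + e) - c := ⟨-(c - 1) * α, by rw [he]; linear_combination (c - 1) * hαβ'⟩
  have hc2 : d ∣ t ^ 2 * (1 + e) - t ^ 2 * c := by
    rw [← mul_sub]; exact hc1.mul_left _
  rw [← S1 h'.right hc1, ← S1 h' hc2]
  obtain ⟨B₂, hB20, hB21⟩ := h'.left.exists
  obtain ⟨A₁, hA10, hA11⟩ := (h'.right.congr hc1).exists
  obtain ⟨B₁, hB10, hB11⟩ := (h'.congr hc2).exists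
  rw [sy_eq B₂ hB20 hB21, sy_eq A₁ hA10 hA11, sy_eq B₁ hB10 hB11]
  have hB2m := B₂.2
  obtain ⟨⟨b₂, hb₂⟩, -, hb3, hb4⟩ := hB2m
  have hdetB := (B₂ : SS K).det
  rw [hB20, hB21, hb₂] at hdetB
  push_cast at hdetB
  -- the matrix `A₂`
  have hdetA : (B₂ : SS K) 0 0 * d - ((t : K) ^ 2 * (n * (b₂ : K))) * ((n : K) * (1 : 𝓞 K)) = 1 := by
    push_cast; linear_combination hdetB
  have hA2m : mk4 ((B₂ : SS K) 0 0) ((t : K) ^ 2 * (n * (b₂ : K))) ((n : K) * (1 : 𝓞 K)) d hdetA ∈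
      GN K n := by
    rw [mem_GN]
    simp only [mk00, mk01, mk10, mk11]
    refine ⟨⟨t ^ 2 * b₂, by push_cast; ring⟩, ⟨_, rfl⟩, hb3, ?_⟩
    rwa [hB21] at hb4
  set A₂ : GN K n := ⟨_, hA2m⟩ with hA₂
  have a00 : (A₂ : SS K) 0 0 = (B₂ : SS K) 0 0 := rfl
  have a01 : (A₂ : SS K) 0 1 = (t : K) ^ 2 * (n * (b₂ : K)) := rfl
  have a10 : (A₂ : SS K) 1 0 = (n : K) * (1 : 𝓞 K) := rfl
  have a11 : (A₂ : SS K) 1 1 = d := rfl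
  have hA2one : (QuotientGroup.mk A₂ : QQ K n) = 1 := by
    rw [← sy_eq A₂ a10 a11]
    exact S3 (by ring) ⟨h'.1, isCoprime_one_left⟩
  -- the matrix `X`
  set X : GN K n := A₁ * A₂⁻¹ with hX
  have hXv : (X : SS K) = (A₁ : SS K) * (A₂ : SS K)⁻¹ := rfl
  have x10 : (X : SS K) 1 0 = d * n * e := by
    rw [hXv, SS.m10, SS.i00, SS.i10, hA10, hA11, a10, a11]; push_cast; ring
  have x11 : (X : SS K) 1 1 = 1 - (n : K) ^ 2 * t ^ 2 * b₂ * e := by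
    rw [hXv, SS.m11, SS.i01, SS.i11, hA10, hA11, a00, a01]; push_cast
    linear_combination hdetB
  obtain ⟨⟨p, hp⟩, -, ⟨x0, hx0⟩, -⟩ := X.2
  have hE : E12 (-(X : SS K) 0 1) ∈ EE K n := E12_mem (Dv.neg ⟨p, hp⟩)
  set X' : SS K := E12 (-(X : SS K) 0 1) * X with hX'
  have hX'n : X' ∈ GN K n := mul_mem (EE_le_GN n hE) X.2
  have x'00 : X' 0 0 = (X : SS K) 0 0 - (X : SS K) 0 1 * (X : SS K) 1 0 := by
    rw [hX', SS.m00, e00, e01]; ring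
  have x'01 : X' 0 1 = (X : SS K) 0 1 * (1 - (X : SS K) 1 1) := by
    rw [hX', SS.m01, e00, e01]; ring
  have x'10 : X' 1 0 = (X : SS K) 1 0 := by
    rw [hX', SS.m10, e10, e11]; ring
  have x'11 : X' 1 1 = (X : SS K) 1 1 := by
    rw [hX', SS.m11, e10, e11]; ring
  have hXm : X' ∈ GN K m := by
    have hdm : m ∣ m ^ 2 := dvd_pow_self _ two_ne_zero
    have he' : Dv (m ^ 2) (e : K) := ⟨(c - 1) * β, by rw [he]; push_cast; ring⟩
    have hinteg : ∀ r : 𝓞 K, Dv 1 (r : K) := Dv.of_int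
    have k11 : Dv (m ^ 2) (X' 1 1 - 1) := by
      rw [x'11, x11]
      have : 1 - (n : K) ^ 2 * t ^ 2 * b₂ * e - 1 = (-((n : 𝓞 K) ^ 2 * t ^ 2 * b₂) : 𝓞 K) * (e : K) := by
        push_cast; ring
      rw [this]; exact (hinteg _).int_mul he'
    have k01 : Dv (m ^ 2) (X' 0 1) := by
      have : X' 0 1 = ((-(n * p) : 𝓞 K) : K) * (X' 1 1 - 1) := by
        rw [x'01, x'11, hp]; push_cast; ring
      rw [this]; exact (hinteg _).int_mul k11
    have k10 : Dv (m ^ 2) (X' 1 0) := by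
      rw [x'10, x10]
      have : (d : K) * n * e = ((d * n : 𝓞 K) : K) * e := by push_cast; ring
      rw [this]; exact (hinteg _).int_mul he'
    have i10 : Dv 1 (X' 1 0) := k10.mono (one_dvd _)
    have i00 : Dv 1 (X' 0 0) := by
      obtain ⟨-, -, h3, -⟩ := hX'n
      simpa using (h3.mono (one_dvd _)).add Dv.one
    refine ⟨k01.mono hdm, k10.mono hdm, ?_, k11⟩
    have : X' 0 0 - 1 = X' 0 1 * X' 1 0 - X' 0 0 * (X' 1 1 - 1) := by
      linear_combination X'.det
    rw [this]
    exact (k01.mul_int i10).sub (i00.int_mul k11)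
  have hfin := hP X' hXm
  rw [inv_inv] at hfin
  have hYm : X' * (X'⁻¹ * (hh T)⁻¹ * X' * hh T) ∈ GN K n := mul_mem hX'n (EP_le_GN n hfin)
  have hY : X' * (X'⁻¹ * (hh T)⁻¹ * X' * hh T) = (hh T)⁻¹ * X' * hh T := by group
  have c1 : (QuotientGroup.mk (B₁ * B₂⁻¹) : QQ K n) =
      QuotientGroup.mk (⟨_, hYm⟩ : GN K n) := by
    apply QQ_row
    · change ((B₁ : SS K) * (B₂ : SS K)⁻¹) 1 0 = (X' * (X'⁻¹ * (hh T)⁻¹ * X' * hh T)) 1 0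
      rw [hY]
      simp only [SS.m00, SS.m01, SS.m10, SS.m11, SS.i00, SS.i01, SS.i10, SS.i11, h00, h01, h10, h11]
      rw [hB10, hB11, hB20, hB21, x'10, x10, hTv]
      push_cast; ring
    · change ((B₁ : SS K) * (B₂ : SS K)⁻¹) 1 1 = (X' * (X'⁻¹ * (hh T)⁻¹ * X' * hh T)) 1 1
      rw [hY]
      simp only [SS.m00, SS.m01, SS.m10, SS.m11, SS.i00, SS.i01, SS.i10, SS.i11, h00, h01, h10, h11]
      rw [hB10, hB11, hb₂, x'11, x11, hTv]
      field_simp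
      push_cast
      linear_combination (t : K) * hdetB
  have c2 : (QuotientGroup.mk (⟨_, hYm⟩ : GN K n) : QQ K n) = QuotientGroup.mk ⟨X', hX'n⟩ :=
    QQ_eq _ _ _ hfin rfl
  have c3 : (QuotientGroup.mk (⟨X', hX'n⟩ : GN K n) : QQ K n) = QuotientGroup.mk X :=
    QQ_eq' _ _ _ (EE_le_EP n hE) rfl
  have c4 : (QuotientGroup.mk X : QQ K n) = QuotientGroup.mk A₁ := by
    rw [hX, QuotientGroup.mk_mul, QuotientGroup.mk_inv, hA2one, inv_one, mul_one]
  have c5 := c1.trans (c2.trans (c3.trans c4))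
  rw [QuotientGroup.mk_mul, QuotientGroup.mk_inv] at c5
  rw [← c5, inv_mul_cancel_right]

end symb
end VL

namespace VL
open NumberField InfinitePlace

section symbend
variable {K : Type*} [Field K] [NumberField K]

theorem S5 (hdeg : 1 < Module.finrank ℚ K) (hreal : Nonempty (K →+* ℝ)) {n : ℕ} (hn : 0 < n)
    {t d : 𝓞 K} (ht : t ≠ 0) (h : VV n (t ^ 2) d) (j : ℕ) :
    sy n (t ^ (2 * j)) d = sy n (t ^ 2) d ^ j := by
  induction j with
  | zero =>
    rw [mul_zero, pow_zero, pow_zero]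
    exact S3 (by ring) ⟨h.1, isCoprime_one_left⟩
  | succ j ih =>
    have e : t ^ (2 * (j + 1)) = t ^ 2 * t ^ (2 * j) := by ring
    have h2 : IsCoprime (t ^ 2 * t ^ (2 * j)) d := by
      rw [pow_mul]
      exact h.2.mul_left h.2.pow_left
    rw [e, S4 hdeg hreal hn ht ⟨h.1, h2⟩, ih, pow_succ (sy n (t ^ 2) d)]

theorem VV.span {n : ℕ} {c d : 𝓞 K} (h : VV n c d) :
    IsCoprime (Ideal.span {d}) (Ideal.span {(n : 𝓞 K) ^ 2 * c}) := by
  rw [Ideal.isCoprime_span_singleton_iff]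
  obtain ⟨⟨d', hd'⟩, h2⟩ := h
  exact IsCoprime.mul_right ⟨1, -d', by rw [hd']; ring⟩ h2.symm

theorem span_mul_ne {n : ℕ} (hn : 0 < n) {c : 𝓞 K} (hc : c ≠ 0) :
    Ideal.span {(n : 𝓞 K) ^ 2 * c} ≠ 0 := by
  rw [Ne, Ideal.zero_eq_bot, Ideal.span_singleton_eq_bot]
  have : (n : 𝓞 K) ≠ 0 := by exact_mod_cast hn.ne'
  exact mul_ne_zero (pow_ne_zero _ this) hc

theorem VV.move {n : ℕ} {c d d' : 𝓞 K} (h : VV n c d)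
    (hd : d' - d ∈ Ideal.span {(n : 𝓞 K) ^ 2 * c}) : VV n c d' ∧ sy n c d = sy n c d' := by
  rw [Ideal.mem_span_singleton] at hd
  obtain ⟨x, hx⟩ := hd
  have e : d' = d + (n : 𝓞 K) ^ 2 * c * x := by linear_combination hx
  have h1 := h.shift x 1
  rw [mul_one] at h1
  rw [e]
  exact ⟨h1, (S2 h x).symm⟩

theorem S6 (hdeg : 1 < Module.finrank ℚ K) (hreal : Nonempty (K →+* ℝ)) {n : ℕ} (hn : 0 < n) :
    ∃ k : ℕ, 0 < k ∧ ∀ t d : 𝓞 K, t ≠ 0 → VV n (t ^ 2) d → sy n (t ^ 2) d ^ k = 1 := by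
  obtain ⟨k, hk, H⟩ := star1 K
  refine ⟨k, hk, fun t d ht h => ?_⟩
  let J : AddSubgroup ℤ :=
    { carrier := {j | sy n (t ^ 2) d ^ j = 1}
      zero_mem' := by simp
      add_mem' := by
        intro a b ha hb
        simp only [Set.mem_setOf_eq] at *
        rw [zpow_add, ha, hb, one_mul]
      neg_mem' := by
        intro a ha
        simp only [Set.mem_setOf_eq] at *
        rw [zpow_neg, ha, inv_one] }
  have := H (Ideal.span {(n : 𝓞 K) ^ 2 * t ^ 2}) d (span_mul_ne hn (pow_ne_zero _ ht)) h.span J ?_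
  · have h3 : sy n (t ^ 2) d ^ (k : ℤ) = 1 := this
    rwa [zpow_natCast] at h3
  · intro b' hb' hbd e he
    change sy n (t ^ 2) d ^ (e : ℤ) = 1
    rw [zpow_natCast]
    obtain ⟨h1, h2⟩ := h.move hbd
    rw [h2, ← S5 hdeg hreal hn ht h1]
    have h1c : VV n 1 b' := ⟨h1.1, isCoprime_one_left⟩
    have htc : IsCoprime t b' := by
      have := h1.2
      rwa [IsCoprime.pow_left_iff (by norm_num)] at this
    rw [S1 h1c, S3 (by ring) h1c]
    have : t ^ (2 * e) - 1 = (t ^ e - 1) * (t ^ e + 1) := by ring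
    rw [this]
    exact (he t htc).mul_right _

theorem S7 (hdeg : 1 < Module.finrank ℚ K) (hreal : Nonempty (K →+* ℝ)) {n : ℕ} (hn : 0 < n)
    {l : ℕ} (hl : l.Prime) {t d : 𝓞 K} (ht : t ≠ 0) (h : VV n (t ^ 2) d) :
    ∃ β d' : 𝓞 K, β ≠ 0 ∧ VV n (β ^ 2) d' ∧ sy n (t ^ 2) d = sy n (β ^ 2) d' ^ l := by
  have key : ∃ b' : 𝓞 K, b' ≠ 0 ∧ b' - d ∈ Ideal.span {(n : 𝓞 K) ^ 2 * t ^ 2} ∧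
      ∃ β : 𝓞 K, b' ∣ β ^ (2 * l) - t ^ 2 := by
    by_cases hl2 : l = 2
    · obtain ⟨b', hb', hbd, β, hβ⟩ := star3 hdeg hreal ht (span_mul_ne hn (pow_ne_zero 2 ht)) h.span
      refine ⟨b', hb', hbd, β, ?_⟩
      subst hl2
      have e : β ^ (2 * 2) - t ^ 2 = (t - β ^ 2) * (-(t + β ^ 2)) := by ring
      rw [e]
      rcases hβ with hβ | hβ
      · exact hβ.mul_right _
      · exact hβ.neg_right.mul_left _
    · obtain ⟨b', hb', hbd, β, hβ⟩ := star2 hdeg hreal hl hl2 ht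
        (span_mul_ne hn (pow_ne_zero 2 ht)) h.span
      refine ⟨b', hb', hbd, β, ?_⟩
      have e : β ^ (2 * l) - t ^ 2 = (t - β ^ l) * (-(t + β ^ l)) := by ring
      rw [e]
      exact hβ.mul_right _
  obtain ⟨b', hb', hbd, β, hβ⟩ := key
  obtain ⟨γ, hγ0, hγ⟩ : ∃ γ : 𝓞 K, γ ≠ 0 ∧ b' ∣ γ ^ (2 * l) - t ^ 2 := by
    by_cases hβ0 : β = 0
    · refine ⟨b', hb', ?_⟩
      have hl0 : 2 * l ≠ 0 := by have := hl.pos; omega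
      rw [hβ0, zero_pow hl0, zero_sub, dvd_neg] at hβ
      exact dvd_sub (dvd_pow_self _ hl0) hβ
    · exact ⟨β, hβ0, hβ⟩
  obtain ⟨h1, h2⟩ := h.move hbd
  have h3 := h1.congr hγ
  have h4 : VV n (γ ^ 2) b' := by
    refine ⟨h1.1, ?_⟩
    have := h3.2
    rw [pow_mul] at this
    rwa [IsCoprime.pow_left_iff hl.pos] at this
  exact ⟨γ, b', hγ0, h4, by rw [h2, ← S1 h1 hγ, S5 hdeg hreal hn hγ0 h4]⟩

theorem S7' (hdeg : 1 < Module.finrank ℚ K) (hreal : Nonempty (K →+* ℝ)) {n : ℕ} (hn : 0 < n)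
    (j : ℕ) : 0 < j → ∀ {t d : 𝓞 K}, t ≠ 0 → VV n (t ^ 2) d →
    ∃ β d' : 𝓞 K, β ≠ 0 ∧ VV n (β ^ 2) d' ∧ sy n (t ^ 2) d = sy n (β ^ 2) d' ^ j := by
  induction j using induction_on_primes with
  | zero => intro h; exact absurd h (lt_irrefl _)
  | one => intro _ t d ht h; exact ⟨t, d, ht, h, (pow_one _).symm⟩
  | prime_mul p a hp ih =>
    intro hj t d ht h
    obtain ⟨β, d', hβ, h1, e1⟩ := S7 hdeg hreal hn hp ht h
    obtain ⟨γ, d2, hγ, h2, e2⟩ := ih (Nat.pos_of_mul_pos_left hj) hβ h1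
    exact ⟨γ, d2, hγ, h2, by rw [e1, e2, ← pow_mul, mul_comm a p]⟩

theorem S7f (hdeg : 1 < Module.finrank ℚ K) (hreal : Nonempty (K →+* ℝ)) {n : ℕ} (hn : 0 < n)
    {t d : 𝓞 K} (ht : t ≠ 0) (h : VV n (t ^ 2) d) : sy n (t ^ 2) d = 1 := by
  obtain ⟨k, hk, H⟩ := S6 hdeg hreal hn
  obtain ⟨β, d', hβ, h1, e1⟩ := S7' hdeg hreal hn k hk ht h
  rw [e1, H β d' hβ h1]

theorem S8 (hdeg : 1 < Module.finrank ℚ K) (hreal : Nonempty (K →+* ℝ)) {n : ℕ} (hn : 0 < n)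
    {c d : 𝓞 K} (hc : c ≠ 0) (h : VV n c d) : sy n c d = 1 := by
  obtain ⟨b', hb', hbd, β, hβ⟩ := star3 hdeg hreal hc (span_mul_ne hn hc) h.span
  obtain ⟨h1, h2⟩ := h.move hbd
  rw [h2]
  obtain ⟨γ, hγ0, hγ⟩ : ∃ γ : 𝓞 K, γ ≠ 0 ∧ (b' ∣ c - γ ^ 2 ∨ b' ∣ c + γ ^ 2) := by
    by_cases hβ0 : β = 0
    · refine ⟨b', hb', Or.inl ?_⟩
      have : b' ∣ c := by rcases hβ with hβ | hβ <;> simpa [hβ0] using hβ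
      exact dvd_sub this (dvd_pow_self _ two_ne_zero)
    · exact ⟨β, hβ0, hβ⟩
  rcases hγ with hγ | hγ
  · have e : b' ∣ γ ^ 2 - c := by rw [← dvd_neg, neg_sub]; exact hγ
    rw [← S1 h1 e]
    exact S7f hdeg hreal hn hγ0 (h1.congr e)
  · have e : b' ∣ γ ^ 2 * (-1) - c := by
      have e2 : γ ^ 2 * (-1) - c = -(c + γ ^ 2) := by ring
      rw [e2, dvd_neg]; exact hγ
    have h3 := h1.congr e
    rw [← S1 h1 e, S4 hdeg hreal hn hγ0 h3, S7f hdeg hreal hn hγ0 h3.left, mul_one]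
    exact S3 (by ring) h3.right

theorem S9 (hdeg : 1 < Module.finrank ℚ K) (hreal : Nonempty (K →+* ℝ)) {n : ℕ} (hn : 0 < n)
    {c d : 𝓞 K} (h : VV n c d) : sy n c d = 1 := by
  by_cases hc : c = 0
  · subst hc
    have hu : IsUnit d := isCoprime_zero_left.mp h.2
    have e : d ∣ d - 0 := by rw [sub_zero]
    rw [← S1 h e]
    exact S8 hdeg hreal hn hu.ne_zero (h.congr e)
  · exact S8 hdeg hreal hn hc h

theorem GN_le_EP (hdeg : 1 < Module.finrank ℚ K) (hreal : Nonempty (K →+* ℝ)) {n : ℕ}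
    (hn : 0 < n) : GN K n ≤ EP K n := by
  intro A hA
  obtain ⟨a, b, c, d, -, -, h10, h11, hd, hdet⟩ := GN_ent hA
  have hV : VV n c d := ⟨hd, -(n : 𝓞 K) ^ 2 * b, a, by linear_combination hdet⟩
  have h := S9 hdeg hreal hn hV
  rw [sy_eq ⟨A, hA⟩ h10 h11, QuotientGroup.eq_one_iff, NEP, Subgroup.mem_subgroupOf] at h
  exact h

theorem main_SL (hdeg : 1 < Module.finrank ℚ K) (hreal : Nonempty (K →+* ℝ)) {n : ℕ}
    (hn : 0 < n) : ∃ m : ℕ, 0 < m ∧ n ∣ m ∧ GN K m ≤ EE K n := by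
  obtain ⟨m, hm, hnm, h⟩ := lemN' hdeg hreal hn
  exact ⟨m, hm, hnm, (GN_le_EP hdeg hreal hm).trans h⟩

end symbend
end VL

namespace VL
open NumberField InfinitePlace

section final
open FractionalIdeal nonZeroDivisors MatrixGroups
variable {K : Type*} [Field K] [NumberField K]

theorem finC (hdeg : 1 < Module.finrank ℚ K) (hreal : Nonempty (K →+* ℝ))
    {N : Ideal (𝓞 K)} (hN : N ≠ 0) (H : Subgroup (SS K)) (h12 : ∀ x : 𝓞 K, E12 (x : K) ∈ H)
    (h21 : ∀ x : 𝓞 K, x ∈ N → E21 (x : K) ∈ H) (A : SS K) (a b c d : 𝓞 K)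
    (h00' : A 0 0 = a) (h01' : A 0 1 = b) (h10' : A 1 0 = c) (h11' : A 1 1 = d)
    (hc : c ∈ N) (hd : d - 1 ∈ N) : A ∈ H := by
  set n : ℕ := Ideal.absNorm N with hn
  have hn0 : 0 < n := Nat.pos_of_ne_zero (by
    rw [hn, Ne, Ideal.absNorm_eq_zero_iff]; exact hN)
  have hnN : (n : 𝓞 K) ∈ N := Ideal.absNorm_mem N
  obtain ⟨m, hm, -, hGE⟩ := main_SL hdeg hreal hn0
  have hEH : EE K n ≤ H := by
    apply EE_le
    · rintro x ⟨y, rfl⟩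
      have := h12 (n * y)
      push_cast at this; exact this
    · rintro x ⟨y, rfl⟩
      have := h21 (n * y) (N.mul_mem_right _ hnN)
      push_cast at this; exact this
  have hdetK := A.det
  rw [h00', h01', h10', h11'] at hdetK
  have hdet : a * d - b * c = 1 := by
    apply RingOfIntegers.coe_injective
    push_cast; exact hdetK
  have hcop : IsCoprime d c := ⟨a, -b, by linear_combination hdet⟩
  obtain ⟨x, hx⟩ := coprime_shift hcop (span_nat_ne (K := K) (n := m ^ 2) (by positivity))
  rw [Ideal.isCoprime_span_singleton_iff] at hx
  obtain ⟨α, β, hαβ⟩ := hx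
  set d1 := d + c * x with hd1
  have hd1N : d1 - 1 ∈ N := by
    have : d1 - 1 = (d - 1) + c * x := by rw [hd1]; ring
    rw [this]; exact N.add_mem hd (N.mul_mem_right _ hc)
  set y := α * (1 - d1 - c) with hy
  have hyN : y ∈ N := by
    have : y = -α * ((d1 - 1) + c) := by rw [hy]; ring
    rw [this]; exact N.mul_mem_left _ (N.add_mem hd1N hc)
  set c2 := c + y * d1 with hc2
  have hc2N : c2 ∈ N := N.add_mem hc (N.mul_mem_right _ hyN)
  have hd2 : d1 + c2 - 1 = ((m ^ 2 : ℕ) : 𝓞 K) * (-β * (1 - d1 - c)) := by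
    rw [hc2, hy]; linear_combination (1 - d1 - c) * hαβ
  set B : SS K := A * E12 (x : K) * E21 (y : K) * E12 ((1 : 𝓞 K) : K) * E21 ((-c2 : 𝓞 K) : K) with hB
  have hBH : B ∈ H → A ∈ H := by
    intro h
    rw [hB] at h
    rw [Subgroup.mul_mem_cancel_right _ (h21 _ (N.neg_mem hc2N)),
      Subgroup.mul_mem_cancel_right _ (h12 _), Subgroup.mul_mem_cancel_right _ (h21 _ hyN),
      Subgroup.mul_mem_cancel_right _ (h12 _)] at h
    exact h
  apply hBH
  have k11 : B 1 1 = ((d1 + c2 : 𝓞 K) : K) := by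
    rw [hB]
    simp only [SS.m00, SS.m01, SS.m10, SS.m11, e00, e01, e10, e11, f00, f01, f10, f11, h10', h11']
    rw [hc2, hd1]; push_cast; ring
  have k10 : B 1 0 = ((c2 * (-(d1 + c2 - 1)) : 𝓞 K) : K) := by
    rw [hB]
    simp only [SS.m00, SS.m01, SS.m10, SS.m11, e00, e01, e10, e11, f00, f01, f10, f11, h10', h11']
    rw [hc2, hd1]; push_cast; ring
  have k01 : ∃ b' : 𝓞 K, B 0 1 = b' := by
    refine ⟨(a + (a * x + b) * y) + (a * x + b), ?_⟩
    rw [hB]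
    simp only [SS.m00, SS.m01, SS.m10, SS.m11, e00, e01, e10, e11, f00, f01, f10, f11, h00', h01']
    push_cast; ring
  have k00 : ∃ a' : 𝓞 K, B 0 0 = a' := by
    refine ⟨(a + (a * x + b) * y) + ((a + (a * x + b) * y) + (a * x + b)) * (-c2), ?_⟩
    rw [hB]
    simp only [SS.m00, SS.m01, SS.m10, SS.m11, e00, e01, e10, e11, f00, f01, f10, f11, h00', h01']
    push_cast; ring
  obtain ⟨b', hb'⟩ := k01
  obtain ⟨a', ha'⟩ := k00
  clear_value B
  have hEb := h12 (-b')
  rw [← Subgroup.mul_mem_cancel_left _ hEb]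
  apply hEH
  apply hGE
  have hBdet := B.det
  rw [ha', hb', k10, k11] at hBdet
  generalize hw : -β * (1 - d1 - c) = w at hd2
  have hd2' : d1 + c2 = 1 + ((m ^ 2 : ℕ) : 𝓞 K) * w := by linear_combination hd2
  rw [hd2] at k10 hBdet
  rw [hd2'] at k11 hBdet
  push_cast at k10 k11 hBdet
  have hdm : m ∣ m ^ 2 := dvd_pow_self _ two_ne_zero
  have j11 : Dv (m ^ 2) ((E12 ((-b' : 𝓞 K) : K) * B) 1 1 - 1) := by
    refine ⟨w, ?_⟩
    rw [SS.m11, e10, e11, k11]; push_cast; ring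
  have j10 : Dv (m ^ 2) ((E12 ((-b' : 𝓞 K) : K) * B) 1 0) := by
    refine ⟨-c2 * w, ?_⟩
    rw [SS.m10, e10, e11, k10]; push_cast; ring
  have j01 : Dv (m ^ 2) ((E12 ((-b' : 𝓞 K) : K) * B) 0 1) := by
    refine ⟨-b' * w, ?_⟩
    rw [SS.m01, e00, e01, k11, hb']; push_cast; ring
  have j00 : Dv (m ^ 2) ((E12 ((-b' : 𝓞 K) : K) * B) 0 0 - 1) := by
    refine ⟨b' * c2 * w - a' * w - b' * c2 * w, ?_⟩
    rw [SS.m00, e00, e01, k10, ha']; push_cast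
    linear_combination hBdet
  exact ⟨j01.mono hdm, j10.mono hdm, j00, j11⟩

theorem finGL (hdeg : 1 < Module.finrank ℚ K) (hreal : Nonempty (K →+* ℝ))
    (t m : Ideal (𝓞 K)) (ht : t ≠ 0) (hm : m ≠ 0) (H : Subgroup (GL (Fin 2) K))
    (h12 : ∀ δ : GL (Fin 2) K, δ.1 0 0 = 1 → δ.1 1 1 = 1 → δ.1 1 0 = 0 →
            δ.1 0 1 ∈ ((t : FractionalIdeal (𝓞 K)⁰ K))⁻¹ → δ ∈ H)
    (h21 : ∀ δ : GL (Fin 2) K, δ.1 0 0 = 1 → δ.1 1 1 = 1 → δ.1 0 1 = 0 →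
            δ.1 1 0 ∈ ((t * m : Ideal (𝓞 K)) : FractionalIdeal (𝓞 K)⁰ K) → δ ∈ H)
    (u : (𝓞 K)ˣ)
    (hu : ∀ δ : GL (Fin 2) K, δ.1 0 1 = 0 → δ.1 1 0 = 0 → δ.1 1 1 = 1 →
            algebraMap (𝓞 K) K u = δ.1 0 0 → δ ∈ H)
    (γ : GL (Fin 2) K)
    (ha : ∃ a : 𝓞 K, algebraMap (𝓞 K) K a = γ.1 0 0)
    (hb : γ.1 0 1 ∈ ((t : FractionalIdeal (𝓞 K)⁰ K))⁻¹)
    (hc : γ.1 1 0 ∈ ((t * t * m : Ideal (𝓞 K)) : FractionalIdeal (𝓞 K)⁰ K))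
    (hd : γ.1 1 1 - 1 ∈ ((t * m : Ideal (𝓞 K)) : FractionalIdeal (𝓞 K)⁰ K))
    (hdet : algebraMap (𝓞 K) K u = γ.1 0 0 * γ.1 1 1 - γ.1 0 1 * γ.1 1 0) : γ ∈ H := by
  have htF : (t : FractionalIdeal (𝓞 K)⁰ K) ≠ 0 := by
    rw [Ne, FractionalIdeal.coeIdeal_eq_zero]; exact ht
  obtain ⟨a, ha⟩ := ha
  rw [FractionalIdeal.mem_coeIdeal] at hc hd
  obtain ⟨c, hcm, hc⟩ := hc
  obtain ⟨d, hdm, hd⟩ := hd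
  have hle : t * t * m ≤ t * m := by rw [mul_assoc]; exact Ideal.mul_le_right
  have hle2 : t * m ≤ t := Ideal.mul_le_left
  have hinteg : ∀ x ∈ ((t : FractionalIdeal (𝓞 K)⁰ K))⁻¹, ∀ y ∈ t, ∃ z : 𝓞 K,
      algebraMap (𝓞 K) K z = x * algebraMap (𝓞 K) K y := by
    intro x hx y hy
    rw [FractionalIdeal.mem_inv_iff htF] at hx
    have := hx (algebraMap (𝓞 K) K y) (FractionalIdeal.mem_coeIdeal_of_mem _ hy)
    rwa [FractionalIdeal.mem_one_iff] at this
  have hone : ∀ z : 𝓞 K, algebraMap (𝓞 K) K z ∈ ((t : FractionalIdeal (𝓞 K)⁰ K))⁻¹ := by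
    intro z
    rw [FractionalIdeal.mem_inv_iff htF]
    intro y hy
    rw [FractionalIdeal.mem_coeIdeal] at hy
    obtain ⟨y', -, rfl⟩ := hy
    rw [FractionalIdeal.mem_one_iff]
    exact ⟨z * y', by rw [map_mul]⟩
  set v : K := algebraMap (𝓞 K) K ((u⁻¹ : (𝓞 K)ˣ) : 𝓞 K) with hv
  have huv : algebraMap (𝓞 K) K u * v = 1 := by
    rw [hv, ← map_mul, Units.mul_inv, map_one]
  have hbv : v * γ.1 0 1 ∈ ((t : FractionalIdeal (𝓞 K)⁰ K))⁻¹ := by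
    have := Submodule.smul_mem ((((t : FractionalIdeal (𝓞 K)⁰ K))⁻¹ : FractionalIdeal (𝓞 K)⁰ K) :
      Submodule (𝓞 K) K) ((u⁻¹ : (𝓞 K)ˣ) : 𝓞 K) hb
    rwa [Algebra.smul_def] at this
  set H' : Subgroup (SS K) := H.comap Matrix.SpecialLinearGroup.toGL with hH'
  have g12 : ∀ x : K, x ∈ ((t : FractionalIdeal (𝓞 K)⁰ K))⁻¹ → E12 x ∈ H' := by
    intro x hx
    rw [hH', Subgroup.mem_comap]
    exact h12 _ rfl rfl rfl hx
  have g21 : ∀ x : 𝓞 K, x ∈ t * m → E21 (x : K) ∈ H' := by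
    intro x hx
    rw [hH', Subgroup.mem_comap]
    exact h21 _ rfl rfl rfl (FractionalIdeal.mem_coeIdeal_of_mem _ hx)
  have hdetA : (v * γ.1 0 0) * γ.1 1 1 - (v * γ.1 0 1) * γ.1 1 0 = 1 := by
    linear_combination huv - v * hdet
  set A : SS K := mk4 _ _ _ _ hdetA with hA
  have hAH : A ∈ H' := by
    rw [← Subgroup.mul_mem_cancel_left _ (inv_mem (g12 _ hbv))]
    obtain ⟨z, hz⟩ := hinteg _ hbv d (hle2 hdm)
    obtain ⟨z', hz'⟩ := hinteg _ hbv c (hle2 (hle hcm))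
    refine finC hdeg hreal (mul_ne_zero ht hm) H' (fun x => g12 _ (hone x)) g21 _
      (((u⁻¹ : (𝓞 K)ˣ) : 𝓞 K) * a - z') (-z) c (1 + d) ?_ ?_ ?_ ?_ (hle hcm) ?_
    · change _ = algebraMap (𝓞 K) K _
      rw [SS.m00, SS.i00, SS.i01, e01, e11, hA, mk00, mk10, map_sub, map_mul, hz', ha, hc]
      ring
    · change _ = algebraMap (𝓞 K) K _
      rw [SS.m01, SS.i00, SS.i01, e01, e11, hA, mk01, mk11, map_neg, hz, hd]
      ring
    · change _ = algebraMap (𝓞 K) K _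
      rw [SS.m10, SS.i10, SS.i11, e00, e10, hA, mk00, mk10, hc]
      ring
    · change _ = algebraMap (𝓞 K) K _
      rw [SS.m11, SS.i10, SS.i11, e00, e10, hA, mk01, mk11, map_add, map_one, hd]
      ring
    · rwa [add_sub_cancel_left]
  rw [hH', Subgroup.mem_comap] at hAH
  have hu0 : algebraMap (𝓞 K) K u ≠ 0 := left_ne_zero_of_mul_eq_one huv
  set D : GL (Fin 2) K := Matrix.GeneralLinearGroup.mkOfDetNeZero
    !![algebraMap (𝓞 K) K u, 0; 0, 1] (by rw [Matrix.det_fin_two_of]; simpa using hu0) with hD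
  have hDH : D ∈ H := hu D rfl rfl rfl rfl
  have hγ : γ = D * Matrix.SpecialLinearGroup.toGL A := by
    apply Units.ext
    have e1 : (Matrix.SpecialLinearGroup.toGL A : GL (Fin 2) K).1 =
      !![v * γ.1 0 0, v * γ.1 0 1; γ.1 1 0, γ.1 1 1] := rfl
    have e2 : D.1 = !![algebraMap (𝓞 K) K u, 0; 0, 1] := rfl
    rw [Units.val_mul, e1, e2, Matrix.mul_fin_two]
    ext i j
    fin_cases i <;> fin_cases j
    · change γ.1 0 0 = algebraMap (𝓞 K) K u * (v * γ.1 0 0) + 0 * γ.1 1 0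
      linear_combination -γ.1 0 0 * huv
    · change γ.1 0 1 = algebraMap (𝓞 K) K u * (v * γ.1 0 1) + 0 * γ.1 1 1
      linear_combination -γ.1 0 1 * huv
    · change γ.1 1 0 = 0 * (v * γ.1 0 0) + 1 * γ.1 1 0
      ring
    · change γ.1 1 1 = 0 * (v * γ.1 0 1) + 1 * γ.1 1 1
      ring
  rw [hγ]
  exact mul_mem hDH hAH

end final
end VL

open NumberField FractionalIdeal
open scoped nonZeroDivisors MatrixGroups

/-- **`Γ₁(𝔱,𝔱𝔪)` is generated by elementary and diagonal-unit matrices.**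
For a number field `K` of degree `> 1` with a real embedding and nonzero ideals `𝔱`, `𝔪`,
every element of `Γ₁(𝔱,𝔱𝔪)` (entries `a ∈ O_K`, `b ∈ 𝔱⁻¹`, `c ∈ 𝔱²𝔪`, `d − 1 ∈ 𝔱𝔪`,
determinant a unit of `O_K`) lies in the subgroup of `GL₂(K)` generated by `(1,b;0,1)` for
`b ∈ 𝔱⁻¹`, `(1,0;c,1)` for `c ∈ 𝔱𝔪`, and `(ε,0;0,1)` for units `ε` of `O_K`; and likewise
for `Γ₁⁺(𝔱,𝔱𝔪)` with totally positive units `ε`. -/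
theorem stmt_7 (K : Type*) [Field K] [NumberField K]
    (hdeg : 1 < Module.finrank ℚ K) (hreal : Nonempty (K →+* ℝ))
    (t m : Ideal (𝓞 K)) (ht : t ≠ 0) (hm : m ≠ 0) :
    (∀ γ : GL (Fin 2) K,
      (∃ a : 𝓞 K, algebraMap (𝓞 K) K a = γ.1 0 0) →
      γ.1 0 1 ∈ ((t : FractionalIdeal (𝓞 K)⁰ K))⁻¹ →
      γ.1 1 0 ∈ ((t * t * m : Ideal (𝓞 K)) : FractionalIdeal (𝓞 K)⁰ K) →
      γ.1 1 1 - 1 ∈ ((t * m : Ideal (𝓞 K)) : FractionalIdeal (𝓞 K)⁰ K) →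
      (∃ u : (𝓞 K)ˣ, algebraMap (𝓞 K) K u = γ.1 0 0 * γ.1 1 1 - γ.1 0 1 * γ.1 1 0) →
      γ ∈ Subgroup.closure
        ({δ : GL (Fin 2) K | δ.1 0 0 = 1 ∧ δ.1 1 1 = 1 ∧ δ.1 1 0 = 0 ∧
            δ.1 0 1 ∈ ((t : FractionalIdeal (𝓞 K)⁰ K))⁻¹} ∪
         {δ : GL (Fin 2) K | δ.1 0 0 = 1 ∧ δ.1 1 1 = 1 ∧ δ.1 0 1 = 0 ∧
            δ.1 1 0 ∈ ((t * m : Ideal (𝓞 K)) : FractionalIdeal (𝓞 K)⁰ K)} ∪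
         {δ : GL (Fin 2) K | δ.1 0 1 = 0 ∧ δ.1 1 0 = 0 ∧ δ.1 1 1 = 1 ∧
            ∃ u : (𝓞 K)ˣ, algebraMap (𝓞 K) K u = δ.1 0 0})) ∧
    (∀ γ : GL (Fin 2) K,
      (∃ a : 𝓞 K, algebraMap (𝓞 K) K a = γ.1 0 0) →
      γ.1 0 1 ∈ ((t : FractionalIdeal (𝓞 K)⁰ K))⁻¹ →
      γ.1 1 0 ∈ ((t * t * m : Ideal (𝓞 K)) : FractionalIdeal (𝓞 K)⁰ K) →
      γ.1 1 1 - 1 ∈ ((t * m : Ideal (𝓞 K)) : FractionalIdeal (𝓞 K)⁰ K) →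
      (∃ u : (𝓞 K)ˣ, algebraMap (𝓞 K) K u = γ.1 0 0 * γ.1 1 1 - γ.1 0 1 * γ.1 1 0 ∧
        ∀ φ : K →+* ℝ, 0 < φ (algebraMap (𝓞 K) K u)) →
      γ ∈ Subgroup.closure
        ({δ : GL (Fin 2) K | δ.1 0 0 = 1 ∧ δ.1 1 1 = 1 ∧ δ.1 1 0 = 0 ∧
            δ.1 0 1 ∈ ((t : FractionalIdeal (𝓞 K)⁰ K))⁻¹} ∪
         {δ : GL (Fin 2) K | δ.1 0 0 = 1 ∧ δ.1 1 1 = 1 ∧ δ.1 0 1 = 0 ∧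
            δ.1 1 0 ∈ ((t * m : Ideal (𝓞 K)) : FractionalIdeal (𝓞 K)⁰ K)} ∪
         {δ : GL (Fin 2) K | δ.1 0 1 = 0 ∧ δ.1 1 0 = 0 ∧ δ.1 1 1 = 1 ∧
            ∃ u : (𝓞 K)ˣ, algebraMap (𝓞 K) K u = δ.1 0 0 ∧
              ∀ φ : K →+* ℝ, 0 < φ (algebraMap (𝓞 K) K u)})) := by
  refine ⟨fun γ ha hb hc hd hdet => ?_, fun γ ha hb hc hd hdet => ?_⟩
  · obtain ⟨u, hu⟩ := hdet
    refine VL.finGL hdeg hreal t m ht hm _ ?_ ?_ u ?_ γ ha hb hc hd hu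
    · exact fun δ h1 h2 h3 h4 => Subgroup.subset_closure (Or.inl (Or.inl ⟨h1, h2, h3, h4⟩))
    · exact fun δ h1 h2 h3 h4 => Subgroup.subset_closure (Or.inl (Or.inr ⟨h1, h2, h3, h4⟩))
    · exact fun δ h1 h2 h3 h4 => Subgroup.subset_closure (Or.inr ⟨h1, h2, h3, u, h4⟩)
  · obtain ⟨u, hu, hpos⟩ := hdet
    refine VL.finGL hdeg hreal t m ht hm _ ?_ ?_ u ?_ γ ha hb hc hd hu
    · exact fun δ h1 h2 h3 h4 => Subgroup.subset_closure (Or.inl (Or.inl ⟨h1, h2, h3, h4⟩))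
    · exact fun δ h1 h2 h3 h4 => Subgroup.subset_closure (Or.inl (Or.inr ⟨h1, h2, h3, h4⟩))
    · exact fun δ h1 h2 h3 h4 => Subgroup.subset_closure (Or.inr ⟨h1, h2, h3, u, h4, hpos⟩)
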